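/- arXiv:0911.0948 — 3 statements merged into one kernel-verified Lean document; each statement's English description precedes it below -/
import Mathlib

section
/- Let n ≥ 3 and let a > 0. Then for every radial u ∈ C_c^∞(B_1), ∫_{B_1} |∇u|² dx ≥ ((n-2)/2)² ∫_{B_1} u²/|x|² dx + (n-2)^{-2(n-1)/n} S_n · ( ∫_{B_1} X_1(a,|x|)^{2(n-1)/(n-2)} |u|^{2n/(n-2)} dx )^{(n-2)/n}. -/
open MeasureTheory Real

/-- The best Sobolev constant `S_n = π n (n-2) (Γ(n/2)/Γ(n))^(2/n)`. -/
noncomputable def sobolevConst (n : ℕ) : ℝ :=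
  Real.pi * n * ((n : ℝ) - 2) * (Real.Gamma ((n : ℝ) / 2) / Real.Gamma (n : ℝ)) ^ (2 / (n : ℝ))

/-- `X_1(a,s) = (a - ln s)⁻¹`. -/
noncomputable def X1 (a s : ℝ) : ℝ := (a - Real.log s)⁻¹

lemma integral_rpow_mul_sqrt_one_sub {α : ℝ} (hα : 0 < α) :
    ∫ z in (0 : ℝ)..1, z ^ (α - 1) * √(1 - z) = Gamma α * Gamma (3 / 2) / Gamma (α + 3 / 2) := by
  have h := ProbabilityTheory.beta_eq_betaIntegralReal α (3 / 2) hα (by norm_num)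
  rw [ProbabilityTheory.beta] at h
  rw [h, Complex.betaIntegral]
  have : ∀ z ∈ Set.uIcc (0 : ℝ) 1, ((z : ℂ) ^ ((α : ℂ) - 1) * (1 - (z : ℂ)) ^ (((3 / 2 : ℝ) : ℂ) - 1))
      = ((z ^ (α - 1) * √(1 - z) : ℝ) : ℂ) := by
    intro z hz
    rw [Set.uIcc_of_le zero_le_one] at hz
    have h1 : 0 ≤ 1 - z := by linarith [hz.2]
    rw [Real.sqrt_eq_rpow, show (1 / 2 : ℝ) = 3 / 2 - 1 by norm_num]
    push_cast [Complex.ofReal_cpow hz.1, Complex.ofReal_cpow h1]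
    rfl
  rw [intervalIntegral.integral_congr this, intervalIntegral.integral_ofReal, Complex.ofReal_re]

lemma setIntegral_Ioi_eq_intervalIntegral {f : ℝ → ℝ} (hf : ∀ y, 1 ≤ y → f y = 0) :
    ∫ y in Set.Ioi (0 : ℝ), f y = ∫ y in (0 : ℝ)..1, f y := by
  rw [intervalIntegral.integral_of_le zero_le_one]
  refine (setIntegral_eq_of_subset_of_forall_sdiff_eq_zero measurableSet_Ioi
    Set.Ioc_subset_Ioi_self fun y hy ↦ hf y ?_)
  by_contra! h
  exact hy.2 ⟨hy.1, h.le⟩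

lemma integral_mul_sqrt_one_sub_rpow {s : ℝ} (hs : 0 < s) :
    ∫ y in (0 : ℝ)..1, y * √(1 - y ^ s) =
      s⁻¹ * (Gamma (2 / s) * Gamma (3 / 2) / Gamma (2 / s + 3 / 2)) := by
  rw [← integral_rpow_mul_sqrt_one_sub (div_pos two_pos hs),
    ← setIntegral_Ioi_eq_intervalIntegral, ← setIntegral_Ioi_eq_intervalIntegral,
    ← integral_comp_rpow_Ioi_of_pos (g := fun z ↦ z ^ (2 / s - 1) * √(1 - z)) hs,
    ← integral_const_mul]
  · refine setIntegral_congr_fun measurableSet_Ioi fun y hy ↦ ?_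
    have hy : 0 < y := hy
    simp only [smul_eq_mul]
    have : y ^ (s - 1) * y ^ (s * (2 / s - 1)) = y := by
      rw [← rpow_add hy, show s - 1 + s * (2 / s - 1) = 1 by field_simp; ring, rpow_one]
    rw [← rpow_mul hy.le, ← mul_assoc, ← mul_assoc, ← mul_assoc, inv_mul_cancel₀ hs.ne', one_mul,
      this]
  · intro y hy
    rw [sqrt_eq_zero_of_nonpos (by linarith), mul_zero]
  · intro y hy
    rw [sqrt_eq_zero_of_nonpos (by linarith [one_le_rpow hy hs.le]), mul_zero]

/-- The sharp one-dimensional constant raised to the power `n / 2`. -/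
lemma gamma_identity {n : ℝ} (hn : 2 < n) :
    (n / (4 * (n - 2))) ^ ((n - 2) / 2) *
      (n * (n * (√π ^ n / Gamma (n / 2 + 1))) *
        ((4 / (n - 2))⁻¹ * (Gamma (2 / (4 / (n - 2))) * Gamma (3 / 2) /
          Gamma (2 / (4 / (n - 2)) + 3 / 2)))) =
    (n - 2) ^ (-(n - 1)) * ((π * n * (n - 2)) ^ (n / 2) * (Gamma (n / 2) / Gamma n)) := by
  have h2 : 0 < n - 2 := by linarith
  have hn0 : 0 < n := by linarith
  have e1 : 2 / (4 / (n - 2)) = n / 2 - 1 := by field_simp; ring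
  have e2 : n / 2 - 1 + 3 / 2 = n / 2 + 1 / 2 := by ring
  have g1 : Gamma (n / 2) = (n / 2 - 1) * Gamma (n / 2 - 1) := by
    rw [← Gamma_add_one (by linarith : n / 2 - 1 ≠ 0)]; ring_nf
  have g2 : Gamma (n / 2 + 1) = n / 2 * Gamma (n / 2) := Gamma_add_one (by positivity)
  have g3 : Gamma (3 / 2) = √π / 2 := by
    rw [show (3 / 2 : ℝ) = 1 / 2 + 1 by norm_num, Gamma_add_one (by norm_num), Gamma_one_half_eq]
    ring
  have g4 := Gamma_mul_Gamma_add_half (n / 2)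
  rw [show 2 * (n / 2) = n by ring] at g4
  have p1 : 0 < Gamma (n / 2) := Gamma_pos_of_pos (by positivity)
  have p2 : 0 < Gamma (n / 2 + 1 / 2) := Gamma_pos_of_pos (by positivity)
  have p3 : 0 < Gamma n := Gamma_pos_of_pos hn0
  have p4 : 0 < Gamma (n / 2 - 1) := Gamma_pos_of_pos (by linarith)
  have hpi : √π ^ n = π ^ (n / 2) := by
    rw [sqrt_eq_rpow, ← rpow_mul pi_pos.le]; ring_nf
  have hπ := sqrt_pos.2 pi_pos
  rw [e1, e2, hpi, g2, g3, div_rpow hn0.le (by positivity), mul_rpow (by norm_num) h2.le,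
    mul_rpow (by positivity) h2.le, mul_rpow pi_pos.le hn0.le]
  have q1 : n ^ (n / 2) = n ^ ((n - 2) / 2) * n := by
    rw [← rpow_add_one hn0.ne']; ring_nf
  have q2 : (4 : ℝ) ^ ((n - 2) / 2) = 2 ^ (n - 2) := by
    rw [show (4 : ℝ) = 2 ^ (2 : ℝ) by norm_num, ← rpow_mul two_pos.le]; ring_nf
  have q3 : (n - 2) ^ (-(n - 1)) * (n - 2) ^ (n / 2) * (n - 2) ^ ((n - 2) / 2) = 1 := by
    rw [← rpow_add h2, ← rpow_add h2]; ring_nf; exact rpow_zero _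
  have q4 : (2 : ℝ) ^ (1 - n) * 2 ^ (n - 2) = 1 / 2 := by
    rw [← rpow_add two_pos, show 1 - n + (n - 2) = -1 by ring, rpow_neg_one]; norm_num
  rw [q1, q2]
  have r1 : 0 < (n - 2) ^ ((n - 2) / 2) := by positivity
  have r2 : 0 < (2 : ℝ) ^ (n - 2) := by positivity
  generalize (n - 2) ^ (-(n - 1)) = A at *
  generalize (n - 2) ^ (n / 2) = B at *
  generalize (n - 2) ^ ((n - 2) / 2) = C at *
  generalize (2 : ℝ) ^ (1 - n) = D at *
  generalize (2 : ℝ) ^ (n - 2) = E at *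
  generalize n ^ ((n - 2) / 2) = F at *
  generalize π ^ (n / 2) = P at *
  have hAB : A * B = 1 / C := by field_simp; linarith
  have hD : D = 1 / (2 * E) := by field_simp; linarith
  have h5 : Gamma (n / 2 + 1 / 2) = Gamma n * (1 / (2 * E)) * √π / Gamma (n / 2) := by
    rw [← hD]
    exact eq_div_of_mul_eq p1.ne' (by linarith)
  trans A * B * (P * F * n * Gamma (n / 2) / Gamma n)
  · rw [hAB, h5]
    have h6 : Gamma (n / 2 - 1) = Gamma (n / 2) / (n / 2 - 1) := by
      have : n / 2 - 1 ≠ 0 := by linarith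
      field_simp at g1 ⊢
      linarith
    have : n / 2 - 1 = (n - 2) / 2 := by ring
    rw [h6, this]
    field_simp
    norm_num
  · ring

/-- The slope field `x ↦ |x| √(1 - (|x| / m) ^ s)`, twice the square root of the zero-energy
potential whose turning point is `m`. -/
noncomputable def turningSlope (s m x : ℝ) : ℝ := |x| * √(1 - (|x| / m) ^ s)

/-- The primitive of `turningSlope` vanishing at the origin. -/
noncomputable def turningPrimitive (s m y : ℝ) : ℝ := ∫ x in (0 : ℝ)..y, turningSlope s m x

/-- The Emden-Fowler variable attached to the radial profile `U`. -/
noncomputable def emdenFowler (a k : ℝ) (U : ℝ → ℝ) (r : ℝ) : ℝ := r ^ k * U r * √(X1 a r)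

lemma continuous_turningSlope {s : ℝ} (hs : 0 < s) (m : ℝ) : Continuous (turningSlope s m) := by
  unfold turningSlope
  have : Continuous fun x : ℝ ↦ (|x| / m) ^ s :=
    (continuous_abs.div_const m).rpow_const fun _ ↦ Or.inr hs.le
  fun_prop

lemma hasDerivAt_turningPrimitive {s : ℝ} (hs : 0 < s) (m y : ℝ) :
    HasDerivAt (turningPrimitive s m) (turningSlope s m y) y :=
  (continuous_turningSlope hs m).integral_hasStrictDerivAt 0 y |>.hasDerivAt

lemma turningPrimitive_zero (s m : ℝ) : turningPrimitive s m 0 = 0 := by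
  simp [turningPrimitive]

lemma turningPrimitive_self (s : ℝ) {m : ℝ} (hm : 0 < m) :
    turningPrimitive s m m = m ^ 2 * ∫ y in (0 : ℝ)..1, y * √(1 - y ^ s) := by
  have h := intervalIntegral.integral_comp_mul_left (a := 0) (b := 1) (turningSlope s m) hm.ne'
  simp only [mul_zero, mul_one, smul_eq_mul] at h
  rw [turningPrimitive, ← mul_inv_cancel_left₀ hm.ne' (∫ x in (0 : ℝ)..m, _), ← h, pow_two, mul_assoc]
  congr 1
  rw [← intervalIntegral.integral_const_mul]
  refine intervalIntegral.integral_congr fun y hy ↦ ?_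
  rw [Set.uIcc_of_le zero_le_one] at hy
  simp only [turningSlope]
  rw [abs_of_nonneg (mul_nonneg hm.le hy.1), mul_div_cancel_left₀ y hm.ne', mul_assoc]

lemma turningSlope_sq {s m x : ℝ} (hs : 0 < s) (hm : 0 < m) (hx : |x| ≤ m) :
    turningSlope s m x ^ 2 = x ^ 2 - m ^ (-s) * |x| ^ (s + 2) := by
  have h1 : (|x| / m) ^ s ≤ 1 := rpow_le_one (by positivity) ((div_le_one hm).2 hx) hs.le
  rw [turningSlope, mul_pow, sq_sqrt (by linarith), sq_abs, div_rpow (abs_nonneg x) hm.le,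
    rpow_neg hm.le, rpow_add_of_nonneg (abs_nonneg x) hs.le zero_le_two, rpow_two, sq_abs]
  ring

lemma X1_pos {a r : ℝ} (ha : 0 < a) (h0 : 0 ≤ r) (h1 : r ≤ 1) : 0 < X1 a r := by
  have := log_nonpos h0 h1
  exact inv_pos.2 (by linarith)

lemma X1_le {a r : ℝ} (ha : 0 < a) (h0 : 0 ≤ r) (h1 : r ≤ 1) : X1 a r ≤ a⁻¹ := by
  have := log_nonpos h0 h1
  exact inv_anti₀ ha (by linarith)

lemma measurable_X1 (a : ℝ) : Measurable (X1 a) :=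
  (measurable_const.sub measurable_log).inv

lemma hasDerivAt_X1 {a r : ℝ} (ha : 0 < a) (h0 : 0 < r) (h1 : r ≤ 1) :
    HasDerivAt (X1 a) (X1 a r ^ 2 / r) r := by
  have h := log_nonpos h0.le h1
  have hd := ((hasDerivAt_log h0.ne').const_sub a).inv (by linarith)
  refine hd.congr_deriv ?_
  simp only [X1]
  field_simp

lemma hasDerivAt_emdenFowler {a k r U' : ℝ} {U : ℝ → ℝ} (ha : 0 < a) (h0 : 0 < r) (h1 : r ≤ 1)
    (hU : HasDerivAt U U' r) :
    HasDerivAt (emdenFowler a k U)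
      ((k * r ^ k / r * U r + r ^ k * U') * √(X1 a r) +
        r ^ k * U r * (√(X1 a r) ^ 3 / (2 * r))) r := by
  have hX := X1_pos ha h0.le h1
  have hd := (((hasDerivAt_rpow_const (p := k) (Or.inl h0.ne')).mul hU).mul
    ((hasDerivAt_X1 ha h0 h1).sqrt hX.ne'))
  refine hd.congr_deriv ?_
  have hs := sqrt_pos.2 hX
  have e : X1 a r ^ 2 = √(X1 a r) ^ 4 := by
    rw [show √(X1 a r) ^ 4 = (√(X1 a r) ^ 2) ^ 2 by ring, sq_sqrt hX.le]
  rw [e, rpow_sub_one h0.ne', Pi.mul_apply]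
  field_simp

lemma continuousOn_emdenFowler {a k : ℝ} {U : ℝ → ℝ} (ha : 0 < a) (hk : 0 < k)
    (hU : Continuous U) : ContinuousOn (emdenFowler a k U) (Set.Icc 0 1) := by
  intro r hr
  rcases hr.1.eq_or_lt with rfl | h0
  · have hz : emdenFowler a k U 0 = 0 := by simp [emdenFowler, zero_rpow hk.ne']
    rw [ContinuousWithinAt, hz]
    have hlim : Filter.Tendsto (fun r : ℝ ↦ r ^ k * |U r| * √(a⁻¹)) (nhdsWithin 0 (Set.Icc 0 1))
        (nhds 0) := by
      have : Continuous fun r : ℝ ↦ r ^ k * |U r| * √(a⁻¹) :=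
        ((continuous_id.rpow_const fun _ ↦ Or.inr hk.le).mul hU.abs).mul continuous_const
      simpa [zero_rpow hk.ne'] using (this.tendsto 0).mono_left nhdsWithin_le_nhds
    refine squeeze_zero_norm' ?_ hlim
    filter_upwards [self_mem_nhdsWithin] with x hx
    rw [emdenFowler, norm_eq_abs, abs_mul, abs_mul, abs_of_nonneg (rpow_nonneg hx.1 k),
      abs_of_nonneg (sqrt_nonneg _)]
    exact mul_le_mul_of_nonneg_left (sqrt_le_sqrt (X1_le ha hx.1 hx.2))
      (mul_nonneg (rpow_nonneg hx.1 k) (abs_nonneg _))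
  · have hX : ContinuousAt (fun r ↦ √(X1 a r)) r :=
      (hasDerivAt_X1 ha h0 hr.2).continuousAt.sqrt
    exact (((continuousAt_rpow_const r k (Or.inl h0.ne')).mul hU.continuousAt).mul
      hX).continuousWithinAt

/-- The calibration whose derivative is dominated by the Hardy-Sobolev deficit density. -/
noncomputable def calibration (a k s m ε : ℝ) (U : ℝ → ℝ) (r : ℝ) : ℝ :=
  ε * turningPrimitive s m (emdenFowler a k U r) - emdenFowler a k U r ^ 2 / 2 -
    k * (r ^ k * U r) ^ 2

/-- The density of the radial energy minus the Hardy term and a multiple of the weighted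
critical power. -/
noncomputable def deficitDensity (a k s m : ℝ) (U : ℝ → ℝ) (r : ℝ) : ℝ :=
  deriv U r ^ 2 * r ^ (2 * k + 1) - k ^ 2 * (U r ^ 2 * r ^ (2 * k - 1)) -
    m ^ (-s) / 4 * (r ^ (2 * k + 1) * (X1 a r ^ (s / 2 + 2) * |U r| ^ (s + 2)))

lemma emdenFowler_rpow {a k s r : ℝ} (U : ℝ → ℝ) (ha : 0 < a) (hks : k * s = 2)
    (h0 : 0 < r) (h1 : r ≤ 1) :
    |emdenFowler a k U r| ^ (s + 2) * X1 a r / r =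
      r ^ (2 * k + 1) * (X1 a r ^ (s / 2 + 2) * |U r| ^ (s + 2)) := by
  have hX := X1_pos ha h0.le h1
  have hr := rpow_nonneg h0.le k
  rw [emdenFowler, abs_mul, abs_mul, abs_of_nonneg hr, abs_of_nonneg (sqrt_nonneg _),
    mul_rpow (by positivity) (sqrt_nonneg _), mul_rpow hr (abs_nonneg _), sqrt_eq_rpow,
    ← rpow_mul hX.le, ← rpow_mul h0.le, show k * (s + 2) = 2 * k + 1 + 1 by linarith,
    rpow_add_one h0.ne', show s / 2 + 2 = 1 / 2 * (s + 2) + 1 by ring, rpow_add_one hX.ne']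
  field_simp

lemma hasDerivAt_calibration_le {a k s m ε r : ℝ} {U : ℝ → ℝ} (ha : 0 < a) (hs : 0 < s)
    (hks : k * s = 2) (hm : 0 < m) (hε : ε ^ 2 = 1) (h0 : 0 < r) (h1 : r ≤ 1)
    (hU : DifferentiableAt ℝ U r) (hle : |emdenFowler a k U r| ≤ m) :
    ∃ d, HasDerivAt (calibration a k s m ε U) d r ∧ d ≤ deficitDensity a k s m U r := by
  have hφ := hasDerivAt_emdenFowler (k := k) ha h0 h1 hU.hasDerivAt
  have hv := (hasDerivAt_rpow_const (p := k) (Or.inl h0.ne')).mul hU.hasDerivAt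
  have hΨ := (hasDerivAt_turningPrimitive hs m (emdenFowler a k U r)).comp r hφ
  refine ⟨_, ((hΨ.const_mul ε).sub ((hφ.pow 2).div_const 2)).sub ((hv.pow 2).const_mul k), ?_⟩
  have hX := X1_pos ha h0.le h1
  have hsq := turningSlope_sq hs hm hle
  rw [deficitDensity, ← emdenFowler_rpow U ha hks h0 h1]
  have hℓ := sqrt_pos.2 hX
  have hℓ2 : X1 a r = √(X1 a r) ^ 2 := (sq_sqrt hX.le).symm
  have hφe : emdenFowler a k U r = r ^ k * U r * √(X1 a r) := rfl
  have e1 : r ^ (2 * k + 1) = (r ^ k) ^ 2 * r := by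
    rw [rpow_add_one h0.ne', two_mul, rpow_add h0, sq]
  have e2 : r ^ (2 * k - 1) = (r ^ k) ^ 2 / r := by
    rw [rpow_sub_one h0.ne', two_mul, rpow_add h0, sq]
  rw [e1, e2, rpow_sub_one h0.ne']
  have e3 : m ^ (-s) * |emdenFowler a k U r| ^ (s + 2) =
    emdenFowler a k U r ^ 2 - turningSlope s m (emdenFowler a k U r) ^ 2 := by linarith
  rw [show m ^ (-s) / 4 * (|emdenFowler a k U r| ^ (s + 2) * X1 a r / r) =
    m ^ (-s) * |emdenFowler a k U r| ^ (s + 2) * X1 a r / r / 4 by ring, e3]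
  simp only [Pi.mul_apply]
  generalize turningSlope s m (emdenFowler a k U r) = h
  rw [hφe, hℓ2]
  generalize √(X1 a r) = x at *
  rw [sqrt_sq hℓ.le]
  generalize r ^ k = R
  generalize U r = w
  generalize deriv U r = w'
  rw [← sub_nonneg]
  have key : 0 ≤ r / x ^ 2 * ((k * R / r * w + R * w') * x + R * w * (x ^ 3 / (2 * r)) -
    ε * h * x ^ 2 / (2 * r)) ^ 2 := by positivity
  refine key.trans_eq ?_
  field_simp
  ring_nf
  simp only [hε]
  ring

lemma continuousOn_calibration {a k s m ε : ℝ} {U : ℝ → ℝ} (ha : 0 < a) (hk : 0 < k) (hs : 0 < s)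
    (hU : Continuous U) : ContinuousOn (calibration a k s m ε U) (Set.Icc 0 1) := by
  have h1 := continuousOn_emdenFowler ha hk hU
  have h2 : Continuous (turningPrimitive s m) :=
    continuous_iff_continuousAt.2 fun y ↦ (hasDerivAt_turningPrimitive hs m y).continuousAt
  have h3 : Continuous fun r : ℝ ↦ r ^ k := continuous_id.rpow_const fun _ ↦ Or.inr hk.le
  exact ((continuousOn_const.mul (h2.comp_continuousOn h1)).sub ((h1.pow 2).div_const 2)).sub
    (continuousOn_const.mul ((h3.mul hU).pow 2).continuousOn)

lemma turningPrimitive_le_integral {a k s m r₀ : ℝ} {U : ℝ → ℝ} (ha : 0 < a) (hk : 0 < k)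
    (hks : k * s = 2) (hU : Differentiable ℝ U) (hU1 : U 1 = 0) (hr₀ : r₀ ∈ Set.Icc (0 : ℝ) 1)
    (hm : 0 < m) (hmax : emdenFowler a k U r₀ = m)
    (hle : ∀ r ∈ Set.Icc (0 : ℝ) 1, |emdenFowler a k U r| ≤ m)
    (hint : IntegrableOn (deficitDensity a k s m U) (Set.Icc 0 1)) :
    2 * turningPrimitive s m m ≤ ∫ r in (0 : ℝ)..1, deficitDensity a k s m U r := by
  have hs : 0 < s := by
    by_contra! h
    nlinarith
  have step : ∀ ε : ℝ, ε ^ 2 = 1 → ∀ b c : ℝ, 0 ≤ b → b ≤ c → c ≤ 1 →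
      calibration a k s m ε U c - calibration a k s m ε U b ≤
        ∫ r in b..c, deficitDensity a k s m U r := by
    intro ε hε b c hb hbc hc
    have hsub : Set.Icc b c ⊆ Set.Icc 0 1 := Set.Icc_subset_Icc hb hc
    have hd : ∀ x ∈ Set.Ioo b c, _ := fun x hx ↦ hasDerivAt_calibration_le ha hs hks hm hε
      (hb.trans_lt hx.1) (hx.2.le.trans hc) (hU x) (hle x (hsub (Set.Ioo_subset_Icc_self hx)))
    refine intervalIntegral.sub_le_integral_of_hasDeriv_right_of_le
      (g' := deriv (calibration a k s m ε U)) hbc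
      ((continuousOn_calibration ha hk hs hU.continuous).mono hsub) (fun x hx ↦ ?_)
      (hint.mono_set hsub) fun x hx ↦ ?_
    · obtain ⟨d, h, -⟩ := hd x hx
      exact h.differentiableAt.hasDerivAt.hasDerivWithinAt
    · obtain ⟨d, h, h'⟩ := hd x hx
      exact h.deriv.trans_le h'
  have hi : IntervalIntegrable (deficitDensity a k s m U) volume 0 1 :=
    (intervalIntegrable_iff_integrableOn_Icc_of_le zero_le_one).2 hint
  have hmem : r₀ ∈ Set.uIcc (0 : ℝ) 1 := by rwa [Set.uIcc_of_le zero_le_one]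
  rw [← intervalIntegral.integral_add_adjacent_intervals
    (hi.mono_set (Set.uIcc_subset_uIcc_left hmem)) (hi.mono_set (Set.uIcc_subset_uIcc_right hmem))]
  have i1 := step 1 (by norm_num) 0 r₀ le_rfl hr₀.1 hr₀.2
  have i2 := step (-1) (by norm_num) r₀ 1 hr₀.1 hr₀.2 le_rfl
  have z0 : emdenFowler a k U 0 = 0 := by simp [emdenFowler, zero_rpow hk.ne']
  have z1 : emdenFowler a k U 1 = 0 := by simp [emdenFowler, hU1]
  simp only [calibration, z0, z1, hmax, turningPrimitive_zero, hU1, zero_rpow hk.ne'] at i1 i2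
  have : 0 ≤ k * (r₀ ^ k * U r₀) ^ 2 := by positivity
  linarith

lemma mul_rpow_mul_rpow_le {n m A B : ℝ} (hn : 2 < n) (hm : 0 < m) (hA : 0 ≤ A) (hB : 0 ≤ B) :
    (n / (4 * (n - 2)) * A) ^ ((n - 2) / n) * (n * B) ^ (2 / n) ≤
      m ^ (-(4 / (n - 2))) / 4 * A + 2 * (m ^ 2 * B) := by
  have h2 : 0 < n - 2 := by linarith
  have hn0 : 0 < n := by linarith
  have hms := rpow_pos_of_pos hm (-(4 / (n - 2)))
  have h := geom_mean_le_arith_mean2_weighted (w₁ := (n - 2) / n) (w₂ := 2 / n)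
    (p₁ := m ^ (-(4 / (n - 2))) * (n / (4 * (n - 2)) * A)) (p₂ := m ^ (2 : ℝ) * (n * B))
    (by positivity) (by positivity) (by positivity) (by positivity) (by field_simp; ring)
  rw [mul_rpow hms.le (by positivity), mul_rpow (rpow_nonneg hm.le _) (by positivity),
    ← rpow_mul hm.le, ← rpow_mul hm.le] at h
  have e : m ^ (-(4 / (n - 2)) * ((n - 2) / n)) * m ^ (2 * (2 / n)) = 1 := by
    rw [← rpow_add hm, show -(4 / (n - 2)) * ((n - 2) / n) + 2 * (2 / n) = 0 by field_simp; ring,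
      rpow_zero]
  calc _ = m ^ (-(4 / (n - 2)) * ((n - 2) / n)) * m ^ (2 * (2 / n)) *
        ((n / (4 * (n - 2)) * A) ^ ((n - 2) / n) * (n * B) ^ (2 / n)) := by rw [e, one_mul]
    _ ≤ (n - 2) / n * (m ^ (-(4 / (n - 2))) * (n / (4 * (n - 2)) * A)) +
        2 / n * (m ^ (2 : ℝ) * (n * B)) := by convert h using 1; ring
    _ = _ := by rw [rpow_two]; field_simp

lemma integrableOn_weighted_power {a p q : ℝ} {U : ℝ → ℝ} (ha : 0 < a) (hp : 0 ≤ p) (hq : 0 ≤ q)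
    (hU : Continuous U) (d : ℕ) :
    IntegrableOn (fun r ↦ r ^ d * (X1 a r ^ p * |U r| ^ q)) (Set.Icc (0 : ℝ) 1) := by
  have hc : Continuous fun r ↦ r ^ d * ((a⁻¹) ^ p * |U r| ^ q) :=
    (continuous_id.pow d).mul
      (continuous_const.mul (hU.abs.rpow_const fun _ ↦ Or.inr hq))
  have hmeas : Measurable fun r ↦ r ^ d * (X1 a r ^ p * |U r| ^ q) :=
    (measurable_id.pow_const d).mul (((measurable_X1 a).pow_const p).mul
      (hU.abs.rpow_const fun _ ↦ Or.inr hq).measurable)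
  refine Integrable.mono' (hc.continuousOn.integrableOn_compact isCompact_Icc)
    hmeas.aestronglyMeasurable ?_
  filter_upwards [ae_restrict_mem measurableSet_Icc] with r hr
  have hX := X1_pos ha hr.1 hr.2
  have hr0 := hr.1
  rw [norm_eq_abs, abs_of_nonneg (by positivity)]
  gcongr
  exact X1_le ha hr.1 hr.2

lemma pow_mul_sq_div_sq {n : ℕ} (hn : 3 ≤ n) {r : ℝ} (hr : r ≠ 0) (w : ℝ) :
    r ^ (n - 1) * (w ^ 2 / r ^ 2) = r ^ (n - 3) * w ^ 2 := by
  obtain ⟨d, rfl⟩ := Nat.exists_eq_add_of_le' hn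
  rw [show d + 3 - 1 = d + 2 by omega, show d + 3 - 3 = d by omega, pow_add]
  field_simp

lemma integral_deficitDensity {n : ℕ} (hn : 3 ≤ n) {a m : ℝ} (ha : 0 < a) {U : ℝ → ℝ}
    (hU : ContDiff ℝ 1 U) :
    IntegrableOn (deficitDensity a (((n : ℝ) - 2) / 2) (4 / ((n : ℝ) - 2)) m U) (Set.Icc 0 1) ∧
    ∫ r in (0 : ℝ)..1, deficitDensity a (((n : ℝ) - 2) / 2) (4 / ((n : ℝ) - 2)) m U r =
      (∫ r in (0 : ℝ)..1, r ^ (n - 1) * deriv U r ^ 2) -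
        (((n : ℝ) - 2) / 2) ^ 2 * (∫ r in (0 : ℝ)..1, r ^ (n - 1) * (U r ^ 2 / r ^ 2)) -
        m ^ (-(4 / ((n : ℝ) - 2))) / 4 * ∫ r in (0 : ℝ)..1, r ^ (n - 1) *
          (X1 a r ^ (2 * ((n : ℝ) - 1) / ((n : ℝ) - 2)) * |U r| ^ (2 * (n : ℝ) / ((n : ℝ) - 2))) := by
  have hn3 : (3 : ℝ) ≤ n := by exact_mod_cast hn
  have h2 : 0 < (n : ℝ) - 2 := by linarith
  have hU' : Continuous (deriv U) := hU.continuous_deriv le_rfl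
  set p := 2 * ((n : ℝ) - 1) / ((n : ℝ) - 2) with hp
  set q := 2 * (n : ℝ) / ((n : ℝ) - 2) with hq
  set k := ((n : ℝ) - 2) / 2 with hk
  set s := 4 / ((n : ℝ) - 2) with hs
  have hp0 : 0 ≤ p := div_nonneg (by linarith) h2.le
  have hq0 : 0 ≤ q := by positivity
  have eq1 : s + 2 = q := by rw [hs, hq]; field_simp; ring
  have eq2 : s / 2 + 2 = p := by rw [hs, hp]; field_simp; ring
  have i1 : IntegrableOn (fun r ↦ r ^ (n - 1) * deriv U r ^ 2) (Set.Icc (0 : ℝ) 1) :=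
    ((continuous_id.pow _).mul (hU'.pow 2)).continuousOn.integrableOn_compact isCompact_Icc
  have i2 : IntegrableOn (fun r ↦ r ^ (n - 1) * (U r ^ 2 / r ^ 2)) (Set.Ioc (0 : ℝ) 1) := by
    refine IntegrableOn.congr_fun (f := fun r ↦ r ^ (n - 3) * U r ^ 2) ?_
      (fun r hr ↦ (pow_mul_sq_div_sq hn hr.1.ne' _).symm) measurableSet_Ioc
    exact (((continuous_id.pow _).mul (hU.continuous.pow 2)).continuousOn.integrableOn_compact
      isCompact_Icc).mono_set Set.Ioc_subset_Icc_self
  have i3 := integrableOn_weighted_power ha hp0 hq0 hU.continuous (n - 1)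
  have hcongr : Set.EqOn (fun r ↦ r ^ (n - 1) * deriv U r ^ 2 -
      k ^ 2 * (r ^ (n - 1) * (U r ^ 2 / r ^ 2)) -
      m ^ (-s) / 4 * (r ^ (n - 1) * (X1 a r ^ p * |U r| ^ q)))
      (deficitDensity a k s m U) (Set.Ioc 0 1) := by
    intro r hr
    have e1 : r ^ (2 * k + 1) = r ^ (n - 1) := by
      rw [← rpow_natCast, Nat.cast_sub (by omega), hk]; push_cast; ring_nf
    have e2 : r ^ (2 * k - 1) = r ^ (n - 3) := by
      rw [← rpow_natCast, Nat.cast_sub hn, hk]; push_cast; ring_nf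
    simp only [deficitDensity]
    rw [eq1, eq2, e1, e2, pow_mul_sq_div_sq hn hr.1.ne']
    ring
  have j1 := i1.mono_set Set.Ioc_subset_Icc_self
  have j3 := i3.mono_set Set.Ioc_subset_Icc_self
  constructor
  · rw [integrableOn_Icc_iff_integrableOn_Ioc]
    exact ((j1.sub (i2.const_mul _)).sub (j3.const_mul _)).congr_fun hcongr measurableSet_Ioc
  · simp only [intervalIntegral.integral_of_le zero_le_one]
    have j2 : Integrable (fun r ↦ k ^ 2 * (r ^ (n - 1) * (U r ^ 2 / r ^ 2)))
      (volume.restrict (Set.Ioc 0 1)) := i2.const_mul _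
    have j12 : Integrable (fun r ↦ r ^ (n - 1) * deriv U r ^ 2 -
      k ^ 2 * (r ^ (n - 1) * (U r ^ 2 / r ^ 2))) (volume.restrict (Set.Ioc 0 1)) :=
      Integrable.sub j1 j2
    rw [← setIntegral_congr_fun measurableSet_Ioc hcongr, integral_sub j12
      (j3.const_mul _), integral_sub j1 j2, integral_const_mul, integral_const_mul]

/-- The sharp Hardy-Sobolev inequality with logarithmic weight on the unit interval, for the
measure `r ^ (n - 1) dr`. -/
lemma interval_hardy_sobolev {n : ℕ} (hn : 3 ≤ n) {a : ℝ} (ha : 0 < a) {U : ℝ → ℝ}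
    (hU : ContDiff ℝ 1 U) (hU1 : U 1 = 0) :
    ((n : ℝ) / (4 * ((n : ℝ) - 2)) * ∫ r in (0 : ℝ)..1, r ^ (n - 1) *
        (X1 a r ^ (2 * ((n : ℝ) - 1) / ((n : ℝ) - 2)) *
          |U r| ^ (2 * (n : ℝ) / ((n : ℝ) - 2)))) ^ (((n : ℝ) - 2) / n) *
      (n * ∫ y in (0 : ℝ)..1, y * √(1 - y ^ (4 / ((n : ℝ) - 2)))) ^ (2 / (n : ℝ)) ≤
    (∫ r in (0 : ℝ)..1, r ^ (n - 1) * deriv U r ^ 2) -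
      (((n : ℝ) - 2) / 2) ^ 2 * (∫ r in (0 : ℝ)..1, r ^ (n - 1) * (U r ^ 2 / r ^ 2)) := by
  have hn3 : (3 : ℝ) ≤ n := by exact_mod_cast hn
  have h2 : 0 < (n : ℝ) - 2 := by linarith
  have hk : 0 < ((n : ℝ) - 2) / 2 := by positivity
  have hB : 0 ≤ ∫ y in (0 : ℝ)..1, y * √(1 - y ^ (4 / ((n : ℝ) - 2))) :=
    intervalIntegral.integral_nonneg zero_le_one fun y hy ↦ mul_nonneg hy.1 (sqrt_nonneg _)
  obtain ⟨r₀, hr₀, hmax⟩ := isCompact_Icc.exists_isMaxOn (Set.nonempty_Icc.2 zero_le_one)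
    (continuousOn_emdenFowler ha hk hU.continuous).abs
  have hmax : ∀ r ∈ Set.Icc (0 : ℝ) 1, |emdenFowler a (((n : ℝ) - 2) / 2) U r| ≤
    |emdenFowler a (((n : ℝ) - 2) / 2) U r₀| := hmax
  rcases eq_or_ne (emdenFowler a (((n : ℝ) - 2) / 2) U r₀) 0 with h0 | h0
  · have hz : ∀ r ∈ Set.Ioc (0 : ℝ) 1, U r = 0 := by
      intro r hr
      have := hmax r (Set.Ioc_subset_Icc_self hr)
      rw [h0, abs_zero, abs_nonpos_iff, emdenFowler, mul_eq_zero, mul_eq_zero] at this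
      have hX := sqrt_pos.2 (X1_pos ha hr.1.le hr.2)
      have hr' := rpow_pos_of_pos hr.1 (((n : ℝ) - 2) / 2)
      rcases this with (h | h) | h
      · exact absurd h hr'.ne'
      · exact h
      · exact absurd h hX.ne'
    have hq0 : 2 * (n : ℝ) / ((n : ℝ) - 2) ≠ 0 := by positivity
    have hw0 : ((n : ℝ) - 2) / n ≠ 0 := by positivity
    have z1 : ∫ r in (0 : ℝ)..1, r ^ (n - 1) * (X1 a r ^ (2 * ((n : ℝ) - 1) / ((n : ℝ) - 2)) *
          |U r| ^ (2 * (n : ℝ) / ((n : ℝ) - 2))) = 0 := by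
      rw [intervalIntegral.integral_of_le zero_le_one]
      refine setIntegral_eq_zero_of_forall_eq_zero fun r hr ↦ ?_
      rw [hz r hr, abs_zero, zero_rpow hq0, mul_zero, mul_zero]
    have z2 : ∫ r in (0 : ℝ)..1, r ^ (n - 1) * (U r ^ 2 / r ^ 2) = 0 := by
      rw [intervalIntegral.integral_of_le zero_le_one]
      refine setIntegral_eq_zero_of_forall_eq_zero fun r hr ↦ ?_
      simp [hz r hr]
    rw [z1, z2, mul_zero, zero_rpow hw0, zero_mul, mul_zero, sub_zero]
    exact intervalIntegral.integral_nonneg zero_le_one fun r hr ↦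
      mul_nonneg (pow_nonneg hr.1 _) (sq_nonneg _)
  · have hA : 0 ≤ ∫ r in (0 : ℝ)..1, r ^ (n - 1) *
        (X1 a r ^ (2 * ((n : ℝ) - 1) / ((n : ℝ) - 2)) * |U r| ^ (2 * (n : ℝ) / ((n : ℝ) - 2))) :=
      intervalIntegral.integral_nonneg zero_le_one fun r hr ↦ mul_nonneg (pow_nonneg hr.1 _)
        (mul_nonneg (rpow_nonneg (X1_pos ha hr.1 hr.2).le _) (rpow_nonneg (abs_nonneg _) _))
    have hm := abs_pos.2 h0
    set m := |emdenFowler a (((n : ℝ) - 2) / 2) U r₀| with hm_def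
    refine (mul_rpow_mul_rpow_le (by linarith) hm hA hB).trans ?_
    rw [← turningPrimitive_self _ hm, ← le_sub_iff_add_le']
    have hks : ((n : ℝ) - 2) / 2 * (4 / ((n : ℝ) - 2)) = 2 := by field_simp; norm_num
    rcases lt_or_gt_of_ne h0 with hlt | hgt
    · have hneg : ∀ r, emdenFowler a (((n : ℝ) - 2) / 2) (fun x ↦ -U x) r =
          -emdenFowler a (((n : ℝ) - 2) / 2) U r := fun r ↦ by simp [emdenFowler]
      obtain ⟨hint, heq⟩ := integral_deficitDensity (m := m) hn ha hU.neg
      have := turningPrimitive_le_integral ha hk hks (hU.neg.differentiable one_ne_zero)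
        (by simp [hU1]) hr₀ hm (by rw [hneg, hm_def, abs_of_neg hlt])
        (fun r hr ↦ by rw [hneg, abs_neg]; exact hmax r hr) hint
      refine this.trans_eq (heq.trans ?_)
      simp
    · obtain ⟨hint, heq⟩ := integral_deficitDensity (m := m) hn ha hU
      have := turningPrimitive_le_integral ha hk hks (hU.differentiable one_ne_zero) hU1 hr₀ hm
        (by rw [hm_def, abs_of_pos hgt]) hmax hint
      exact this.trans_eq heq

/-- The surface area of the unit sphere of `ℝ ^ n`. -/
noncomputable def sphereArea (n : ℝ) : ℝ := n * (√π ^ n / Gamma (n / 2 + 1))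

lemma setIntegral_ball_radial {n : ℕ} (hn : 3 ≤ n) {f : ℝ → ℝ} (hf : ∀ y, 1 ≤ y → f y = 0) :
    ∫ x in Metric.ball (0 : EuclideanSpace ℝ (Fin n)) 1, f ‖x‖ =
      sphereArea n * ∫ r in (0 : ℝ)..1, r ^ (n - 1) * f r := by
  have : Nonempty (Fin n) := ⟨⟨0, by omega⟩⟩
  rw [setIntegral_eq_integral_of_forall_compl_eq_zero, integral_fun_norm_addHaar,
    setIntegral_Ioi_eq_intervalIntegral, measureReal_def, EuclideanSpace.volume_ball]
  · have : 0 ≤ √π ^ n / Gamma ((n : ℝ) / 2 + 1) :=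
      div_nonneg (by positivity) (Gamma_pos_of_pos (by positivity)).le
    simp [sphereArea, ENNReal.toReal_ofReal this, mul_assoc]
  · intro y hy
    rw [hf y hy, smul_zero]
  · intro x hx
    exact hf _ (by simpa using hx)

lemma abs_deriv_profile_le {E : Type*} [NormedAddCommGroup E] [NormedSpace ℝ E] {u : E → ℝ}
    (hu : Differentiable ℝ u) {g : ℝ → ℝ} (hg : ∀ x, u x = g ‖x‖) {e : E} (he : ‖e‖ = 1) (x : E) :
    |deriv (fun t : ℝ ↦ u (t • e)) ‖x‖| ≤ ‖fderiv ℝ u x‖ := by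
  obtain ⟨e', he', hx⟩ : ∃ e' : E, ‖e'‖ = 1 ∧ ‖x‖ • e' = x := by
    rcases eq_or_ne x 0 with rfl | hx
    · exact ⟨e, he, by simp⟩
    · exact ⟨‖x‖⁻¹ • x, norm_smul_inv_norm hx, smul_inv_smul₀ (norm_ne_zero_iff.2 hx) x⟩
  have heq : (fun t : ℝ ↦ u (t • e)) = fun t ↦ u (t • e') := by
    funext t
    rw [hg, hg, norm_smul, norm_smul, he, he']
  have hd : HasDerivAt (fun t : ℝ ↦ u (t • e')) (fderiv ℝ u x e') ‖x‖ := by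
    have h1 : HasDerivAt (fun t : ℝ ↦ t • e') e' ‖x‖ := by
      simpa using (hasDerivAt_id ‖x‖).smul_const e'
    have h2 := (hu (‖x‖ • e')).hasFDerivAt.comp_hasDerivAt ‖x‖ h1
    rwa [hx] at h2
  rw [heq, hd.deriv, ← norm_eq_abs]
  simpa [he'] using (fderiv ℝ u x).le_opNorm e'

lemma norm_gradient_eq {E : Type*} [NormedAddCommGroup E] [InnerProductSpace ℝ E] [CompleteSpace E]
    (u : E → ℝ) (x : E) : ‖gradient u x‖ = ‖fderiv ℝ u x‖ := by
  rw [gradient, LinearIsometryEquiv.norm_map]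

lemma sobolevConst_identity {n : ℕ} (hn : 3 ≤ n) {N : ℝ} (hN : 0 ≤ N) :
    ((n : ℝ) - 2) ^ (-(2 * ((n : ℝ) - 1)) / (n : ℝ)) * sobolevConst n *
      (sphereArea n * N) ^ (((n : ℝ) - 2) / n) =
    sphereArea n * (((n : ℝ) / (4 * ((n : ℝ) - 2)) * N) ^ (((n : ℝ) - 2) / n) *
      (n * ∫ y in (0 : ℝ)..1, y * √(1 - y ^ (4 / ((n : ℝ) - 2)))) ^ (2 / (n : ℝ))) := by
  have hn3 : (3 : ℝ) ≤ n := by exact_mod_cast hn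
  have hn0 : (0 : ℝ) < n := by linarith
  have h2 : 0 < (n : ℝ) - 2 := by linarith
  have hΓ : 0 < Gamma ((n : ℝ) / 2 + 1) := Gamma_pos_of_pos (by positivity)
  have hω : 0 < sphereArea n := by
    have := sqrt_pos.2 pi_pos
    rw [sphereArea]; positivity
  have hB : 0 ≤ ∫ y in (0 : ℝ)..1, y * √(1 - y ^ (4 / ((n : ℝ) - 2))) :=
    intervalIntegral.integral_nonneg zero_le_one fun y hy ↦ mul_nonneg hy.1 (sqrt_nonneg _)
  have hid := gamma_identity (n := n) (by linarith)
  rw [← integral_mul_sqrt_one_sub_rpow (by positivity)] at hid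
  have hΓ2 : 0 ≤ Gamma ((n : ℝ) / 2) / Gamma n :=
    div_nonneg (Gamma_pos_of_pos (by positivity)).le (Gamma_pos_of_pos hn0).le
  have hB' : 0 ≤ (n : ℝ) * ∫ y in (0 : ℝ)..1, y * √(1 - y ^ (4 / ((n : ℝ) - 2))) := by positivity
  rw [show (n : ℝ) * (n * (√π ^ (n : ℝ) / Gamma ((n : ℝ) / 2 + 1))) = n * sphereArea n from rfl,
    mul_comm (n : ℝ) (sphereArea n), mul_assoc (sphereArea n)] at hid
  have hid' := congrArg (· ^ (2 / (n : ℝ))) hid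
  have hpn : 0 ≤ π * n * ((n : ℝ) - 2) := by positivity
  rw [mul_rpow (by positivity) (by positivity), mul_rpow hω.le hB',
    mul_rpow (rpow_nonneg h2.le _) (by positivity), mul_rpow (rpow_nonneg hpn _) hΓ2, ← rpow_mul (by positivity), ← rpow_mul h2.le,
    ← rpow_mul hpn, show ((n : ℝ) - 2) / 2 * (2 / n) = (n - 2) / n by field_simp,
    show (n : ℝ) / 2 * (2 / n) = 1 by field_simp, rpow_one,
    show -((n : ℝ) - 1) * (2 / n) = -(2 * (n - 1)) / n by ring] at hid'
  have hsplit : sphereArea n = sphereArea n ^ (2 / (n : ℝ)) * sphereArea n ^ (((n : ℝ) - 2) / n) := by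
    rw [← rpow_add hω, show 2 / (n : ℝ) + (n - 2) / n = 1 by field_simp; ring, rpow_one]
  rw [sobolevConst, ← hid', mul_rpow hω.le hN, mul_rpow (by positivity) hN]
  conv_rhs => rw [hsplit]
  ring

theorem stmt4 (n : ℕ) (hn : 3 ≤ n) (a : ℝ) (ha0 : 0 < a)
    (u : EuclideanSpace ℝ (Fin n) → ℝ) (hu : ContDiff ℝ (⊤ : ℕ∞) u)
    (hcs : HasCompactSupport u)
    (hsupp : tsupport u ⊆ Metric.ball (0 : EuclideanSpace ℝ (Fin n)) 1)
    (hrad : ∃ g : ℝ → ℝ, ∀ x : EuclideanSpace ℝ (Fin n), u x = g ‖x‖) :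
    (∫ x in Metric.ball (0 : EuclideanSpace ℝ (Fin n)) 1, ‖gradient u x‖ ^ 2)
      ≥ (((n : ℝ) - 2) / 2) ^ 2 *
          (∫ x in Metric.ball (0 : EuclideanSpace ℝ (Fin n)) 1, u x ^ 2 / ‖x‖ ^ 2)
        + ((n : ℝ) - 2) ^ (-(2 * ((n : ℝ) - 1)) / (n : ℝ)) * sobolevConst n *
          (∫ x in Metric.ball (0 : EuclideanSpace ℝ (Fin n)) 1,
              (X1 a ‖x‖) ^ (2 * ((n : ℝ) - 1) / ((n : ℝ) - 2)) *
                |u x| ^ (2 * (n : ℝ) / ((n : ℝ) - 2)))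
            ^ (((n : ℝ) - 2) / (n : ℝ)) := by
  obtain ⟨g, hg⟩ := hrad
  have hn3 : (3 : ℝ) ≤ n := by exact_mod_cast hn
  have h2 : 0 < (n : ℝ) - 2 := by linarith
  obtain ⟨e, he⟩ : ∃ e : EuclideanSpace ℝ (Fin n), ‖e‖ = 1 :=
    ⟨EuclideanSpace.single ⟨0, by omega⟩ 1, by simp⟩
  set U : ℝ → ℝ := fun t ↦ u (t • e) with hU_def
  have hu1 : ContDiff ℝ 1 u := hu.of_le (by exact_mod_cast le_top)
  have hU : ContDiff ℝ 1 U := hu1.comp (contDiff_id.smul contDiff_const)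
  have huU : ∀ x, u x = U ‖x‖ := fun x ↦ by
    simp only [hU_def, hg, norm_smul, he, mul_one, norm_norm]
  have hout : ∀ y : ℝ, 1 ≤ y → y • e ∉ tsupport u := fun y hy h ↦ by
    have := hsupp h
    rw [mem_ball_zero_iff, norm_smul, he, mul_one, norm_eq_abs] at this
    linarith [le_abs_self y]
  have hUz : ∀ y, 1 ≤ y → U y = 0 := fun y hy ↦
    image_eq_zero_of_notMem_tsupport (f := u) (hout y hy)
  have hU'z : ∀ y, 1 ≤ y → deriv U y = 0 := fun y hy ↦ by
    have hev : U =ᶠ[nhds y] fun _ ↦ 0 :=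
      (continuous_id.smul continuous_const).continuousAt.eventually
        (notMem_tsupport_iff_eventuallyEq.1 (hout y hy))
    rw [hev.deriv_eq, deriv_const]
  have hq0 : 2 * (n : ℝ) / ((n : ℝ) - 2) ≠ 0 := by positivity
  have hgrad : ∫ x in Metric.ball (0 : EuclideanSpace ℝ (Fin n)) 1, deriv U ‖x‖ ^ 2 ≤
      ∫ x in Metric.ball (0 : EuclideanSpace ℝ (Fin n)) 1, ‖gradient u x‖ ^ 2 := by
    simp only [norm_gradient_eq]
    have hint : ∀ f : EuclideanSpace ℝ (Fin n) → ℝ, Continuous f →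
        IntegrableOn f (Metric.ball 0 1) := fun f hf ↦
      (hf.continuousOn.integrableOn_compact (isCompact_closedBall 0 1)).mono_set
        Metric.ball_subset_closedBall
    refine setIntegral_mono
      (hint _ (((hU.continuous_deriv le_rfl).comp continuous_norm).pow 2))
      (hint _ ((hu1.continuous_fderiv one_ne_zero).norm.pow 2)) fun x ↦ ?_
    have h := abs_deriv_profile_le (hu1.differentiable one_ne_zero) hg he x
    exact sq_le_sq' (neg_le_of_abs_le h) (le_of_abs_le h)
  refine le_trans ?_ hgrad
  simp only [huU]
  rw [setIntegral_ball_radial hn (f := fun r ↦ deriv U r ^ 2) fun y hy ↦ by simp [hU'z y hy],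
    setIntegral_ball_radial hn (f := fun r ↦ U r ^ 2 / r ^ 2) fun y hy ↦ by simp [hUz y hy],
    setIntegral_ball_radial hn (f := fun r ↦ X1 a r ^ (2 * ((n : ℝ) - 1) / ((n : ℝ) - 2)) *
      |U r| ^ (2 * (n : ℝ) / ((n : ℝ) - 2))) fun y hy ↦ by
        rw [hUz y hy, abs_zero, zero_rpow hq0, mul_zero],
    sobolevConst_identity hn]
  · have hω : 0 ≤ sphereArea n := by
      have : 0 < Gamma ((n : ℝ) / 2 + 1) := Gamma_pos_of_pos (by positivity)
      rw [sphereArea]; positivity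
    have := mul_le_mul_of_nonneg_left (interval_hardy_sobolev hn ha0 hU (hUz 1 le_rfl)) hω
    linarith
  · exact intervalIntegral.integral_nonneg zero_le_one fun r hr ↦ mul_nonneg (pow_nonneg hr.1 _)
      (mul_nonneg (rpow_nonneg (X1_pos ha0 hr.1 hr.2).le _) (rpow_nonneg (abs_nonneg _) _))
end

section
/- Let n ≥ 3 and let a > 0. The constant (n-2)^{-2(n-1)/n} S_n is sharp among radial functions: for every C > (n-2)^{-2(n-1)/n} S_n there exists a nonzero radial u ∈ C_c^∞(B_1) such that ∫_{B_1} |∇u|² dx − ((n-2)/2)² ∫_{B_1} u²/|x|² dx < C · ( ∫_{B_1} X_1(a,|x|)^{2(n-1)/(n-2)} |u|^{2n/(n-2)} dx )^{(n-2)/n}. -/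
open MeasureTheory Real

/-- The beta integral in the form `∫₀^∞ y^(α-1) (1+y)^(-(α+β)) dy = Β(α,β)`. -/
theorem integral_rpow_mul_one_add_rpow {α β : ℝ} (hα : 0 < α) (hβ : 0 < β) :
    ∫ y in Set.Ioi (0 : ℝ), y ^ (α - 1) * (1 + y) ^ (-(α + β)) =
      Gamma α * Gamma β / Gamma (α + β) := by
  have hI : ∫ x in Set.Ioo (0 : ℝ) 1, x ^ (α - 1) * (1 - x) ^ (β - 1) =
      Gamma α * Gamma β / Gamma (α + β) := by
    change _ = ProbabilityTheory.beta α β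
    rw [ProbabilityTheory.beta_eq_betaIntegralReal α β hα hβ, Complex.betaIntegral,
      intervalIntegral.integral_of_le zero_le_one, ← integral_Ioc_eq_integral_Ioo,
      ← RCLike.re_eq_complex_re, ← integral_re]
    · refine setIntegral_congr_fun measurableSet_Ioc fun x hx ↦ ?_
      norm_cast
      rw [← Complex.ofReal_cpow hx.1.le, ← Complex.ofReal_cpow (by linarith [hx.2]),
        RCLike.re_eq_complex_re, Complex.re_mul_ofReal, Complex.ofReal_re]
    · have := Complex.betaIntegral_convergent (u := α) (v := β) (by simpa) (by simpa)
      rwa [intervalIntegrable_iff_integrableOn_Ioc_of_le zero_le_one] at this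
  have himg : (fun y : ℝ ↦ y / (1 + y)) '' Set.Ioi 0 = Set.Ioo 0 1 := by
    ext x
    constructor
    · rintro ⟨y, hy, rfl⟩
      have hy : 0 < y := hy
      exact ⟨by positivity, (div_lt_one (by positivity)).2 (by linarith)⟩
    · rintro ⟨h0, h1⟩
      have : 0 < 1 - x := by linarith
      exact ⟨x / (1 - x), div_pos h0 this, by field_simp; ring⟩
  have hderiv : ∀ y ∈ Set.Ioi (0 : ℝ),
      HasDerivWithinAt (fun y : ℝ ↦ y / (1 + y)) (1 / (1 + y) ^ 2) (Set.Ioi 0) y := by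
    intro y hy
    have hy : 0 < y := hy
    have := (hasDerivAt_id y).div ((hasDerivAt_id y).const_add 1) (by simp; positivity)
    refine HasDerivAt.hasDerivWithinAt ?_
    convert! this using 1
    simp
  have hinj : Set.InjOn (fun y : ℝ ↦ y / (1 + y)) (Set.Ioi 0) := by
    intro x hx y hy h
    have hx : 0 < x := hx
    have hy : 0 < y := hy
    simp only at h
    field_simp at h
    linarith
  rw [← hI, ← himg, integral_image_eq_integral_abs_deriv_smul measurableSet_Ioi hderiv hinj]
  refine setIntegral_congr_fun measurableSet_Ioi fun y hy ↦ ?_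
  have hy : 0 < y := hy
  have h1 : 0 < 1 + y := by positivity
  have e : 1 - y / (1 + y) = (1 + y)⁻¹ := by field_simp; ring
  simp only [smul_eq_mul]
  rw [abs_of_pos (by positivity), e, div_rpow hy.le h1.le, inv_rpow h1.le,
    show -(α + β) = -2 - (α - 1) - (β - 1) by ring, rpow_sub h1, rpow_sub h1, rpow_neg h1.le]
  norm_num
  field_simp

/-- The integral `∫₀^∞ t^q (1+t^p)^(-s) dt` in terms of the Gamma function. -/
theorem integral_rpow_mul_one_add_rpow_rpow {p q s : ℝ} (hp : 0 < p) (hq : 0 < (q + 1) / p)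
    (hs : 0 < s - (q + 1) / p) :
    ∫ t in Set.Ioi (0 : ℝ), t ^ q * (1 + t ^ p) ^ (-s) =
      p⁻¹ * (Gamma ((q + 1) / p) * Gamma (s - (q + 1) / p) / Gamma s) := by
  have h := integral_rpow_mul_one_add_rpow hq hs
  rw [add_sub_cancel] at h
  rw [← h, ← integral_comp_rpow_Ioi_of_pos (g := fun y ↦ y ^ ((q + 1) / p - 1) * (1 + y) ^ (-s)) hp,
    ← integral_const_mul]
  refine setIntegral_congr_fun measurableSet_Ioi fun t ht ↦ ?_
  have ht : 0 < t := ht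
  simp only [smul_eq_mul]
  have : t ^ q = t ^ (p - 1) * (t ^ p) ^ ((q + 1) / p - 1) := by
    rw [← rpow_mul ht.le, ← rpow_add ht]
    congr 1
    field_simp
    ring
  rw [this]
  field_simp

/-- The Talenti extremal in the variable `t = |x|^(-(n-2))`, where `p = 2/(n-2)`. -/
noncomputable def talentiProfile (p t : ℝ) : ℝ := t * (1 + t ^ p) ^ (-1 / p)

theorem talentiProfile_pos (p : ℝ) {t : ℝ} (ht : 0 < t) : 0 < talentiProfile p t := by
  unfold talentiProfile; positivity

theorem hasDerivAt_talentiProfile {p t : ℝ} (hp : 0 < p) (ht : 0 < t) :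
    HasDerivAt (talentiProfile p) ((1 + t ^ p) ^ (-1 / p - 1)) t := by
  have h1 : 0 < 1 + t ^ p := by positivity
  have h := (hasDerivAt_id t).mul
    (((hasDerivAt_rpow_const (p := p) (Or.inl ht.ne')).const_add 1).rpow_const
      (p := -1 / p) (Or.inl h1.ne'))
  convert! h using 1
  rw [rpow_sub_one h1.ne', rpow_sub_one ht.ne']
  simp only [id]
  field_simp
  ring

theorem contDiffAt_talentiProfile {p t : ℝ} (ht : 0 < t) :
    ContDiffAt ℝ (⊤ : ℕ∞) (talentiProfile p) t := by
  have h1 : 0 < 1 + t ^ p := by positivity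
  exact contDiffAt_id.mul
    ((contDiffAt_const.add (contDiffAt_rpow_const_of_ne ht.ne')).rpow_const_of_ne h1.ne')

/-- Logarithmic truncation of `talentiProfile` by a cutoff function `φ` at scale `K`. -/
noncomputable def truncProfile (φ : ℝ → ℝ) (p K t : ℝ) : ℝ :=
  if 0 < t then φ (log t / K) * talentiProfile p t else 0

theorem truncProfile_of_pos {φ : ℝ → ℝ} {p K t : ℝ} (ht : 0 < t) :
    truncProfile φ p K t = φ (log t / K) * talentiProfile p t := if_pos ht

theorem truncProfile_eventuallyEq {φ : ℝ → ℝ} {p K t : ℝ} (ht : 0 < t) :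
    truncProfile φ p K =ᶠ[nhds t] fun t ↦ φ (log t / K) * talentiProfile p t := by
  filter_upwards [lt_mem_nhds ht] with s hs using truncProfile_of_pos hs

theorem truncProfile_eq_zero {φ : ℝ → ℝ} {R : ℝ} (hφ : ∀ s, R < |s| → φ s = 0) {p K t : ℝ}
    (hK : 0 < K) (ht : t ∉ Set.Icc (exp (-(R * K))) (exp (R * K))) :
    truncProfile φ p K t = 0 := by
  unfold truncProfile
  split_ifs with h0
  · rw [hφ, zero_mul]
    by_contra! h
    rw [abs_div, abs_of_pos hK, div_le_iff₀ hK, abs_le] at h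
    exact ht ⟨(le_log_iff_exp_le h0).1 h.1, (log_le_iff_le_exp h0).1 h.2⟩
  · rfl

theorem hasDerivAt_truncProfile {φ : ℝ → ℝ} (hφ : Differentiable ℝ φ) {p K t : ℝ} (hp : 0 < p)
    (ht : 0 < t) :
    HasDerivAt (truncProfile φ p K)
      (deriv φ (log t / K) / K * (1 + t ^ p) ^ (-1 / p) +
        φ (log t / K) * (1 + t ^ p) ^ (-1 / p - 1)) t := by
  refine HasDerivAt.congr_of_eventuallyEq ?_ (truncProfile_eventuallyEq ht)
  have h1 : HasDerivAt (fun t ↦ φ (log t / K)) (deriv φ (log t / K) * (t⁻¹ / K)) t :=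
    HasDerivAt.comp t (hφ _).hasDerivAt ((hasDerivAt_log ht.ne').div_const K)
  convert! h1.mul (hasDerivAt_talentiProfile hp ht) using 1
  unfold talentiProfile
  field_simp

theorem contDiff_truncProfile {φ : ℝ → ℝ} (hφ : ContDiff ℝ (⊤ : ℕ∞) φ) {R : ℝ}
    (hφR : ∀ s, R < |s| → φ s = 0) {p K : ℝ} (hK : 0 < K) :
    ContDiff ℝ (⊤ : ℕ∞) (truncProfile φ p K) := by
  rw [contDiff_iff_contDiffAt]
  intro t
  rcases lt_or_ge 0 t with ht | ht
  · refine ContDiffAt.congr_of_eventuallyEq ?_ (truncProfile_eventuallyEq ht)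
    exact ((hφ.contDiffAt).comp t ((contDiffAt_log.2 ht.ne').div_const K)).mul
      (contDiffAt_talentiProfile ht)
  · refine (contDiffAt_const (c := (0 : ℝ))).congr_of_eventuallyEq ?_
    filter_upwards [gt_mem_nhds (ht.trans_lt (exp_pos (-(R * K))))] with s hs
    exact truncProfile_eq_zero hφR hK fun h ↦ hs.not_ge h.1

/-- Smooth compactly supported functions on the half line approximate the Talenti profile in
both the energy and the weighted Lebesgue integral. -/
theorem exists_contDiff_of_talentiProfile {p q r θ ω C : ℝ} (hp : 0 < p) (hr : 0 < r)
    (hθ : 0 < θ)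
    (hint : IntegrableOn (fun t ↦ t⁻¹ ^ q * talentiProfile p t ^ r) (Set.Ioi 0))
    (hlt : ω * ∫ t in Set.Ioi (0 : ℝ), ((1 + t ^ p) ^ (-1 / p - 1)) ^ 2 <
      C * (ω * ∫ t in Set.Ioi (0 : ℝ), t⁻¹ ^ q * talentiProfile p t ^ r) ^ θ) :
    ∃ v : ℝ → ℝ, ContDiff ℝ (⊤ : ℕ∞) v ∧
      (∃ b c : ℝ, 0 < b ∧ ∀ t ∉ Set.Icc b c, v t = 0) ∧
      ω * ∫ t in Set.Ioi (0 : ℝ), deriv v t ^ 2 <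
        C * (ω * ∫ t in Set.Ioi (0 : ℝ), t⁻¹ ^ q * |v t| ^ r) ^ θ := by
  let f : ContDiffBump (0 : ℝ) := ⟨1, 2, one_pos, one_lt_two⟩
  have hf : ContDiff ℝ (⊤ : ℕ∞) f := f.contDiff
  have hfd : Differentiable ℝ f := hf.differentiable (by simp)
  have hf2 : ∀ s, 2 < |s| → f s = 0 := fun s hs ↦ f.zero_of_le_dist (by simpa using hs.le)
  have hf0 : f 0 = 1 := f.one_of_mem_closedBall (by simp [f])
  have hd : Continuous (deriv f) := hf.continuous_deriv (by simp)
  obtain ⟨M, hM⟩ := f.hasCompactSupport.deriv.exists_bound_of_continuous hd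
  have hM0 : 0 ≤ M := (norm_nonneg _).trans (hM 0)
  let v : ℕ → ℝ → ℝ := fun k ↦ truncProfile f p (k + 1)
  have hk : ∀ k : ℕ, (0 : ℝ) < k + 1 := fun k ↦ by positivity
  have hvc : ∀ k, ContDiff ℝ (⊤ : ℕ∞) (v k) := fun k ↦ contDiff_truncProfile hf hf2 (hk k)
  have hlim : ∀ t : ℝ, Filter.Tendsto (fun k : ℕ ↦ log t / ((k : ℝ) + 1)) Filter.atTop (nhds 0) :=
    fun t ↦ tendsto_const_nhds.div_atTop (Filter.tendsto_atTop_add_const_right _ _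
      tendsto_natCast_atTop_atTop)
  have hflim : ∀ t : ℝ, Filter.Tendsto (fun k : ℕ ↦ f (log t / ((k : ℝ) + 1))) Filter.atTop
      (nhds 1) := fun t ↦ by
    have := (hf.continuous.tendsto 0).comp (hlim t)
    rwa [hf0] at this
  have hP : Filter.Tendsto (fun k ↦ ∫ t in Set.Ioi (0 : ℝ), t⁻¹ ^ q * |v k t| ^ r) Filter.atTop
      (nhds (∫ t in Set.Ioi (0 : ℝ), t⁻¹ ^ q * talentiProfile p t ^ r)) := by
    refine tendsto_integral_of_dominated_convergence _ (fun k ↦ ?_) hint (fun k ↦ ?_) ?_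
    · have := (hvc k).continuous.measurable
      exact Measurable.aestronglyMeasurable (by fun_prop)
    · filter_upwards [ae_restrict_mem measurableSet_Ioi] with t ht
      have ht : 0 < t := ht
      have := talentiProfile_pos p ht
      rw [norm_of_nonneg (by positivity)]
      have : |v k t| ≤ talentiProfile p t := by
        simp only [v]
        rw [truncProfile_of_pos ht, abs_mul, abs_of_pos this, abs_of_nonneg f.nonneg]
        exact mul_le_of_le_one_left this.le f.le_one
      gcongr
    · filter_upwards [ae_restrict_mem measurableSet_Ioi] with t ht
      have ht : 0 < t := ht
      have h0 := talentiProfile_pos p ht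
      refine Filter.Tendsto.const_mul _ ?_
      refine Filter.Tendsto.rpow_const ?_ (Or.inr hr.le)
      have := ((hflim t).mul_const (talentiProfile p t)).abs
      rw [one_mul, abs_of_pos h0] at this
      simpa only [v, truncProfile_of_pos ht] using this
  have hD : IntegrableOn (fun t : ℝ ↦ (M + 1) ^ 2 * (1 + t ^ p) ^ (-(2 / p))) (Set.Ioi 0) := by
    refine Integrable.const_mul ?_ _
    refine Integrable.of_integral_ne_zero ?_
    have h2 : 2 / p - (0 + 1) / p = 1 / p := by ring
    have := integral_rpow_mul_one_add_rpow_rpow (p := p) (q := 0) (s := 2 / p) hp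
      (by positivity) (by rw [h2]; positivity)
    simp only [rpow_zero, one_mul, h2] at this
    rw [this]
    have := Gamma_pos_of_pos (show 0 < (0 + 1) / p by positivity)
    have := Gamma_pos_of_pos (show 0 < 1 / p by positivity)
    have := Gamma_pos_of_pos (show 0 < 2 / p by positivity)
    positivity
  have hQ : Filter.Tendsto (fun k ↦ ∫ t in Set.Ioi (0 : ℝ), deriv (v k) t ^ 2) Filter.atTop
      (nhds (∫ t in Set.Ioi (0 : ℝ), ((1 + t ^ p) ^ (-1 / p - 1)) ^ 2)) := by
    refine tendsto_integral_of_dominated_convergence _ (fun k ↦ ?_) hD (fun k ↦ ?_) ?_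
    · exact (((hvc k).continuous_deriv (by simp)).pow 2).aestronglyMeasurable
    · filter_upwards [ae_restrict_mem measurableSet_Ioi] with t ht
      have ht : 0 < t := ht
      have h1 : 1 ≤ 1 + t ^ p := by linarith [rpow_pos_of_pos ht p]
      have h2 : (1 + t ^ p) ^ (-(2 / p)) = ((1 + t ^ p) ^ (-1 / p)) ^ 2 := by
        rw [← rpow_natCast, ← rpow_mul (by positivity)]
        congr 1
        push_cast
        ring
      rw [(hasDerivAt_truncProfile hfd hp ht).deriv, norm_pow, h2, ← mul_pow]
      refine pow_le_pow_left₀ (norm_nonneg _) ?_ 2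
      refine (norm_add_le _ _).trans ?_
      rw [add_mul]
      have h3 : (1 + t ^ p) ^ (-1 / p - 1) ≤ (1 + t ^ p) ^ (-1 / p) :=
        rpow_le_rpow_of_exponent_le h1 (by linarith)
      have h4 : 0 < (1 + t ^ p) ^ (-1 / p) := by positivity
      have h5 : 0 < (1 + t ^ p) ^ (-1 / p - 1) := by positivity
      rw [norm_mul, norm_mul, norm_of_nonneg h4.le, norm_of_nonneg h5.le,
        norm_of_nonneg f.nonneg, norm_div, norm_of_nonneg (hk k).le]
      gcongr
      · refine (div_le_self (norm_nonneg _) ?_).trans (hM _)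
        linarith [k.cast_nonneg (α := ℝ)]
      · exact f.le_one
    · filter_upwards [ae_restrict_mem measurableSet_Ioi] with t ht
      have ht : 0 < t := ht
      simp only [v, (hasDerivAt_truncProfile hfd hp ht).deriv]
      refine Filter.Tendsto.pow ?_ 2
      have h1 : Filter.Tendsto (fun k : ℕ ↦ deriv f (log t / ((k : ℝ) + 1)) / ((k : ℝ) + 1))
          Filter.atTop (nhds 0) :=
        ((hd.tendsto 0).comp (hlim t)).div_atTop (Filter.tendsto_atTop_add_const_right _ _
          tendsto_natCast_atTop_atTop)
      simpa using (h1.mul_const ((1 + t ^ p) ^ (-1 / p))).add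
        ((hflim t).mul_const ((1 + t ^ p) ^ (-1 / p - 1)))
  have hev := (hQ.const_mul ω).eventually_lt
    (((hP.const_mul ω).rpow_const (Or.inr hθ.le)).const_mul C) hlt
  obtain ⟨k, hk'⟩ := hev.exists
  exact ⟨v k, hvc k, ⟨_, _, exp_pos _, fun t ht ↦ truncProfile_eq_zero hf2 (hk k) ht⟩, hk'⟩

/-- Dilation moves the support into `(a, ∞)` without affecting the strict inequality. -/
theorem exists_dilation {q r θ ω C b c a : ℝ} {v : ℝ → ℝ} (hω : 0 < ω) (hθ : (q - 1) * θ = 1)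
    (ha : 0 < a) (hb : 0 < b) (hv : ContDiff ℝ (⊤ : ℕ∞) v) (hvs : ∀ t ∉ Set.Icc b c, v t = 0)
    (hlt : ω * ∫ t in Set.Ioi (0 : ℝ), deriv v t ^ 2 <
        C * (ω * ∫ t in Set.Ioi (0 : ℝ), t⁻¹ ^ q * |v t| ^ r) ^ θ) :
    ∃ w : ℝ → ℝ, ContDiff ℝ (⊤ : ℕ∞) w ∧
      (∃ b c : ℝ, a < b ∧ ∀ t ∉ Set.Icc b c, w t = 0) ∧
      ω * ∫ t in Set.Ioi (0 : ℝ), deriv w t ^ 2 <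
        C * (ω * ∫ t in Set.Ioi (0 : ℝ), t⁻¹ ^ q * |w t| ^ r) ^ θ := by
  set l : ℝ := b / (2 * a) with hl
  have hl0 : 0 < l := by positivity
  have hbl : b / l = 2 * a := by rw [hl]; field_simp
  refine ⟨fun t ↦ v (l * t), by fun_prop, ⟨b / l, c / l, by rw [hbl]; linarith, fun t ht ↦ ?_⟩, ?_⟩
  · refine hvs _ fun h ↦ ht ⟨?_, ?_⟩
    · rw [div_le_iff₀' hl0]; exact h.1
    · rw [le_div_iff₀' hl0]; exact h.2
  have hQ : ∫ t in Set.Ioi (0 : ℝ), deriv (fun t ↦ v (l * t)) t ^ 2 =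
      l * ∫ t in Set.Ioi (0 : ℝ), deriv v t ^ 2 := by
    have h := integral_comp_mul_left_Ioi (fun t ↦ deriv v t ^ 2) 0 hl0
    rw [mul_zero, smul_eq_mul] at h
    have hd : ∀ t, deriv (fun t ↦ v (l * t)) t = l * deriv v (l * t) := fun t ↦ by
      rw [deriv_comp_mul_left, smul_eq_mul]
    simp_rw [hd, mul_pow]
    rw [integral_const_mul, h]
    field_simp
  have hP : ∫ t in Set.Ioi (0 : ℝ), t⁻¹ ^ q * |v (l * t)| ^ r =
      l ^ (q - 1) * ∫ t in Set.Ioi (0 : ℝ), t⁻¹ ^ q * |v t| ^ r := by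
    have h := integral_comp_mul_left_Ioi (fun t ↦ t⁻¹ ^ q * |v t| ^ r) 0 hl0
    rw [mul_zero, smul_eq_mul] at h
    rw [rpow_sub_one hl0.ne', div_eq_mul_inv, mul_assoc, ← h, ← integral_const_mul]
    refine setIntegral_congr_fun measurableSet_Ioi fun t ht ↦ ?_
    have ht : 0 < t := ht
    have : 0 < l ^ q := by positivity
    rw [inv_rpow (by positivity), inv_rpow (by positivity), mul_rpow hl0.le ht.le]
    field_simp
  have h0 : 0 ≤ ∫ t in Set.Ioi (0 : ℝ), t⁻¹ ^ q * |v t| ^ r :=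
    setIntegral_nonneg measurableSet_Ioi fun t ht ↦ by
      have ht : 0 < t := ht
      positivity
  rw [hQ, hP, mul_left_comm, mul_left_comm ω (l ^ (q - 1)), mul_rpow (by positivity) (by positivity),
    ← rpow_mul hl0.le, hθ, rpow_one, mul_left_comm C]
  exact mul_lt_mul_of_pos_left hlt hl0

/-- Polar coordinates followed by the substitution `|x| = exp (a - t)`. -/
theorem integral_radial_exp {n : ℕ} (hn : 1 ≤ n) (a : ℝ) {F : EuclideanSpace ℝ (Fin n) → ℝ}
    {G : ℝ → ℝ} (hF : ∀ x, x ≠ 0 → F x = G ‖x‖) :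
    ∫ x, F x = n * volume.real (Metric.ball (0 : EuclideanSpace ℝ (Fin n)) 1) *
      ∫ t, exp (a - t) ^ n * G (exp (a - t)) := by
  have : Nonempty (Fin n) := ⟨⟨0, hn⟩⟩
  have h1 : ∫ x, F x = ∫ x : EuclideanSpace ℝ (Fin n), G ‖x‖ := by
    refine integral_congr_ae ?_
    filter_upwards [compl_mem_ae_iff.2 (measure_singleton (0 : EuclideanSpace ℝ (Fin n)))] with x hx
    exact hF x hx
  have himg : (fun t ↦ exp (a - t)) '' Set.univ = Set.Ioi 0 := by
    ext r
    constructor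
    · rintro ⟨t, -, rfl⟩
      exact exp_pos _
    · intro hr
      exact ⟨a - log r, trivial, by simp [exp_log hr]⟩
  have hderiv : ∀ t ∈ Set.univ,
      HasDerivWithinAt (fun t ↦ exp (a - t)) (-exp (a - t)) Set.univ t := fun t _ ↦ by
    have := ((hasDerivAt_id t).const_sub a).exp
    simpa using this
  have hinj : Set.InjOn (fun t ↦ exp (a - t)) Set.univ := fun s _ t _ h ↦ by
    have := exp_injective h
    linarith
  rw [h1, integral_fun_norm_addHaar, ← himg,
    integral_image_eq_integral_abs_deriv_smul MeasurableSet.univ hderiv hinj]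
  simp only [finrank_euclideanSpace, Fintype.card_fin, nsmul_eq_mul, smul_eq_mul, abs_neg, abs_exp,
    setIntegral_univ, mul_assoc]
  congr 3
  ext t
  rw [← mul_assoc, ← pow_succ', Nat.sub_add_cancel hn]

theorem norm_gradient_radial {n : ℕ} {g : ℝ → ℝ} {g' : ℝ} {x : EuclideanSpace ℝ (Fin n)}
    (hx : x ≠ 0) (hg : HasDerivAt g g' ‖x‖) : ‖gradient (fun x ↦ g ‖x‖) x‖ = |g'| := by
  have hd : DifferentiableAt ℝ (norm : EuclideanSpace ℝ (Fin n) → ℝ) x :=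
    (contDiffAt_norm ℝ hx (n := 1)).differentiableAt one_ne_zero
  have : Nontrivial (EuclideanSpace ℝ (Fin n)) := ⟨x, 0, hx⟩
  have h := hg.comp_hasFDerivAt x hd.hasFDerivAt
  have h' : fderiv ℝ (fun x : EuclideanSpace ℝ (Fin n) ↦ g ‖x‖) x = g' • fderiv ℝ norm x := h.fderiv
  rw [gradient, LinearIsometryEquiv.norm_map, h', norm_smul, norm_fderiv_norm hd, mul_one,
    norm_eq_abs]

/-- The radial function `|x|^(-(n-2)/2) v(a - ln |x|)`: the ground state substitution for the Hardy
inequality written in the logarithmic variable. -/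
noncomputable def hardyRadial (n : ℕ) (a : ℝ) (v : ℝ → ℝ) (x : EuclideanSpace ℝ (Fin n)) : ℝ :=
  ‖x‖ ^ (-(((n : ℝ) - 2) / 2)) * v (a - log ‖x‖)

section hardyRadial

variable {n : ℕ} {a b c : ℝ} {v : ℝ → ℝ}

theorem hardyRadial_eq_zero_of_lt_norm (hvs : ∀ t ∉ Set.Icc b c, v t = 0)
    {x : EuclideanSpace ℝ (Fin n)} (hx : exp (a - b) < ‖x‖) : hardyRadial n a v x = 0 := by
  have h0 : 0 < ‖x‖ := (exp_pos _).trans hx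
  have := (lt_log_iff_exp_lt h0).2 hx
  rw [hardyRadial, hvs _ fun h ↦ by linarith [h.1], mul_zero]

theorem hardyRadial_eq_zero_of_norm_lt (hab : a < b) (hvs : ∀ t ∉ Set.Icc b c, v t = 0)
    {x : EuclideanSpace ℝ (Fin n)} (hx : ‖x‖ < exp (a - c)) : hardyRadial n a v x = 0 := by
  rw [hardyRadial, hvs _ fun h ↦ ?_, mul_zero]
  rcases (norm_nonneg x).eq_or_lt with h0 | h0
  · rw [← h0, log_zero, sub_zero] at h
    linarith [h.1]
  · have := (log_lt_iff_lt_exp h0).2 hx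
    linarith [h.2]

theorem contDiff_hardyRadial (hab : a < b) (hv : ContDiff ℝ (⊤ : ℕ∞) v)
    (hvs : ∀ t ∉ Set.Icc b c, v t = 0) : ContDiff ℝ (⊤ : ℕ∞) (hardyRadial n a v) := by
  rw [contDiff_iff_contDiffAt]
  intro x
  by_cases hx : x = 0
  · refine (contDiffAt_const (c := (0 : ℝ))).congr_of_eventuallyEq ?_
    have h : ‖x‖ < exp (a - c) := by rw [hx, norm_zero]; exact exp_pos _
    filter_upwards [continuous_norm.continuousAt.eventually_lt_const h] with y hy
    exact hardyRadial_eq_zero_of_norm_lt hab hvs hy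
  · have h0 : ‖x‖ ≠ 0 := norm_ne_zero_iff.2 hx
    have hn : ContDiffAt ℝ (⊤ : ℕ∞) (norm : EuclideanSpace ℝ (Fin n) → ℝ) x := contDiffAt_norm ℝ hx
    exact (hn.rpow_const_of_ne h0).mul
      (hv.contDiffAt.comp x (contDiffAt_const.sub (hn.log h0)))

theorem tsupport_hardyRadial_subset (hvs : ∀ t ∉ Set.Icc b c, v t = 0) :
    tsupport (hardyRadial n a v) ⊆ Metric.closedBall 0 (exp (a - b)) := by
  refine closure_minimal (fun x hx ↦ ?_) Metric.isClosed_closedBall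
  rw [mem_closedBall_zero_iff]
  by_contra! h
  exact hx (hardyRadial_eq_zero_of_lt_norm hvs h)

theorem norm_gradient_hardyRadial (hv : Differentiable ℝ v) {x : EuclideanSpace ℝ (Fin n)}
    (hx : x ≠ 0) :
    ‖gradient (hardyRadial n a v) x‖ = |‖x‖ ^ (-((n : ℝ) / 2)) *
      (((n : ℝ) - 2) / 2 * v (a - log ‖x‖) + deriv v (a - log ‖x‖))| := by
  have h0 : 0 < ‖x‖ := norm_pos_iff.2 hx
  have h1 : HasDerivAt (fun r ↦ v (a - log r)) (deriv v (a - log ‖x‖) * (-‖x‖⁻¹)) ‖x‖ :=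
    HasDerivAt.comp ‖x‖ (hv _).hasDerivAt ((hasDerivAt_log h0.ne').const_sub a)
  have h2 := (hasDerivAt_rpow_const (p := -(((n : ℝ) - 2) / 2)) (Or.inl h0.ne')).mul h1
  rw [show hardyRadial n a v = fun x ↦
    ((fun r : ℝ ↦ r ^ (-(((n : ℝ) - 2) / 2))) * fun r ↦ v (a - log r)) ‖x‖ from rfl,
    norm_gradient_radial hx h2, ← abs_neg]
  congr 1
  rw [show -((n : ℝ) / 2) = -(((n : ℝ) - 2) / 2) - 1 by ring, rpow_sub_one h0.ne']
  field_simp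
  ring

end hardyRadial

theorem exp_pow_mul_rpow_mul_pow {n : ℕ} {s κ z : ℝ} {m : ℕ} (h : n + m * κ = 0) :
    exp s ^ n * (exp s ^ κ * z) ^ m = z ^ m := by
  rw [mul_pow, ← mul_assoc, ← rpow_natCast, ← rpow_natCast (exp s ^ κ), ← exp_mul, ← exp_mul,
    ← exp_mul, ← exp_add, show s * n + s * κ * m = s * (n + m * κ) by ring, h, mul_zero, exp_zero,
    one_mul]

theorem integral_mul_add_deriv_sq {v : ℝ → ℝ} (hv : ContDiff ℝ (⊤ : ℕ∞) v)
    (hc : HasCompactSupport v) (κ : ℝ) :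
    ∫ t, (κ * v t + deriv v t) ^ 2 = κ ^ 2 * (∫ t, v t ^ 2) + ∫ t, deriv v t ^ 2 := by
  have hvc := hv.continuous
  have hdc : Continuous (deriv v) := hv.continuous_deriv (by simp)
  have hsq : ∀ w : ℝ → ℝ, Continuous w → HasCompactSupport w → Integrable fun t ↦ w t ^ 2 := by
    intro w hw hwc
    simp_rw [pow_two]
    exact (hw.mul hw).integrable_of_hasCompactSupport hwc.mul_left
  have i1 := hsq v hvc hc
  have i2 := hsq (deriv v) hdc hc.deriv
  have i3 : Integrable fun t ↦ 2 * v t * deriv v t :=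
    (by fun_prop : Continuous fun t ↦ 2 * v t * deriv v t).integrable_of_hasCompactSupport
      hc.deriv.mul_left
  have h0 : ∫ t, 2 * v t * deriv v t = 0 := by
    refine integral_eq_zero_of_hasDerivAt_of_integrable (f := fun t ↦ v t ^ 2) (fun t ↦ ?_) i3 i1
    have h := ((hv.differentiable (by simp)) t).hasDerivAt.fun_pow 2
    rwa [pow_one] at h
  have h1 : ∀ t, (κ * v t + deriv v t) ^ 2 =
      κ ^ 2 * v t ^ 2 + κ * (2 * v t * deriv v t) + deriv v t ^ 2 := fun t ↦ by ring
  have i4 : Integrable fun t ↦ κ ^ 2 * v t ^ 2 + κ * (2 * v t * deriv v t) :=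
    (i1.const_mul _).add (i3.const_mul _)
  simp_rw [h1]
  rw [integral_add i4 i2,
    integral_add (i1.const_mul _) (i3.const_mul _), integral_const_mul, integral_const_mul, h0]
  ring

/-- Comparison of the Talenti profile with the explicit constant. -/
theorem talentiProfile_energy_lt {n : ℕ} (hn : 3 ≤ n) {C ω : ℝ}
    (hω : ω = n * (√π ^ n / Gamma ((n : ℝ) / 2 + 1)))
    (hC : C > ((n : ℝ) - 2) ^ (-(2 * ((n : ℝ) - 1)) / (n : ℝ)) * sobolevConst n) :
    IntegrableOn (fun t ↦ t⁻¹ ^ (2 * ((n : ℝ) - 1) / (n - 2)) *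
      talentiProfile (2 / ((n : ℝ) - 2)) t ^ (2 * (n : ℝ) / (n - 2))) (Set.Ioi 0) ∧
    ω * ∫ t in Set.Ioi (0 : ℝ),
        ((1 + t ^ (2 / ((n : ℝ) - 2))) ^ (-1 / (2 / ((n : ℝ) - 2)) - 1)) ^ 2 <
      C * (ω * ∫ t in Set.Ioi (0 : ℝ), t⁻¹ ^ (2 * ((n : ℝ) - 1) / (n - 2)) *
        talentiProfile (2 / ((n : ℝ) - 2)) t ^ (2 * (n : ℝ) / (n - 2))) ^ (((n : ℝ) - 2) / n) := by
  have hn3 : (3 : ℝ) ≤ n := by exact_mod_cast hn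
  unfold sobolevConst at hC
  rw [sqrt_eq_rpow, ← rpow_natCast, ← rpow_mul pi_pos.le] at hω
  generalize (n : ℝ) = d at *
  have hd2 : 0 < d - 2 := by linarith
  have hd0 : 0 < d := by linarith
  have hG1 : 0 < Gamma (d / 2) := Gamma_pos_of_pos (by positivity)
  have hG2 : 0 < Gamma d := Gamma_pos_of_pos (by positivity)
  set p : ℝ := 2 / (d - 2) with hp
  have hp0 : 0 < p := by positivity
  have hinvp : 1 / p = (d - 2) / 2 := by rw [hp]; field_simp
  set B : ℝ := Gamma (d / 2) * Gamma (d / 2) / Gamma d with hB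
  have hB0 : 0 < B := by positivity
  have hN : ∀ t ∈ Set.Ioi (0 : ℝ), t⁻¹ ^ (2 * (d - 1) / (d - 2)) *
      talentiProfile p t ^ (2 * d / (d - 2)) = t ^ p * (1 + t ^ p) ^ (-d) := by
    intro t ht
    have ht : 0 < t := ht
    have h1 : 0 < 1 + t ^ p := by positivity
    rw [talentiProfile, mul_rpow ht.le (by positivity), ← rpow_mul h1.le, inv_rpow ht.le,
      ← rpow_neg ht.le, ← mul_assoc, ← rpow_add ht]
    congr 2
    · rw [hp]; field_simp; ring
    · rw [hp]; field_simp
  have hD : ∀ t ∈ Set.Ioi (0 : ℝ), ((1 + t ^ p) ^ (-1 / p - 1)) ^ 2 =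
      t ^ (0 : ℝ) * (1 + t ^ p) ^ (-d) := by
    intro t ht
    have ht : 0 < t := ht
    have h1 : 0 < 1 + t ^ p := by positivity
    rw [← rpow_natCast, ← rpow_mul h1.le, rpow_zero, one_mul]
    congr 1
    rw [neg_div, hinvp]
    push_cast
    ring
  have eN1 : (p + 1) / p = d / 2 := by rw [hp]; field_simp; ring
  have eN2 : d - d / 2 = d / 2 := by ring
  have eD1 : (0 + 1) / p = d / 2 - 1 := by rw [zero_add, hinvp]; ring
  have eD2 : d - (d / 2 - 1) = d / 2 + 1 := by ring
  have hNv : ∫ t in Set.Ioi (0 : ℝ), t ^ p * (1 + t ^ p) ^ (-d) = (d - 2) / 2 * B := by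
    rw [integral_rpow_mul_one_add_rpow_rpow hp0 (by rw [eN1]; linarith) (by rw [eN1]; linarith),
      eN1, eN2, ← hB, ← one_div, hinvp]
  have hDv : ∫ t in Set.Ioi (0 : ℝ), t ^ (0 : ℝ) * (1 + t ^ p) ^ (-d) = d / 2 * B := by
    rw [integral_rpow_mul_one_add_rpow_rpow hp0 (by rw [eD1]; linarith) (by rw [eD1]; linarith),
      eD1, eD2, Gamma_add_one (by positivity), ← one_div, hinvp, hB]
    have : Gamma (d / 2) = (d / 2 - 1) * Gamma (d / 2 - 1) := by
      rw [← Gamma_add_one (by linarith), sub_add_cancel]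
    rw [this]
    field_simp
  refine ⟨?_, ?_⟩
  · rw [integrableOn_congr_fun hN measurableSet_Ioi]
    refine Integrable.of_integral_ne_zero ?_
    rw [hNv]
    positivity
  rw [setIntegral_congr_fun measurableSet_Ioi hN, setIntegral_congr_fun measurableSet_Ioi hD, hNv,
    hDv]
  have hω0 : 0 < ω * B := by
    rw [hω]
    have := Gamma_pos_of_pos (show 0 < d / 2 + 1 by positivity)
    positivity
  have hωB : ω * B = 2 * π ^ (d / 2) * (Gamma (d / 2) / Gamma d) := by
    rw [hω, hB, Gamma_add_one (by positivity), one_div_mul_eq_div]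
    field_simp
  have hR : 0 < (ω * ((d - 2) / 2 * B)) ^ ((d - 2) / d) := by
    rw [mul_left_comm]; positivity
  refine lt_of_eq_of_lt ?_ (mul_lt_mul_of_pos_right hC hR)
  rw [mul_left_comm, mul_left_comm ω, hωB]
  generalize Gamma (d / 2) / Gamma d = G at *
  have hG0 : 0 < G := by
    rw [hωB] at hω0
    exact (pos_iff_pos_of_mul_pos hω0).1 (by positivity)
  refine log_injOn_pos (Set.mem_Ioi.2 (by positivity)) (Set.mem_Ioi.2 (by positivity)) ?_
  have := pi_pos
  rw [log_mul, log_mul, log_mul, log_mul, log_mul, log_mul, log_mul, log_rpow, log_rpow, log_rpow,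
    log_rpow, log_mul, log_mul, log_mul, log_mul, log_rpow, log_div, log_div] <;> try positivity
  field_simp
  ring

section hardyRadial

variable {n : ℕ} {a b c : ℝ} {v : ℝ → ℝ}

theorem hardyRadial_energy (hn : 1 ≤ n) (hab : a < b) (hv : ContDiff ℝ (⊤ : ℕ∞) v)
    (hvs : ∀ t ∉ Set.Icc b c, v t = 0) :
    (∫ x in Metric.ball (0 : EuclideanSpace ℝ (Fin n)) 1, ‖gradient (hardyRadial n a v) x‖ ^ 2) -
        (((n : ℝ) - 2) / 2) ^ 2 *
          (∫ x in Metric.ball (0 : EuclideanSpace ℝ (Fin n)) 1,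
            hardyRadial n a v x ^ 2 / ‖x‖ ^ 2) =
      n * volume.real (Metric.ball (0 : EuclideanSpace ℝ (Fin n)) 1) * ∫ t, deriv v t ^ 2 := by
  have hlt : exp (a - b) < 1 := exp_lt_one_iff.2 (by linarith)
  have hsub : tsupport (hardyRadial n a v) ⊆ Metric.ball 0 1 :=
    (tsupport_hardyRadial_subset hvs).trans (Metric.closedBall_subset_ball hlt)
  have hc : HasCompactSupport v := HasCompactSupport.intro isCompact_Icc hvs
  have h1 : ∀ x ∉ Metric.ball (0 : EuclideanSpace ℝ (Fin n)) 1,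
      ‖gradient (hardyRadial n a v) x‖ ^ 2 = 0 := fun x hx ↦ by
    rw [(notMem_tsupport_iff_eventuallyEq.1 fun h ↦ hx (hsub h)).gradient_eq]
    simp [gradient]
  have h2 : ∀ x ∉ Metric.ball (0 : EuclideanSpace ℝ (Fin n)) 1,
      hardyRadial n a v x ^ 2 / ‖x‖ ^ 2 = 0 := fun x hx ↦ by
    rw [image_eq_zero_of_notMem_tsupport fun h ↦ hx (hsub h)]
    simp
  rw [setIntegral_eq_integral_of_forall_compl_eq_zero h1,
    setIntegral_eq_integral_of_forall_compl_eq_zero h2,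
    integral_radial_exp hn a (G := fun r ↦ (r ^ (-((n : ℝ) / 2)) *
      (((n : ℝ) - 2) / 2 * v (a - log r) + deriv v (a - log r))) ^ 2) fun x hx ↦ by
        rw [norm_gradient_hardyRadial (hv.differentiable (by simp)) hx, sq_abs],
    integral_radial_exp hn a (G := fun r ↦ (r ^ (-((n : ℝ) / 2)) * v (a - log r)) ^ 2) fun x hx ↦ by
        have h0 : 0 < ‖x‖ := norm_pos_iff.2 hx
        rw [hardyRadial, show -((n : ℝ) / 2) = -(((n : ℝ) - 2) / 2) - 1 by ring,
          rpow_sub_one h0.ne']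
        ring]
  have hκ : (n : ℝ) + (2 : ℕ) * (-((n : ℝ) / 2)) = 0 := by push_cast; ring
  simp_rw [exp_pow_mul_rpow_mul_pow hκ, log_exp, sub_sub_cancel]
  rw [integral_mul_add_deriv_sq hv hc]
  ring

theorem hardyRadial_weighted_integral (hn : 3 ≤ n) (ha : 0 < a) (hab : a < b)
    (hvs : ∀ t ∉ Set.Icc b c, v t = 0) :
    ∫ x in Metric.ball (0 : EuclideanSpace ℝ (Fin n)) 1,
        (X1 a ‖x‖) ^ (2 * ((n : ℝ) - 1) / ((n : ℝ) - 2)) *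
          |hardyRadial n a v x| ^ (2 * (n : ℝ) / ((n : ℝ) - 2)) =
      n * volume.real (Metric.ball (0 : EuclideanSpace ℝ (Fin n)) 1) *
        ∫ t in Set.Ioi 0, t⁻¹ ^ (2 * ((n : ℝ) - 1) / ((n : ℝ) - 2)) *
          |v t| ^ (2 * (n : ℝ) / ((n : ℝ) - 2)) := by
  have hn3 : (3 : ℝ) ≤ n := by exact_mod_cast hn
  have hd2 : 0 < (n : ℝ) - 2 := by linarith
  have hr : 2 * (n : ℝ) / ((n : ℝ) - 2) ≠ 0 := by positivity
  have hlt : exp (a - b) < 1 := exp_lt_one_iff.2 (by linarith)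
  have hpolar := integral_radial_exp (n := n) (by omega) a
    (F := fun x ↦ (X1 a ‖x‖) ^ (2 * ((n : ℝ) - 1) / ((n : ℝ) - 2)) *
      |hardyRadial n a v x| ^ (2 * (n : ℝ) / ((n : ℝ) - 2)))
    (G := fun r ↦ (X1 a r) ^ (2 * ((n : ℝ) - 1) / ((n : ℝ) - 2)) *
      |r ^ (-(((n : ℝ) - 2) / 2)) * v (a - log r)| ^ (2 * (n : ℝ) / ((n : ℝ) - 2)))
    fun x _ ↦ rfl
  rw [setIntegral_eq_integral_of_forall_compl_eq_zero,
    setIntegral_eq_integral_of_forall_compl_eq_zero, hpolar]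
  · congr 2
    ext t
    have he : exp (a - t) ^ n *
        (exp (a - t) ^ (-(((n : ℝ) - 2) / 2))) ^ (2 * (n : ℝ) / ((n : ℝ) - 2)) = 1 := by
      rw [← rpow_natCast, ← exp_mul, ← exp_mul, ← exp_mul, ← exp_add, exp_eq_one_iff]
      field_simp
      ring
    rw [X1, log_exp, sub_sub_cancel, abs_mul, abs_of_pos (rpow_pos_of_pos (exp_pos _) _),
      mul_rpow (by positivity) (abs_nonneg _), mul_left_comm, ← mul_assoc (exp (a - t) ^ n), he,
      one_mul]
  · intro t ht
    rw [hvs t fun h ↦ ht (ha.trans (hab.trans_le h.1)), abs_zero, zero_rpow hr, mul_zero]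
  · intro x hx
    have hx : 1 ≤ ‖x‖ := by simpa using hx
    rw [hardyRadial_eq_zero_of_lt_norm hvs (hlt.trans_le hx), abs_zero, zero_rpow hr, mul_zero]

end hardyRadial

theorem stmt5 (n : ℕ) (hn : 3 ≤ n) (a : ℝ) (ha0 : 0 < a)
    (C : ℝ) (hC : C > ((n : ℝ) - 2) ^ (-(2 * ((n : ℝ) - 1)) / (n : ℝ)) * sobolevConst n) :
    ∃ u : EuclideanSpace ℝ (Fin n) → ℝ, u ≠ 0 ∧ ContDiff ℝ (⊤ : ℕ∞) u ∧ HasCompactSupport u ∧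
      tsupport u ⊆ Metric.ball (0 : EuclideanSpace ℝ (Fin n)) 1 ∧ (∃ g : ℝ → ℝ, ∀ x : EuclideanSpace ℝ (Fin n), u x = g ‖x‖) ∧
      (∫ x in Metric.ball (0 : EuclideanSpace ℝ (Fin n)) 1, ‖gradient u x‖ ^ 2) - (((n : ℝ) - 2) / 2) ^ 2 *
          (∫ x in Metric.ball (0 : EuclideanSpace ℝ (Fin n)) 1, u x ^ 2 / ‖x‖ ^ 2)
        < C *
          (∫ x in Metric.ball (0 : EuclideanSpace ℝ (Fin n)) 1,
              (X1 a ‖x‖) ^ (2 * ((n : ℝ) - 1) / ((n : ℝ) - 2)) *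
                |u x| ^ (2 * (n : ℝ) / ((n : ℝ) - 2)))
            ^ (((n : ℝ) - 2) / (n : ℝ)) := by
  have hn3 : (3 : ℝ) ≤ n := by exact_mod_cast hn
  have hd2 : 0 < (n : ℝ) - 2 := by linarith
  have : Nonempty (Fin n) := ⟨⟨0, by omega⟩⟩
  have hG := Gamma_pos_of_pos (show 0 < (n : ℝ) / 2 + 1 by positivity)
  obtain ⟨ω, hω⟩ : ∃ ω, ω = n * volume.real (Metric.ball (0 : EuclideanSpace ℝ (Fin n)) 1) :=
    ⟨_, rfl⟩
  have hω' : ω = n * (√π ^ n / Gamma ((n : ℝ) / 2 + 1)) := by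
    rw [hω, measureReal_def, EuclideanSpace.volume_ball, Fintype.card_fin, ENNReal.ofReal_one,
      one_pow, one_mul, ENNReal.toReal_ofReal (by positivity)]
  have hω0 : 0 < ω := by rw [hω']; positivity
  obtain ⟨hint, hlt⟩ := talentiProfile_energy_lt hn hω' hC
  obtain ⟨v₀, hv₀, ⟨b₀, c₀, hb₀, hs₀⟩, hlt₀⟩ := exists_contDiff_of_talentiProfile
    (by positivity) (by positivity) (by positivity) hint hlt
  obtain ⟨v, hv, ⟨b, c, hab, hs⟩, hlt⟩ := exists_dilation hω0
    (by field_simp; ring) ha0 hb₀ hv₀ hs₀ hlt₀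
  have hexp : exp (a - b) < 1 := exp_lt_one_iff.2 (by linarith)
  have hsub := tsupport_hardyRadial_subset (n := n) (a := a) hs
  have hQ : ∫ t in Set.Ioi (0 : ℝ), deriv v t ^ 2 = ∫ t, deriv v t ^ 2 := by
    refine setIntegral_eq_integral_of_forall_compl_eq_zero fun t ht ↦ ?_
    have : t ∉ tsupport v := fun h ↦ by
      have : t ∈ Set.Icc b c :=
        closure_minimal (Function.support_subset_iff'.2 hs) isClosed_Icc h
      exact ht (ha0.trans (hab.trans_le this.1))
    rw [Function.notMem_support.1 fun h ↦ this (support_deriv_subset h), zero_pow two_ne_zero]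
  have key := hlt
  rw [hQ, hω, ← hardyRadial_weighted_integral hn ha0 hab hs,
    ← hardyRadial_energy (by omega) hab hv hs] at key
  refine ⟨hardyRadial n a v, fun h0 ↦ ?_, contDiff_hardyRadial hab hv hs,
    HasCompactSupport.of_support_subset_isCompact (isCompact_closedBall 0 (exp (a - b)))
      ((subset_tsupport _).trans hsub),
    hsub.trans (Metric.closedBall_subset_ball hexp),
    ⟨fun r ↦ r ^ (-(((n : ℝ) - 2) / 2)) * v (a - log r), fun x ↦ rfl⟩, key⟩
  rw [h0] at key
  have hr : 2 * (n : ℝ) / ((n : ℝ) - 2) ≠ 0 := by positivity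
  have hθ : ((n : ℝ) - 2) / n ≠ 0 := by positivity
  simp [gradient, zero_rpow hr, zero_rpow hθ] at key
end

section
/- Let n ≥ 3 and a > 0, and set C_n(a) := (n-2)^{-2(n-1)/n} S_n if a ≥ 1/(n-2) and C_n(a) := a^{2(n-1)/n} S_n if 0 < a < 1/(n-2). Then the best constant is never attained by a smooth function: for every nonzero u ∈ C_c^∞(B_1), the strict inequality ∫_{B_1} |∇u|² dx > ((n-2)/2)² ∫_{B_1} u²/|x|² dx + C_n(a) · ( ∫_{B_1} X_1(a,|x|)^{2(n-1)/(n-2)} |u|^{2n/(n-2)} dx )^{(n-2)/n} holds. -/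
open MeasureTheory Real

section

open Filter Topology

open scoped InnerProductSpace

theorem integrable_one_add_sq_rpow_neg {β : ℝ} (hβ : 1 / 2 < β) :
    Integrable fun ξ : ℝ => (1 + ξ ^ 2) ^ (-β) := by
  have h := integrable_rpow_neg_one_add_norm_sq (E := ℝ) (μ := volume) (r := 2 * β)
    (by simp; linarith)
  refine h.congr (ae_of_all _ fun ξ => ?_)
  simp only [Real.norm_eq_abs, sq_abs]
  congr 1
  ring

theorem integral_one_add_sq_rpow_neg {β : ℝ} (hβ : 1 / 2 < β) :
    ∫ ξ : ℝ, (1 + ξ ^ 2) ^ (-β) = √π * Gamma (β - 1 / 2) / Gamma β := by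
  have hβ0 : 0 < β := by linarith
  have hΓ := Gamma_pos_of_pos hβ0
  rw [eq_div_iff hΓ.ne']
  have hinner : ∀ ξ : ℝ, ∫ t in Set.Ioi (0 : ℝ), t ^ (β - 1) * exp (-((1 + ξ ^ 2) * t)) =
      (1 + ξ ^ 2) ^ (-β) * Gamma β := by
    intro ξ
    have h1 : 0 < 1 + ξ ^ 2 := by positivity
    rw [integral_rpow_mul_exp_neg_mul_Ioi hβ0 h1, one_div, inv_rpow h1.le, rpow_neg h1.le]
  have hgauss : ∀ t ∈ Set.Ioi (0 : ℝ), ∫ ξ : ℝ, t ^ (β - 1) * exp (-((1 + ξ ^ 2) * t)) =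
      √π * (exp (-t) * t ^ (β - 1 / 2 - 1)) := by
    intro t ht
    have ht : 0 < t := ht
    have : ∀ ξ : ℝ, t ^ (β - 1) * exp (-((1 + ξ ^ 2) * t)) =
        (t ^ (β - 1) * exp (-t)) * exp (-t * ξ ^ 2) := by
      intro ξ
      rw [mul_assoc, ← exp_add]
      congr 2
      ring
    simp only [this]
    rw [integral_const_mul, integral_gaussian, sqrt_div pi_pos.le, sqrt_eq_rpow t,
      show β - 1 / 2 - 1 = (β - 1) - 1 / 2 by ring, rpow_sub ht (β - 1)]
    ring
  have hint_prod : Integrable (Function.uncurry fun (ξ t : ℝ) =>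
      t ^ (β - 1) * exp (-((1 + ξ ^ 2) * t))) (volume.prod (volume.restrict (Set.Ioi 0))) := by
    have hm : Measurable (Function.uncurry fun (ξ t : ℝ) =>
      t ^ (β - 1) * exp (-((1 + ξ ^ 2) * t))) := by
      unfold Function.uncurry
      fun_prop
    rw [integrable_prod_iff hm.aestronglyMeasurable]
    constructor
    · refine ae_of_all _ fun ξ => ?_
      have h1 : 0 < 1 + ξ ^ 2 := by positivity
      refine not_imp_comm.1 integral_undef ?_
      simp only [Function.uncurry]
      rw [hinner]
      positivity
    · refine ((integrable_one_add_sq_rpow_neg hβ).mul_const (Gamma β)).congr (ae_of_all _ fun ξ => ?_)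
      simp only [Function.uncurry]
      rw [← hinner]
      refine setIntegral_congr_fun measurableSet_Ioi fun t ht => ?_
      have ht : 0 < t := ht
      rw [norm_of_nonneg (by positivity)]
  rw [← integral_mul_const]
  simp only [← hinner]
  rw [integral_integral_swap hint_prod, setIntegral_congr_fun measurableSet_Ioi hgauss,
    integral_const_mul, Gamma_eq_integral (by linarith)]

/-- The truncated integral of `(1 + ξ²)^(-β)` over `[-R, R]`. -/
noncomputable def truncInt (β R : ℝ) : ℝ := ∫ ξ in (-R)..R, (1 + ξ ^ 2) ^ (-β)

theorem continuous_one_add_sq_rpow (β : ℝ) : Continuous fun ξ : ℝ => (1 + ξ ^ 2) ^ β := by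
  refine Continuous.rpow_const (by fun_prop) fun ξ => Or.inl ?_
  positivity

theorem truncInt_pos (β : ℝ) {R : ℝ} (hR : 0 < R) : 0 < truncInt β R := by
  refine intervalIntegral.intervalIntegral_pos_of_pos
    ((continuous_one_add_sq_rpow _).intervalIntegrable _ _) (fun ξ => ?_) (by linarith)
  positivity

theorem tendsto_truncInt {β : ℝ} (hβ : 1 / 2 < β) :
    Filter.Tendsto (truncInt β) Filter.atTop (nhds (√π * Gamma (β - 1 / 2) / Gamma β)) := by
  rw [← integral_one_add_sq_rpow_neg hβ]
  exact intervalIntegral_tendsto_integral (integrable_one_add_sq_rpow_neg hβ)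
    Filter.tendsto_neg_atTop_atBot Filter.tendsto_id

theorem prod_gamma_quotient {β : ℝ} (k : ℕ) (hβ : (k : ℝ) / 2 < β) :
    ∏ j ∈ Finset.range k, (√π * Gamma (β - j / 2 - 1 / 2) / Gamma (β - j / 2)) =
      √π ^ k * Gamma (β - k / 2) / Gamma β := by
  induction k with
  | zero =>
    have : 0 < β := by simpa using hβ
    simp [(Gamma_pos_of_pos this).ne']
  | succ k ih =>
    push_cast at hβ
    have hk : (k : ℝ) / 2 < β := by linarith
    rw [Finset.prod_range_succ, ih hk]
    have h1 := (Gamma_pos_of_pos (sub_pos.2 hk)).ne'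
    have h2 : β - ((k + 1 : ℕ) : ℝ) / 2 = β - k / 2 - 1 / 2 := by push_cast; ring
    have h0 : 0 ≤ (k : ℝ) := by positivity
    have h3 := (Gamma_pos_of_pos (show 0 < β by linarith)).ne'
    rw [h2, pow_succ, div_mul_div_comm, div_eq_div_iff (mul_ne_zero h3 h1) h3]
    ring

theorem tendsto_prod_truncInt {β : ℝ} (k : ℕ) (hβ : (k : ℝ) / 2 < β) :
    Filter.Tendsto (fun R => ∏ j ∈ Finset.range k, truncInt (β - j / 2) R) Filter.atTop
      (nhds (√π ^ k * Gamma (β - k / 2) / Gamma β)) := by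
  rw [← prod_gamma_quotient k hβ]
  refine tendsto_finsetProd _ fun j hj => tendsto_truncInt ?_
  have : (j : ℝ) + 1 ≤ k := by exact_mod_cast Finset.mem_range.1 hj
  linarith

theorem exists_inverse_cdf (β : ℝ) {R : ℝ} (hR : 0 < R) :
    ∃ G : ℝ → ℝ, G 0 = -R ∧ G (truncInt β R) = R ∧ Continuous G ∧ Monotone G ∧
      ∀ y ∈ Set.Icc 0 (truncInt β R), HasDerivAt G ((1 + G y ^ 2) ^ β) y := by
  set γ : ℝ → ℝ := fun ξ => (1 + (min |ξ| R) ^ 2) ^ (-β) with hγ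
  have hγc : Continuous γ := by
    refine Continuous.rpow_const (by fun_prop) fun ξ => Or.inl ?_
    positivity
  have hγp : ∀ ξ, 0 < γ ξ := fun ξ => by simp only [hγ]; positivity
  have hγR : ∀ ξ ∈ Set.Icc (-R) R, γ ξ = (1 + ξ ^ 2) ^ (-β) := by
    intro ξ hξ
    simp only [hγ]
    rw [min_eq_left (abs_le.2 hξ), sq_abs]
  set Ψ : ℝ → ℝ := fun ξ => ∫ t in (-R)..ξ, γ t with hΨ
  have hΨd : ∀ ξ, HasDerivAt Ψ (γ ξ) ξ := fun ξ =>
    intervalIntegral.integral_hasDerivAt_right (hγc.intervalIntegrable _ _)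
      (hγc.stronglyMeasurableAtFilter _ _) hγc.continuousAt
  have hmono : StrictMono Ψ := strictMono_of_hasDerivAt_pos hΨd hγp
  have hΨc : Continuous Ψ := continuous_iff_continuousAt.2 fun ξ => (hΨd ξ).continuousAt
  set m : ℝ := min 1 ((1 + R ^ 2) ^ (-β))
  have hm : 0 < m := by positivity
  have hγm : ∀ ξ, m ≤ γ ξ := by
    intro ξ
    simp only [hγ]
    have h0 : 0 ≤ min |ξ| R := by positivity
    have h1 : min |ξ| R ^ 2 ≤ R ^ 2 := by gcongr; exact min_le_right _ _
    rcases le_total 0 β with hb | hb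
    · exact (min_le_right _ _).trans
        (rpow_le_rpow_of_nonpos (by positivity) (by linarith) (by linarith))
    · exact (min_le_left _ _).trans (one_le_rpow (by nlinarith) (by linarith))
  have hΨR : Ψ (-R) = 0 := by simp [hΨ]
  have hgrow : ∀ a b, a ≤ b → m * (b - a) ≤ Ψ b - Ψ a := by
    intro a b hab
    have := mul_sub_le_image_sub_of_le_deriv (f := Ψ) (C := m)
      (fun ξ => (hΨd ξ).differentiableAt) (fun ξ => by rw [(hΨd ξ).deriv]; exact hγm ξ)
      (x := a) (y := b) hab
    exact this
  have htop : Filter.Tendsto Ψ Filter.atTop Filter.atTop := by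
    refine Filter.tendsto_atTop_mono' _ (f₁ := fun ξ => m * (ξ + R)) ?_ ?_
    · filter_upwards [Filter.eventually_ge_atTop (-R)] with ξ hξ
      have := hgrow (-R) ξ hξ
      rw [hΨR] at this
      linarith
    · exact Filter.Tendsto.const_mul_atTop hm (Filter.tendsto_atTop_add_const_right _ _ Filter.tendsto_id)
  have hbot : Filter.Tendsto Ψ Filter.atBot Filter.atBot := by
    refine Filter.tendsto_atBot_mono' _ (f₁ := fun ξ => m * (ξ + R)) ?_ ?_
    · filter_upwards [Filter.eventually_le_atBot (-R)] with ξ hξ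
      have := hgrow ξ (-R) hξ
      rw [hΨR] at this
      linarith
    · exact Filter.Tendsto.const_mul_atBot hm (Filter.tendsto_atBot_add_const_right _ _ Filter.tendsto_id)
  have hsurj : Function.Surjective Ψ := hΨc.surjective htop hbot
  set e := hmono.orderIsoOfSurjective Ψ hsurj
  have hleft : ∀ ξ, e.symm (Ψ ξ) = ξ := fun ξ => e.symm_apply_apply ξ
  have hright : ∀ y, Ψ (e.symm y) = y := fun y => e.apply_symm_apply y
  have hΨtop : Ψ R = truncInt β R := by
    refine intervalIntegral.integral_congr fun ξ hξ => ?_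
    rw [Set.uIcc_of_le (by linarith)] at hξ
    exact hγR ξ hξ
  have hG0 : e.symm 0 = -R := by rw [← hΨR, hleft]
  have hG1 : e.symm (truncInt β R) = R := by rw [← hΨtop, hleft]
  refine ⟨e.symm, hG0, hG1, e.symm.continuous, e.symm.monotone, fun y hy => ?_⟩
  have hyR : e.symm y ∈ Set.Icc (-R) R :=
    ⟨hG0 ▸ e.symm.monotone hy.1, hG1 ▸ e.symm.monotone hy.2⟩
  have := HasDerivAt.of_local_left_inverse (g := e.symm) (a := y)
    e.symm.continuous.continuousAt (hΨd _) (hγp _).ne' (Filter.Eventually.of_forall hright)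
  rwa [hγR _ hyR, rpow_neg (by positivity), inv_inv] at this

section OneDim
variable {β R L : ℝ} {G h : ℝ → ℝ}

theorem integral_mem_Icc_of_support (hL : 0 < L) (hc : Continuous h) (h0 : ∀ s, 0 ≤ h s)
    (hs : ∀ s, h s ≠ 0 → |s| ≤ L) (τ : ℝ) :
    0 ≤ ∫ s in (-L)..τ, h s ∧ ∫ s in (-L)..τ, h s ≤ ∫ s in (-L)..L, h s := by
  have hi : ∀ a b, IntervalIntegrable h volume a b := fun a b => hc.intervalIntegrable a b
  have hz : ∀ s, L < |s| → h s = 0 := fun s hsL => by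
    by_contra hne
    exact absurd (hs s hne) (not_le.2 hsL)
  constructor
  · rcases le_total (-L) τ with hτ | hτ
    · exact intervalIntegral.integral_nonneg hτ fun s _ => h0 s
    · rw [intervalIntegral.integral_zero_ae]
      filter_upwards [(volume : Measure ℝ).ae_ne (-L)] with s hs1 hs2
      rw [Set.uIoc_of_ge hτ] at hs2
      refine hz s ?_
      have : s < -L := lt_of_le_of_ne hs2.2 hs1
      rw [abs_of_nonpos (by linarith)]
      linarith
  · rw [← intervalIntegral.integral_add_adjacent_intervals (hi (-L) τ) (hi τ L)]
    simp only [le_add_iff_nonneg_right]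
    rcases le_total τ L with hτ | hτ
    · exact intervalIntegral.integral_nonneg hτ fun s _ => h0 s
    · rw [intervalIntegral.integral_zero_ae]
      filter_upwards with s hs2
      rw [Set.uIoc_of_ge hτ] at hs2
      exact hz s (lt_of_lt_of_le hs2.1 (le_abs_self s))

theorem cdf_mem_Icc (hR : 0 < R) (hL : 0 < L) (hc : Continuous h) (h0 : ∀ s, 0 ≤ h s)
    (hs : ∀ s, h s ≠ 0 → |s| ≤ L) (τ : ℝ) :
    truncInt β R * ((∫ s in (-L)..τ, h s) / ∫ s in (-L)..L, h s) ∈ Set.Icc 0 (truncInt β R) := by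
  have hN := truncInt_pos β hR
  obtain ⟨h1, h2⟩ := integral_mem_Icc_of_support hL hc h0 hs τ
  have h3 : 0 ≤ ∫ s in (-L)..L, h s := h1.trans h2
  refine ⟨by positivity, ?_⟩
  exact mul_le_of_le_one_right hN.le (div_le_one_of_le₀ h2 h3)

theorem hasDerivAt_quantile (hR : 0 < R) (hL : 0 < L) (hc : Continuous h) (h0 : ∀ s, 0 ≤ h s)
    (hs : ∀ s, h s ≠ 0 → |s| ≤ L)
    (hG : ∀ y ∈ Set.Icc 0 (truncInt β R), HasDerivAt G ((1 + G y ^ 2) ^ β) y) (τ : ℝ) :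
    HasDerivAt (fun τ => G (truncInt β R * ((∫ s in (-L)..τ, h s) / ∫ s in (-L)..L, h s)))
      ((1 + G (truncInt β R * ((∫ s in (-L)..τ, h s) / ∫ s in (-L)..L, h s)) ^ 2) ^ β *
        (truncInt β R * (h τ / ∫ s in (-L)..L, h s))) τ := by
  have h1 : HasDerivAt (fun τ => ∫ s in (-L)..τ, h s) (h τ) τ :=
    intervalIntegral.integral_hasDerivAt_right (hc.intervalIntegrable _ _)
      (hc.stronglyMeasurableAtFilter _ _) hc.continuousAt
  exact (hG _ (cdf_mem_Icc hR hL hc h0 hs τ)).comp τ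
    ((h1.div_const (∫ s in (-L)..L, h s)).const_mul (truncInt β R))

theorem integral_quantile_moment (hR : 0 < R) (hL : 0 < L) (hc : Continuous h) (h0 : ∀ s, 0 ≤ h s)
    (hs : ∀ s, h s ≠ 0 → |s| ≤ L) (hG0 : G 0 = -R)
    (hG1 : G (truncInt β R) = R)
    (hG : ∀ y ∈ Set.Icc 0 (truncInt β R), HasDerivAt G ((1 + G y ^ 2) ^ β) y) :
    ∫ s in (-L)..L, h s *
        (1 + G (truncInt β R * ((∫ s in (-L)..s, h s) / ∫ s in (-L)..L, h s)) ^ 2) =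
      truncInt (β - 1) R / truncInt β R * ∫ s in (-L)..L, h s := by
  have hN := truncInt_pos β hR
  set I := ∫ s in (-L)..L, h s with hI
  by_cases hI0 : I = 0
  · have hz : ∀ s ∈ Set.Icc (-L) L, h s = 0 := by
      intro s hsm
      by_contra hne
      have hpos : 0 < h s := lt_of_le_of_ne (h0 s) (Ne.symm hne)
      have := intervalIntegral.integral_pos (a := -L) (b := L) (by linarith) hc.continuousOn
        (fun x _ => h0 x) ⟨s, hsm, hpos⟩
      linarith
    rw [hI0, mul_zero]
    refine intervalIntegral.integral_zero_ae (ae_of_all _ fun s hsm => ?_)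
    rw [Set.uIoc_of_le (by linarith)] at hsm
    rw [hz s ⟨hsm.1.le, hsm.2⟩, zero_mul]
  set ξ : ℝ → ℝ := fun τ => G (truncInt β R * ((∫ s in (-L)..τ, h s) / I)) with hξ
  have hd : ∀ τ, HasDerivAt ξ ((1 + ξ τ ^ 2) ^ β * (truncInt β R * (h τ / I))) τ :=
    fun τ => hasDerivAt_quantile hR hL hc h0 hs hG τ
  have hξc : Continuous ξ := continuous_iff_continuousAt.2 fun τ => (hd τ).continuousAt
  have hξ0 : ξ (-L) = -R := by simp [hξ, hG0]
  have hξ1 : ξ L = R := by simp only [hξ]; rw [div_self hI0, mul_one, hG1]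
  have hsub := intervalIntegral.integral_comp_mul_deriv (a := -L) (b := L) (f := ξ)
    (f' := fun τ => (1 + ξ τ ^ 2) ^ β * (truncInt β R * (h τ / I)))
    (g := fun x => (1 + x ^ 2) ^ (-(β - 1))) (fun τ _ => hd τ)
    ((((continuous_one_add_sq_rpow β).comp hξc).mul (by fun_prop)).continuousOn)
    (continuous_one_add_sq_rpow _)
  rw [hξ0, hξ1] at hsub
  have hpt : ∀ τ, ((fun x => (1 + x ^ 2) ^ (-(β - 1))) ∘ ξ) τ *
      ((1 + ξ τ ^ 2) ^ β * (truncInt β R * (h τ / I))) =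
      (truncInt β R / I) * (h τ * (1 + ξ τ ^ 2)) := by
    intro τ
    have hp : 0 < 1 + ξ τ ^ 2 := by positivity
    simp only [Function.comp]
    rw [← mul_assoc, ← rpow_add hp, show -(β - 1) + β = 1 by ring, rpow_one]
    ring
  simp only [hpt] at hsub
  rw [intervalIntegral.integral_const_mul] at hsub
  change ∫ s in (-L)..L, h s * (1 + ξ s ^ 2) = _
  rw [truncInt, ← hsub]
  field_simp

end OneDim

theorem measurePreserving_insertNth {k : ℕ} (i : Fin (k + 1)) :
    MeasurePreserving (fun p : ℝ × (Fin k → ℝ) => (i.insertNth p.1 p.2 : Fin (k + 1) → ℝ))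
      (volume.prod volume) volume := by
  have h := (volume_preserving_piFinSuccAbove (fun _ : Fin (k + 1) => ℝ) i).symm
  exact h

theorem measurableEmbedding_insertNth {k : ℕ} (i : Fin (k + 1)) :
    MeasurableEmbedding (fun p : ℝ × (Fin k → ℝ) => (i.insertNth p.1 p.2 : Fin (k + 1) → ℝ)) :=
  (MeasurableEquiv.piFinSuccAbove (fun _ : Fin (k + 1) => ℝ) i).symm.measurableEmbedding

theorem integrable_insertNth {k : ℕ} (i : Fin (k + 1)) {f : (Fin (k + 1) → ℝ) → ℝ}
    (hf : Integrable f) :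
    Integrable (fun p : ℝ × (Fin k → ℝ) => f (i.insertNth p.1 p.2)) (volume.prod volume) :=
  (measurePreserving_insertNth i).integrable_comp_of_integrable hf

theorem integral_insertNth {k : ℕ} (i : Fin (k + 1)) {f : (Fin (k + 1) → ℝ) → ℝ}
    (hf : Integrable f) :
    ∫ x, f x = ∫ y : Fin k → ℝ, ∫ s : ℝ, f (i.insertNth s y) := by
  rw [← (measurePreserving_insertNth i).integral_comp (measurableEmbedding_insertNth i)]
  rw [integral_prod_symm _ (integrable_insertNth i hf)]

theorem integrable_of_support_box {k : ℕ} {L : ℝ} {F : (Fin k → ℝ) → ℝ} (hF : Continuous F)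
    (hs : ∀ x, F x ≠ 0 → ∀ i, |x i| ≤ L) : Integrable F := by
  refine hF.integrable_of_hasCompactSupport
    (HasCompactSupport.of_support_subset_isCompact
      (isCompact_univ_pi fun _ : Fin k => isCompact_Icc (a := -L) (b := L)) fun x hx => ?_)
  exact fun i _ => abs_le.1 (hs x hx i)

theorem integral_eq_intervalIntegral_of_support {L : ℝ} (hL : 0 < L) {h : ℝ → ℝ}
    (hs : ∀ s, h s ≠ 0 → |s| ≤ L) : ∫ s, h s = ∫ s in (-L)..L, h s := by
  rw [intervalIntegral.integral_of_le (by linarith), ← integral_Icc_eq_integral_Ioc]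
  exact (setIntegral_eq_integral_of_forall_compl_eq_zero fun s hsm => by
    by_contra hne
    exact hsm (abs_le.1 (hs s hne))).symm

/-- A Knothe-type triangular transport of the density `F` onto a truncation of
`(1 + |y|²)^(-β)`: `T i` are the components of the map, `D i` the diagonal partial derivatives. -/
structure IsTriangularTransport {k : ℕ} (β R : ℝ) (F : (Fin k → ℝ) → ℝ)
    (T D : Fin k → (Fin k → ℝ) → ℝ) : Prop where
  measurable_map : ∀ i, Measurable (T i)
  measurable_diag : ∀ i, Measurable (D i)
  bounded : ∃ B, ∀ i x, |T i x| ≤ B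
  diag_nonneg : ∀ i x, 0 ≤ D i x
  hasDerivAt : ∀ i x, F x ≠ 0 → ∀ τ,
    HasDerivAt (fun s => T i (Function.update x i s)) (D i (Function.update x i τ)) τ
  density : ∀ x, F x ≠ 0 → (∏ i, D i x) * ∫ y, F y =
    (∏ j ∈ Finset.range k, truncInt (β - j / 2) R) * F x * (1 + ∑ i, T i x ^ 2) ^ β
  moment : ∫ x, F x * (1 + ∑ i, T i x ^ 2) =
    (∏ j ∈ Finset.range k, truncInt (β - 1 - j / 2) R / truncInt (β - j / 2) R) * ∫ y, F y

theorem exists_triangularTransport {R L : ℝ} (hR : 0 < R) (hL : 0 < L) (k : ℕ) :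
    ∀ (β : ℝ) (F : (Fin k → ℝ) → ℝ), Continuous F → (∀ x, 0 ≤ F x) →
      (∀ x, F x ≠ 0 → ∀ i, |x i| ≤ L) →
      ∃ T D : Fin k → (Fin k → ℝ) → ℝ, IsTriangularTransport β R F T D := by
  induction k with
  | zero =>
    intro β F _ _ _
    refine ⟨fun _ _ => 0, fun _ _ => 0, ?_, ?_, ⟨0, ?_⟩, ?_, ?_, ?_, ?_⟩
    · exact fun i => i.elim0
    · exact fun i => i.elim0
    · exact fun i => i.elim0
    · exact fun i => i.elim0
    · exact fun i => i.elim0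
    · intro x _
      have hx : x = default := Subsingleton.elim _ _
      simp only [Finset.univ_eq_empty, Finset.prod_empty, Finset.sum_empty, Finset.range_zero,
        one_mul, add_zero, one_rpow, mul_one]
      rw [integral_unique]
      have hv : (volume : Measure (Fin 0 → ℝ)).real Set.univ = 1 := by
        simp [Measure.real, volume_pi]
      rw [hv, one_smul]
      exact congrArg F (Subsingleton.elim _ _)
    · simp
  | succ k ih =>
    intro β F hFc hF0 hFs
    have hcons : Continuous fun p : (Fin k → ℝ) × ℝ => (Fin.cons p.2 p.1 : Fin (k + 1) → ℝ) := by
      refine continuous_pi fun i => ?_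
      refine Fin.cases ?_ (fun i => ?_) i
      · simpa using continuous_snd
      · simpa [Function.comp_def] using (continuous_apply i).comp continuous_fst
    have hFu : Continuous (Function.uncurry fun (y : Fin k → ℝ) (s : ℝ) =>
        F (Fin.cons s y : Fin (k + 1) → ℝ)) := hFc.comp hcons
    set P : (Fin k → ℝ) → ℝ := fun y => ∫ s in (-L)..L, F (Fin.cons s y : Fin (k + 1) → ℝ) with hP
    have hline : ∀ y, Continuous fun s : ℝ => F (Fin.cons s y : Fin (k + 1) → ℝ) := fun y =>
      hFu.comp (Continuous.prodMk_right y)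
    have hlineS : ∀ y (s : ℝ), F (Fin.cons s y : Fin (k + 1) → ℝ) ≠ 0 → |s| ≤ L := fun y s hne => by
      simpa using hFs _ hne 0
    have hPc : Continuous P :=
      intervalIntegral.continuous_parametric_intervalIntegral_of_continuous' hFu _ _
    have hP0 : ∀ y, 0 ≤ P y := fun y =>
      intervalIntegral.integral_nonneg (by linarith) fun s _ => hF0 _
    have hPs : ∀ y, P y ≠ 0 → ∀ i, |y i| ≤ L := by
      intro y hy i
      by_contra hlt
      refine hy ?_
      have : ∀ s : ℝ, F (Fin.cons s y : Fin (k + 1) → ℝ) = 0 := fun s => by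
        by_contra hne
        exact hlt (by simpa using hFs _ hne i.succ)
      simp [hP, this]
    have hPpos : ∀ x : Fin (k + 1) → ℝ, F x ≠ 0 → P (Fin.tail x) ≠ 0 := by
      intro x hx
      have hx' : F (Fin.cons (x 0) (Fin.tail x) : Fin (k + 1) → ℝ) ≠ 0 := by
        rwa [Fin.cons_self_tail]
      refine (intervalIntegral.integral_pos (by linarith) (hline _).continuousOn
        (fun s _ => hF0 _) ⟨x 0, abs_le.1 (hlineS _ _ hx'), lt_of_le_of_ne (hF0 _) hx'.symm⟩).ne'
    obtain ⟨T', D', h'⟩ := ih (β - 1 / 2) P hPc hP0 hPs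
    obtain ⟨B, hB⟩ := h'.bounded
    obtain ⟨G, hG0, hG1, hGc, hGm, hG⟩ := exists_inverse_cdf β hR
    have hN := truncInt_pos β hR
    set N := truncInt β R with hNdef
    set ξ : (Fin (k + 1) → ℝ) → ℝ := fun x =>
      G (N * ((∫ s in (-L)..(x 0), F (Fin.cons s (Fin.tail x) : Fin (k + 1) → ℝ)) /
        P (Fin.tail x))) with hξ
    set w : (Fin (k + 1) → ℝ) → ℝ := fun x => √(1 + ∑ i, T' i (Fin.tail x) ^ 2) with hw
    have htail : Measurable (Fin.tail : (Fin (k + 1) → ℝ) → Fin k → ℝ) :=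
      measurable_pi_lambda _ fun i => measurable_pi_apply i.succ
    have htailc : Continuous (Fin.tail : (Fin (k + 1) → ℝ) → Fin k → ℝ) :=
      continuous_pi fun i => continuous_apply i.succ
    have hPm : Measurable fun x : Fin (k + 1) → ℝ => P (Fin.tail x) := hPc.measurable.comp htail
    have hwm : Measurable w := by
      refine Measurable.sqrt (measurable_const.add (Finset.measurable_sum _ fun i _ => ?_))
      exact ((h'.measurable_map i).comp htail).pow_const 2
    have hcdf : Continuous fun x : Fin (k + 1) → ℝ =>
        ∫ s in (-L)..(x 0), F (Fin.cons s (Fin.tail x) : Fin (k + 1) → ℝ) := by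
      refine intervalIntegral.continuous_parametric_intervalIntegral_of_continuous
        (f := fun (x : Fin (k + 1) → ℝ) s => F (Fin.cons s (Fin.tail x) : Fin (k + 1) → ℝ)) ?_
        (continuous_apply 0)
      exact hFu.comp ((htailc.comp continuous_fst).prodMk continuous_snd)
    have hξm : Measurable ξ :=
      hGc.measurable.comp ((hcdf.measurable.div hPm).const_mul N)
    have hξR : ∀ x, |ξ x| ≤ R := by
      intro x
      have hmem := cdf_mem_Icc (β := β) hR hL (hline (Fin.tail x)) (fun s => hF0 _)
        (hlineS (Fin.tail x)) (x 0)
      exact abs_le.2 ⟨hG0 ▸ hGm hmem.1, hG1 ▸ hGm hmem.2⟩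
    have hw1 : ∀ x, w x ^ 2 = 1 + ∑ i, T' i (Fin.tail x) ^ 2 := fun x => sq_sqrt (by positivity)
    have hwpos : ∀ x, 0 < w x := fun x => sqrt_pos.2 (by positivity)
    have hsum : ∀ x, 1 + ∑ i : Fin (k + 1),
        (Fin.cons (fun x => w x * ξ x) (fun i x => T' i (Fin.tail x)) :
          Fin (k + 1) → (Fin (k + 1) → ℝ) → ℝ) i x ^ 2 =
        (1 + ∑ i, T' i (Fin.tail x) ^ 2) * (1 + ξ x ^ 2) := by
      intro x
      rw [Fin.sum_univ_succ]
      simp only [Fin.cons_zero, Fin.cons_succ]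
      rw [mul_pow, hw1]
      ring
    have hFint : Integrable F := integrable_of_support_box hFc hFs
    have hintP : ∫ x, F x = ∫ y, P y := by
      rw [integral_insertNth 0 hFint]
      refine integral_congr_ae (ae_of_all _ fun y => ?_)
      simp only [Fin.insertNth_zero']
      exact integral_eq_intervalIntegral_of_support hL (hlineS y)
    have hTm : ∀ i, Measurable ((Fin.cons (fun x => w x * ξ x) (fun i x => T' i (Fin.tail x)) :
          Fin (k + 1) → (Fin (k + 1) → ℝ) → ℝ) i) := by
      refine Fin.cases ?_ fun i => ?_
      · exact hwm.mul hξm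
      · exact (h'.measurable_map i).comp htail
    have hwB : ∀ x, w x ≤ √(1 + ∑ _i : Fin k, B ^ 2) := by
      intro x
      refine sqrt_le_sqrt ?_
      gcongr 1 + ?_
      exact Finset.sum_le_sum fun i _ => sq_le_sq' (abs_le.1 (hB i _)).1 (abs_le.1 (hB i _)).2
    have hTB : ∃ B', ∀ i x, |(Fin.cons (fun x => w x * ξ x) (fun i x => T' i (Fin.tail x)) :
          Fin (k + 1) → (Fin (k + 1) → ℝ) → ℝ) i x| ≤ B' := by
      refine ⟨max B (√(1 + ∑ _i : Fin k, B ^ 2) * R), Fin.cases ?_ fun i => ?_⟩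
      · intro x
        rw [Fin.cons_zero, abs_mul, abs_of_pos (hwpos x)]
        exact (mul_le_mul (hwB x) (hξR x) (abs_nonneg _) (sqrt_nonneg _)).trans (le_max_right _ _)
      · intro x
        exact (hB i _).trans (le_max_left _ _)
    refine ⟨Fin.cons (fun x => w x * ξ x) (fun i x => T' i (Fin.tail x)),
      Fin.cons (fun x => w x * ((1 + ξ x ^ 2) ^ β * (N * (F x / P (Fin.tail x)))))
        (fun i x => D' i (Fin.tail x)), hTm, ?_, hTB, ?_, ?_, ?_, ?_⟩
    · refine Fin.cases ?_ fun i => ?_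
      · exact hwm.mul ((((hξm.pow_const 2).const_add 1).pow_const β).mul
          ((hFc.measurable.div hPm).const_mul N))
      · exact (h'.measurable_diag i).comp htail
    · refine Fin.cases (fun x => ?_) fun i x => h'.diag_nonneg i _
      have := hF0 x
      have := hP0 (Fin.tail x)
      have := hwpos x
      simp only [Fin.cons_zero]
      positivity
    · refine Fin.cases (fun x hx τ => ?_) fun i x hx τ => ?_
      · simp only [Fin.cons_zero, hw, hξ, Fin.tail_update_zero, Function.update_self]
        have := hasDerivAt_quantile (β := β) hR hL (hline (Fin.tail x)) (fun s => hF0 _)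
          (hlineS (Fin.tail x)) hG τ
        have hupd : Function.update x 0 τ = (Fin.cons τ (Fin.tail x) : Fin (k + 1) → ℝ) := by
          rw [← Fin.cons_self_tail (Function.update x 0 τ)]
          simp
        rw [hupd]
        exact this.const_mul _
      · simp only [Fin.cons_succ, Fin.tail_update_succ]
        exact h'.hasDerivAt i _ (hPpos x hx) τ
    · intro x hx
      rw [hsum, Fin.prod_univ_succ]
      simp only [Fin.cons_zero, Fin.cons_succ]
      have hd := h'.density _ (hPpos x hx)
      rw [hintP, Finset.prod_range_succ']
      have hprod : ∀ j : ℕ, β - ((j + 1 : ℕ) : ℝ) / 2 = β - 1 / 2 - j / 2 := fun j => by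
        push_cast; ring
      simp only [hprod, Nat.cast_zero, zero_div, sub_zero]
      have hs : 0 < 1 + ∑ i, T' i (Fin.tail x) ^ 2 := by positivity
      rw [mul_rpow hs.le (by positivity)]
      have hws : (1 + ∑ i, T' i (Fin.tail x) ^ 2) ^ β =
          w x * (1 + ∑ i, T' i (Fin.tail x) ^ 2) ^ (β - 1 / 2) := by
        rw [hw]
        simp only
        rw [sqrt_eq_rpow, ← rpow_add hs]
        congr 1
        ring
      rw [hws]
      have hPne := hPpos x hx
      rw [mul_assoc, hd, ← hNdef]
      field_simp
    · simp only [hsum]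
      obtain ⟨B', hB'⟩ := hTB
      have hint_prod : Integrable fun x => F x *
          ((1 + ∑ i, T' i (Fin.tail x) ^ 2) * (1 + ξ x ^ 2)) := by
        simp only [← hsum]
        refine hFint.mul_bdd (c := 1 + ∑ _i : Fin (k + 1), B' ^ 2) ?_ (ae_of_all _ fun x => ?_)
        · exact (measurable_const.add (Finset.measurable_sum _ fun i _ =>
            (hTm i).pow_const 2)).aestronglyMeasurable
        · rw [norm_of_nonneg (by positivity)]
          gcongr 1 + ?_
          exact Finset.sum_le_sum fun i _ => sq_le_sq' (abs_le.1 (hB' i _)).1 (abs_le.1 (hB' i _)).2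
      rw [integral_insertNth 0 hint_prod]
      have hinner : ∀ y : Fin k → ℝ, ∫ s : ℝ, F (Fin.insertNth 0 s y) *
          ((1 + ∑ i, T' i (Fin.tail (Fin.insertNth 0 s y : Fin (k + 1) → ℝ)) ^ 2) *
            (1 + ξ (Fin.insertNth 0 s y) ^ 2)) =
          (truncInt (β - 1) R / N) * (P y * (1 + ∑ i, T' i y ^ 2)) := by
        intro y
        simp only [Fin.insertNth_zero', Fin.tail_cons, hξ, Fin.cons_zero]
        rw [integral_eq_intervalIntegral_of_support hL fun s hs =>
          hlineS y s (left_ne_zero_of_mul hs)]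
        have := integral_quantile_moment (β := β) hR hL (hline y) (fun s => hF0 _)
          (hlineS y) hG0 hG1 hG
        rw [← hNdef] at this
        calc _ = ∫ s in (-L)..L, (1 + ∑ i, T' i y ^ 2) * (F (Fin.cons s y : Fin (k + 1) → ℝ) *
              (1 + G (N * ((∫ s in (-L)..s, F (Fin.cons s y : Fin (k + 1) → ℝ)) / P y)) ^ 2)) := by
              congr 1
              ext s
              ring
          _ = _ := by
              rw [intervalIntegral.integral_const_mul, this]
              ring
      simp only [hinner]
      rw [integral_const_mul, h'.moment, hintP, Finset.prod_range_succ']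
      have hprod : ∀ j : ℕ, β - ((j + 1 : ℕ) : ℝ) / 2 = β - 1 / 2 - j / 2 := fun j => by
        push_cast; ring
      have hprod' : ∀ j : ℕ, β - 1 - ((j + 1 : ℕ) : ℝ) / 2 = β - 1 / 2 - 1 - j / 2 := fun j => by
        push_cast; ring
      simp only [hprod, hprod', Nat.cast_zero, zero_div, sub_zero]
      rw [← hNdef]
      ring

theorem integral_mul_deriv_of_bounded_monotone {φ φ' T D : ℝ → ℝ} {L B : ℝ}
    (hφ : ∀ τ, HasDerivAt φ (φ' τ) τ) (hφs : ∀ s, φ s ≠ 0 → |s| ≤ L) (hφ' : Integrable φ')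
    (hT : ∀ τ, HasDerivAt T (D τ) τ) (hB : ∀ τ, |T τ| ≤ B) (hD : ∀ τ, 0 ≤ D τ) :
    Integrable (fun τ => φ τ * D τ) ∧ ∫ τ, φ τ * D τ = -∫ τ, φ' τ * T τ := by
  have hφc : Continuous φ := continuous_iff_continuousAt.2 fun τ => (hφ τ).continuousAt
  have hTc : Continuous T := continuous_iff_continuousAt.2 fun τ => (hT τ).continuousAt
  have hDi : IntegrableOn D (Set.Icc (-L) L) := by
    rw [integrableOn_Icc_iff_integrableOn_Ioc]
    exact intervalIntegral.integrableOn_deriv_of_nonneg hTc.continuousOn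
      (fun x _ => hT x) (fun x _ => hD x)
  have hφD : Integrable (fun τ => φ τ * D τ) := by
    have h1 : IntegrableOn (fun τ => φ τ * D τ) (Set.Icc (-L) L) :=
      hDi.continuousOn_mul hφc.continuousOn isCompact_Icc
    refine (integrableOn_iff_integrable_of_support_subset fun s hs => ?_).1 h1
    exact abs_le.1 (hφs s (left_ne_zero_of_mul hs))
  have hφT : Integrable (fun τ => φ τ * T τ) := by
    have h1 : IntegrableOn (fun τ => φ τ * T τ) (Set.Icc (-L) L) :=
      (hφc.mul hTc).continuousOn.integrableOn_compact isCompact_Icc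
    refine (integrableOn_iff_integrable_of_support_subset fun s hs => ?_).1 h1
    exact abs_le.1 (hφs s (left_ne_zero_of_mul hs))
  have hφ'T : Integrable (fun τ => φ' τ * T τ) :=
    hφ'.mul_bdd hTc.aestronglyMeasurable (ae_of_all _ hB)
  exact ⟨hφD, integral_mul_deriv_eq_deriv_mul_of_integrable (fun x _ => hφ x) (fun x _ => hT x)
    hφD hφ'T hφT⟩

theorem lintegral_mul_diag_eq {m : ℕ} (hm : 0 < m) {L B : ℝ} (i : Fin (m + 1))
    {φ φ' T D : (Fin (m + 1) → ℝ) → ℝ} (hφ0 : ∀ x, 0 ≤ φ x) (hφm : Measurable φ)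
    (hφs : ∀ x, φ x ≠ 0 → ∀ j, |x j| ≤ L)
    (hφ : ∀ x, x ≠ 0 → HasDerivAt (fun s => φ (Function.update x i s)) (φ' x) (x i))
    (hφ' : Integrable φ') (hTm : Measurable T) (hDm : Measurable D) (hB : ∀ x, |T x| ≤ B)
    (hD : ∀ x, 0 ≤ D x)
    (hT : ∀ x, φ x ≠ 0 → ∀ τ,
      HasDerivAt (fun s => T (Function.update x i s)) (D (Function.update x i τ)) τ) :
    0 ≤ -∫ x, φ' x * T x ∧
      ∫⁻ x, ENNReal.ofReal (φ x * D x) = ENNReal.ofReal (-∫ x, φ' x * T x) := by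
  have : Nonempty (Fin m) := ⟨⟨0, hm⟩⟩
  have hφ'T : Integrable (fun x => φ' x * T x) :=
    hφ'.mul_bdd hTm.aestronglyMeasurable (ae_of_all _ hB)
  have hφ'i := integrable_insertNth i hφ'
  have hφ'Ti := integrable_insertNth i hφ'T
  have hHi : Integrable fun y : Fin m → ℝ =>
      -∫ s, φ' (i.insertNth s y) * T (i.insertNth s y) :=
    (Integrable.integral_prod_right hφ'Ti).neg
  have hupd : ∀ (s τ : ℝ) (y : Fin m → ℝ),
      Function.update (i.insertNth s y : Fin (m + 1) → ℝ) i τ = i.insertNth τ y := by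
    intro s τ y
    simp
  have hline : ∀ᵐ y : Fin m → ℝ, (∀ s, 0 ≤ φ (i.insertNth s y) * D (i.insertNth s y)) ∧
      Integrable (fun s => φ (i.insertNth s y) * D (i.insertNth s y)) ∧
      ∫ s, φ (i.insertNth s y) * D (i.insertNth s y) =
        -∫ s, φ' (i.insertNth s y) * T (i.insertNth s y) := by
    filter_upwards [(volume : Measure (Fin m → ℝ)).ae_ne 0, hφ'i.prod_left_ae] with y hy hyi
    refine ⟨fun s => mul_nonneg (hφ0 _) (hD _), ?_⟩
    have hne : ∀ s : ℝ, (i.insertNth s y : Fin (m + 1) → ℝ) ≠ 0 := by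
      intro s h0
      refine hy (funext fun j => ?_)
      have := congrFun h0 (i.succAbove j)
      simpa using this
    have hder : ∀ τ, HasDerivAt (fun s => φ (i.insertNth s y)) (φ' (i.insertNth τ y)) τ := by
      intro τ
      have := hφ _ (hne τ)
      simpa only [hupd, Fin.insertNth_apply_same] using this
    by_cases hz : ∀ s : ℝ, φ (i.insertNth s y) = 0
    · have hz' : ∀ s : ℝ, φ' (i.insertNth s y) = 0 := by
        intro s
        have h1 := hder s
        simp only [hz] at h1
        exact h1.unique (hasDerivAt_const s 0)
      simp [hz, hz']
    · obtain ⟨s, hs⟩ := not_forall.1 hz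
      refine integral_mul_deriv_of_bounded_monotone (L := L) (B := B) hder (fun s hs => ?_) hyi ?_
        (fun _ => hB _) (fun _ => hD _)
      · simpa using hφs _ hs i
      · intro τ
        have := hT _ hs τ
        simpa only [hupd] using this
  have hpos : 0 ≤ᵐ[volume] fun y : Fin m → ℝ =>
      -∫ s, φ' (i.insertNth s y) * T (i.insertNth s y) := by
    filter_upwards [hline] with y hy
    simp only [Pi.zero_apply]
    rw [← hy.2.2]
    exact integral_nonneg hy.1
  rw [integral_insertNth i hφ'T, ← integral_neg]
  refine ⟨integral_nonneg_of_ae hpos, ?_⟩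
  rw [← (measurePreserving_insertNth i).lintegral_comp_emb (measurableEmbedding_insertNth i),
    lintegral_prod_symm _ ?_,
    ofReal_integral_eq_lintegral_ofReal hHi hpos]
  · refine lintegral_congr_ae ?_
    filter_upwards [hline] with y hy
    rw [← hy.2.2, ofReal_integral_eq_lintegral_ofReal hy.2.1 (ae_of_all _ hy.1)]
  · exact ((hφm.mul hDm).ennreal_ofReal.comp
      (measurePreserving_insertNth i).measurable).aemeasurable

theorem sq_le_of_forall_young {c q E A : ℝ} (hc : 0 ≤ c) (hq : 0 ≤ q) (hE : 0 ≤ E) (hA : 0 ≤ A)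
    (h : ∀ l : ℝ, 0 < l → c ≤ q * (l / 2 * E + A / (2 * l))) : c ^ 2 ≤ q ^ 2 * (E * A) := by
  have hd : discrim (q * E / 2) (-c) (q * A / 2) ≤ 0 := by
    refine discrim_le_zero fun l => ?_
    rcases le_or_gt l 0 with hl | hl
    · have h1 : 0 ≤ -c * l := by nlinarith
      have h2 : 0 ≤ l * l := mul_self_nonneg l
      positivity
    · have h1 := mul_le_mul_of_nonneg_left (h l hl) hl.le
      have h2 : l * (q * (l / 2 * E + A / (2 * l))) = q * E / 2 * (l * l) + q * A / 2 := by
        field_simp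
      linarith
  rw [discrim] at hd
  linarith

theorem sobolev_truncated {m : ℕ} (hm : 2 ≤ m) {L R : ℝ} (hL : 0 < L) (hR : 0 < R)
    {f : (Fin (m + 1) → ℝ) → ℝ} {g : Fin (m + 1) → (Fin (m + 1) → ℝ) → ℝ}
    (hf : Continuous f) (hfs : ∀ x, f x ≠ 0 → ∀ j, |x j| ≤ L)
    (hg : ∀ i, Measurable (g i)) (hgi : ∀ i, Integrable fun x => g i x ^ 2)
    (hd : ∀ i x, x ≠ 0 → HasDerivAt (fun s => f (Function.update x i s)) (g i x) (x i))
    {p q n : ℝ} (hn : n = ((m + 1 : ℕ) : ℝ)) (hp : p = 2 * n / (n - 2))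
    (hq : q = 2 * (n - 1) / (n - 2)) (hI : 0 < ∫ x, |f x| ^ p) :
    n ^ 2 * (∏ j ∈ Finset.range (m + 1), truncInt (n - j / 2) R) ^ (2 / n) *
      (∏ j ∈ Finset.range (m + 1), truncInt (n - 1 - j / 2) R / truncInt (n - j / 2) R) ^ 2 *
      (∫ x, |f x| ^ p) ^ ((n - 2) / n) ≤
    q ^ 2 * ((∫ x, ∑ i, g i x ^ 2) *
      ((∏ j ∈ Finset.range (m + 1), truncInt (n - 1 - j / 2) R / truncInt (n - j / 2) R) - 1)) := by
  have hn3 : 3 ≤ n := by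
    rw [hn]; push_cast
    have : (2 : ℝ) ≤ m := by exact_mod_cast hm
    linarith
  have hn2 : 0 < n - 2 := by linarith
  have hp2 : 2 < p := by rw [hp, lt_div_iff₀ hn2]; linarith
  have hq2 : 2 < q := by rw [hq, lt_div_iff₀ hn2]; linarith
  have hpq : p * (1 / n) + q = p := by rw [hp, hq]; field_simp; ring
  have hqp : 2 * (q - 1) = p := by rw [hp, hq]; field_simp; ring
  set F : (Fin (m + 1) → ℝ) → ℝ := fun x => |f x| ^ p with hF
  have hFc : Continuous F := hf.abs.rpow_const fun x => Or.inr (by linarith)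
  have hF0 : ∀ x, 0 ≤ F x := fun x => by positivity
  have hFf : ∀ x, F x ≠ 0 → f x ≠ 0 := by
    intro x hx h0
    refine hx ?_
    simp only [hF, h0, abs_zero]
    exact zero_rpow (by linarith)
  have hFs : ∀ x, F x ≠ 0 → ∀ j, |x j| ≤ L := fun x hx => hfs x (hFf x hx)
  have hFi : Integrable F := integrable_of_support_box hFc hFs
  obtain ⟨T, D, hTD⟩ := exists_triangularTransport hR hL (m + 1) n F hFc hF0 hFs
  obtain ⟨B, hB⟩ := hTD.bounded
  set K := ∏ j ∈ Finset.range (m + 1), truncInt (n - j / 2) R with hK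
  have hKpos : 0 < K := Finset.prod_pos fun j _ => truncInt_pos _ hR
  set M := ∏ j ∈ Finset.range (m + 1), truncInt (n - 1 - j / 2) R / truncInt (n - j / 2) R with hM
  have hMpos : 0 < M :=
    Finset.prod_pos fun j _ => div_pos (truncInt_pos _ hR) (truncInt_pos _ hR)
  set I := ∫ x, F x with hIdef
  set E := ∫ x, ∑ i, g i x ^ 2 with hE
  have hmom : ∫ x, F x * (1 + ∑ i, T i x ^ 2) = M * I := hTD.moment
  have hT2m : Measurable fun x => ∑ i, T i x ^ 2 :=
    Finset.measurable_sum _ fun i _ => (hTD.measurable_map i).pow_const 2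
  have hT2b : ∀ x, ∑ i, T i x ^ 2 ≤ ∑ _i : Fin (m + 1), B ^ 2 := fun x =>
    Finset.sum_le_sum fun i _ => sq_le_sq' (abs_le.1 (hB i x)).1 (abs_le.1 (hB i x)).2
  have hT2F : Integrable fun x => F x * ∑ i, T i x ^ 2 := by
    refine hFi.mul_bdd (c := ∑ _i : Fin (m + 1), B ^ 2) hT2m.aestronglyMeasurable
      (ae_of_all _ fun x => ?_)
    rw [norm_of_nonneg (by positivity)]
    exact hT2b x
  have hFT : ∫ x, F x * ∑ i, T i x ^ 2 = I * (M - 1) := by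
    have : ∫ x, F x * (1 + ∑ i, T i x ^ 2) = I + ∫ x, F x * ∑ i, T i x ^ 2 := by
      simp only [mul_add, mul_one]
      exact integral_add hFi hT2F
    linarith
  have hF1T : Integrable fun x => F x * (1 + ∑ i, T i x ^ 2) := by
    simp only [mul_add, mul_one]
    exact hFi.add hT2F
  -- the derivative of `|f|^q`
  set φ : (Fin (m + 1) → ℝ) → ℝ := fun x => |f x| ^ q with hφ
  set φ' : Fin (m + 1) → (Fin (m + 1) → ℝ) → ℝ :=
    fun i x => q * |f x| ^ (q - 2) * f x * g i x with hφ'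
  have hsq : ∀ x, (|f x| ^ (q - 2) * f x) ^ 2 = F x := by
    intro x
    by_cases h0 : f x = 0
    · simp only [hF, h0, abs_zero, mul_zero]
      rw [zero_rpow (by linarith : p ≠ 0)]
      norm_num
    · have habs : 0 < |f x| := abs_pos.2 h0
      simp only [hF]
      rw [mul_pow, ← sq_abs (f x), ← rpow_natCast, ← rpow_natCast, ← rpow_mul habs.le,
        ← rpow_add habs]
      congr 1
      push_cast
      linarith
  have hφi : ∀ i x, x ≠ 0 →
      HasDerivAt (fun s => φ (Function.update x i s)) (φ' i x) (x i) := by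
    intro i x hx
    have h1 := hd i x hx
    have h2 := hasDerivAt_abs_rpow (f (Function.update x i (x i))) (p := q) (by linarith)
    have h3 := h2.comp (x i) h1
    rw [Function.update_eq_self] at h3
    exact h3
  have hyoung : ∀ (a b l : ℝ), 0 < l → -(a * b) ≤ l / 2 * b ^ 2 + a ^ 2 / (2 * l) := by
    intro a b l hl
    have : l / 2 * b ^ 2 + a ^ 2 / (2 * l) + a * b = (l * b + a) ^ 2 / (2 * l) := by
      field_simp; ring
    have h2 : 0 ≤ (l * b + a) ^ 2 / (2 * l) := by positivity
    linarith
  have hφ'i : ∀ i, Integrable (φ' i) := by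
    intro i
    have hmeas : Measurable (φ' i) :=
      (((hf.abs.measurable.pow_const _).const_mul q).mul hf.measurable).mul (hg i)
    refine ((((hgi i).const_mul (1 / 2)).add (hFi.div_const 2)).const_mul q).mono'
      hmeas.aestronglyMeasurable (ae_of_all _ fun x => ?_)
    have h1 := hyoung (|f x| ^ (q - 2) * f x) (g i x) 1 one_pos
    have h2 := hyoung (-(|f x| ^ (q - 2) * f x)) (g i x) 1 one_pos
    rw [neg_sq] at h2
    rw [hsq] at h1 h2
    have h3 : φ' i x = q * ((|f x| ^ (q - 2) * f x) * g i x) := by simp only [hφ']; ring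
    have h4 : |(|f x| ^ (q - 2) * f x) * g i x| ≤ 1 / 2 * g i x ^ 2 + F x / 2 :=
      abs_le.2 ⟨by linarith, by linarith⟩
    rw [h3, norm_eq_abs, abs_mul, abs_of_pos (by linarith : 0 < q)]
    exact mul_le_mul_of_nonneg_left h4 (by linarith)
  have hφc : Continuous φ := hf.abs.rpow_const fun x => Or.inr (by linarith)
  have hφf : ∀ x, φ x ≠ 0 → f x ≠ 0 := by
    intro x hx h0
    refine hx ?_
    simp only [hφ, h0, abs_zero]
    exact zero_rpow (by linarith)
  have hfF : ∀ x, f x ≠ 0 → F x ≠ 0 := fun x hx => (rpow_pos_of_pos (abs_pos.2 hx) _).ne'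
  have hibp : ∀ i, 0 ≤ -∫ x, φ' i x * T i x ∧ ∫⁻ x, ENNReal.ofReal (φ x * D i x) =
      ENNReal.ofReal (-∫ x, φ' i x * T i x) := fun i =>
    lintegral_mul_diag_eq (by omega) (L := L) (B := B) i (fun x => by positivity) hφc.measurable
      (fun x hx => hfs x (hφf x hx)) (hφi i) (hφ'i i) (hTD.measurable_map i)
      (hTD.measurable_diag i) (hB i) (hTD.diag_nonneg i)
      (fun x hx => hTD.hasDerivAt i x (hfF x (hφf x hx)))
  have hφ'T : ∀ i, Integrable fun x => φ' i x * T i x := fun i =>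
    (hφ'i i).mul_bdd (hTD.measurable_map i).aestronglyMeasurable (ae_of_all _ (hB i))
  have hneg : ∀ i, Integrable fun x => -(φ' i x * T i x) := fun i => (hφ'T i).neg
  -- arithmetic-geometric mean inequality for the diagonal derivatives
  have hamgm : ∀ x, n * (K / I) ^ (1 / n) * (F x * (1 + ∑ i, T i x ^ 2)) ≤ ∑ i, φ x * D i x := by
    intro x
    by_cases hx : F x = 0
    · rw [hx, zero_mul, mul_zero]
      exact Finset.sum_nonneg fun i _ => mul_nonneg (by positivity) (hTD.diag_nonneg i x)
    have hFx : 0 < F x := lt_of_le_of_ne (hF0 x) (Ne.symm hx)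
    have habs : 0 < |f x| := abs_pos.2 (hFf x hx)
    have h1 := geom_mean_le_arith_mean_weighted Finset.univ (fun _ : Fin (m + 1) => 1 / n)
      (fun i => D i x) (fun _ _ => by positivity) (by simp [hn]; field_simp)
      (fun i _ => hTD.diag_nonneg i x)
    rw [finsetProd_rpow _ _ (fun i _ => hTD.diag_nonneg i x)] at h1
    have hden := hTD.density x hx
    rw [← hK, ← hIdef] at hden
    have hS : 0 < 1 + ∑ i, T i x ^ 2 := by positivity
    have h2 : ∏ i, D i x = K / I * F x * (1 + ∑ i, T i x ^ 2) ^ n := by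
      field_simp
      linarith
    rw [h2, mul_rpow (by positivity) (by positivity), mul_rpow (by positivity) hFx.le,
      ← rpow_mul hS.le, mul_one_div_cancel (by linarith), rpow_one, ← Finset.mul_sum] at h1
    have h3 : F x = F x ^ (1 / n) * φ x := by
      simp only [hF, hφ]
      rw [← rpow_mul habs.le, ← rpow_add habs, hpq]
    have hφx : 0 ≤ φ x := by positivity
    rw [← Finset.mul_sum]
    have h4 := mul_le_mul_of_nonneg_left h1 (mul_nonneg (by linarith : 0 ≤ n) hφx)
    calc n * (K / I) ^ (1 / n) * (F x * (1 + ∑ i, T i x ^ 2))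
        = n * φ x * ((K / I) ^ (1 / n) * F x ^ (1 / n) * (1 + ∑ i, T i x ^ 2)) := by
          nth_rewrite 1 [h3]; ring
      _ ≤ _ := h4
      _ = _ := by field_simp
  set c := n * (K / I) ^ (1 / n) * (M * I) with hc
  have hcpos : 0 < c := by positivity
  have hcZ : c ≤ ∑ i, -∫ x, φ' i x * T i x := by
    have h1 : ENNReal.ofReal c ≤ ENNReal.ofReal (∑ i, -∫ x, φ' i x * T i x) := by
      rw [ENNReal.ofReal_sum_of_nonneg fun i _ => (hibp i).1, hc, ← hmom, ← integral_const_mul,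
        ofReal_integral_eq_lintegral_ofReal (hF1T.const_mul _)
          (ae_of_all _ fun x => mul_nonneg (by positivity) (mul_nonneg (hF0 x) (by positivity)))]
      simp only [← (hibp _).2]
      rw [← lintegral_finsetSum]
      · refine lintegral_mono fun x => ?_
        rw [← ENNReal.ofReal_sum_of_nonneg fun i _ =>
          mul_nonneg (by positivity) (hTD.diag_nonneg i x)]
        exact ENNReal.ofReal_le_ofReal (hamgm x)
      · exact fun i _ => (hφc.measurable.mul (hTD.measurable_diag i)).ennreal_ofReal
    rcases ENNReal.ofReal_le_ofReal_iff'.1 h1 with h | h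
    · exact h
    · linarith
  have hupper : ∀ l : ℝ, 0 < l → c ≤ q * (l / 2 * E + I * (M - 1) / (2 * l)) := by
    intro l hl
    refine hcZ.trans ?_
    rw [← hFT, hE, ← integral_const_mul, ← integral_div,
      ← integral_add ((integrable_finsetSum _ fun i _ => hgi i).const_mul _) (hT2F.div_const _),
      ← integral_const_mul]
    simp only [← integral_neg]
    rw [← integral_finsetSum _ fun i _ => hneg i]
    refine integral_mono (integrable_finsetSum _ fun i _ => hneg i)
      ((((integrable_finsetSum _ fun i _ => hgi i).const_mul _).add
        (hT2F.div_const _)).const_mul q) fun x => ?_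
    simp only
    rw [Finset.mul_sum, Finset.mul_sum, Finset.sum_div, ← Finset.sum_add_distrib, Finset.mul_sum]
    refine Finset.sum_le_sum fun i _ => ?_
    have h1 := hyoung (|f x| ^ (q - 2) * f x * T i x) (g i x) l hl
    rw [mul_pow, hsq] at h1
    have h2 := mul_le_mul_of_nonneg_left h1 (by linarith : 0 ≤ q)
    refine le_trans (le_of_eq ?_) h2
    simp only [hφ']
    ring
  have hM1 : 0 ≤ I * (M - 1) := by
    rw [← hFT]
    exact integral_nonneg fun x => mul_nonneg (hF0 x) (by positivity)
  have hE0 : 0 ≤ E := integral_nonneg fun x => by positivity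
  have hfin := sq_le_of_forall_young hcpos.le (by linarith) hE0 hM1 hupper
  have hpow : ((K / I) ^ (1 / n)) ^ 2 = K ^ (2 / n) * (I ^ ((n - 2) / n) / I) := by
    rw [← rpow_natCast, ← rpow_mul (by positivity), div_rpow hKpos.le hI.le,
      show (n - 2) / n = 1 - 2 / n by field_simp, rpow_sub hI, rpow_one]
    rw [show 1 / n * ((2 : ℕ) : ℝ) = 2 / n by push_cast; ring]
    field_simp
  have hc2 : c ^ 2 = n ^ 2 * K ^ (2 / n) * M ^ 2 * I ^ ((n - 2) / n) * I := by
    rw [hc, mul_pow, mul_pow, hpow]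
    field_simp
  rw [hc2] at hfin
  refine le_of_mul_le_mul_right (hfin.trans (le_of_eq ?_)) hI
  ring

theorem sobolev_pi {m : ℕ} (hm : 2 ≤ m) {L : ℝ} (hL : 0 < L)
    {f : (Fin (m + 1) → ℝ) → ℝ} {g : Fin (m + 1) → (Fin (m + 1) → ℝ) → ℝ}
    (hf : Continuous f) (hfs : ∀ x, f x ≠ 0 → ∀ j, |x j| ≤ L)
    (hg : ∀ i, Measurable (g i)) (hgi : ∀ i, Integrable fun x => g i x ^ 2)
    (hd : ∀ i x, x ≠ 0 → HasDerivAt (fun s => f (Function.update x i s)) (g i x) (x i))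
    {n : ℝ} (hn : n = ((m + 1 : ℕ) : ℝ)) :
    sobolevConst (m + 1) * (∫ x, |f x| ^ (2 * n / (n - 2))) ^ ((n - 2) / n) ≤
      ∫ x, ∑ i, g i x ^ 2 := by
  have hn3 : 3 ≤ n := by
    rw [hn]; push_cast
    have : (2 : ℝ) ≤ m := by exact_mod_cast hm
    linarith
  have hn2 : 0 < n - 2 := by linarith
  have hE0 : 0 ≤ ∫ x, ∑ i, g i x ^ 2 := integral_nonneg fun x => by positivity
  rcases (integral_nonneg fun x => by positivity :
    0 ≤ ∫ x, |f x| ^ (2 * n / (n - 2))).eq_or_lt with hI | hI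
  · rw [← hI, zero_rpow (by positivity), mul_zero]
    exact hE0
  have hnn : ((m + 1 : ℕ) : ℝ) - (m + 1 : ℕ) / 2 = n / 2 := by rw [← hn]; ring
  have hP := tendsto_prod_truncInt (β := n) (m + 1) (by rw [← hn]; linarith)
  have hN := tendsto_prod_truncInt (β := n - 1) (m + 1) (by rw [← hn]; linarith)
  have hG : 0 < Gamma n := Gamma_pos_of_pos (by linarith)
  have hG1 : 0 < Gamma (n - 1) := Gamma_pos_of_pos (by linarith)
  have hH1 : 0 < Gamma (n / 2 - 1) := Gamma_pos_of_pos (by linarith)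
  have hGr : Gamma n = (n - 1) * Gamma (n - 1) := by
    have := Gamma_add_one (s := n - 1) (by linarith)
    rwa [sub_add_cancel] at this
  have hHr : Gamma (n / 2) = (n / 2 - 1) * Gamma (n / 2 - 1) := by
    have := Gamma_add_one (s := n / 2 - 1) (by linarith)
    rwa [sub_add_cancel] at this
  have hH : 0 < Gamma (n / 2) := Gamma_pos_of_pos (by linarith)
  have hsq : 0 < √π ^ (m + 1) := by positivity
  rw [← hn, show n - n / 2 = n / 2 by ring] at hP
  rw [← hn, show n - 1 - n / 2 = n / 2 - 1 by ring] at hN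
  set K := √π ^ (m + 1) * Gamma (n / 2) / Gamma n with hK
  have hKpos : 0 < K := by positivity
  have hM := hN.div hP hKpos.ne'
  have hMlim : √π ^ (m + 1) * Gamma (n / 2 - 1) / Gamma (n - 1) / K = 2 * (n - 1) / (n - 2) := by
    rw [hK, hGr, hHr, show n / 2 - 1 = (n - 2) / 2 by ring]
    rw [show n / 2 - 1 = (n - 2) / 2 by ring] at hH1
    have : n - 1 ≠ 0 := by linarith
    field_simp
  rw [hMlim] at hM
  set q := 2 * (n - 1) / (n - 2) with hq
  have hlim := le_of_tendsto_of_tendsto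
    ((((hP.rpow_const (p := 2 / n) (Or.inl hKpos.ne')).const_mul (n ^ 2)).mul
      (hM.pow 2)).mul_const ((∫ x, |f x| ^ (2 * n / (n - 2))) ^ ((n - 2) / n)))
    (((hM.sub_const 1).const_mul (∫ x, ∑ i, g i x ^ 2)).const_mul (q ^ 2))
    (by
      filter_upwards [eventually_gt_atTop 0] with R hR
      have := sobolev_truncated hm hL hR hf hfs hg hgi hd hn rfl hq hI
      rw [Finset.prod_div_distrib] at this
      exact this)
  have hq1 : q - 1 = n / (n - 2) := by rw [hq]; field_simp; ring
  have hqpos : 0 < q := div_pos (by linarith) hn2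
  have hKn : K ^ (2 / n) = π * (Gamma (n / 2) / Gamma n) ^ (2 / n) := by
    rw [hK, mul_div_assoc, mul_rpow hsq.le (by positivity), ← rpow_natCast, ← hn,
      ← rpow_mul (by positivity), mul_div_cancel₀ _ (by linarith : n ≠ 0), rpow_two,
      sq_sqrt pi_pos.le]
  rw [hq1, hKn] at hlim
  unfold sobolevConst
  rw [← hn]
  set J := (∫ x, |f x| ^ (2 * n / (n - 2))) ^ ((n - 2) / n)
  set Q := (Gamma (n / 2) / Gamma n) ^ (2 / n)
  have hk : 0 < q ^ 2 * n / (n - 2) := by positivity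
  refine le_of_mul_le_mul_left ?_ hk
  calc _ = n ^ 2 * (π * Q) * q ^ 2 * J := by field_simp
    _ ≤ _ := hlim
    _ = _ := by ring

theorem sobolev_euclidean {n : ℕ} (hn : 3 ≤ n) {w : EuclideanSpace ℝ (Fin n) → ℝ}
    {w' : EuclideanSpace ℝ (Fin n) → EuclideanSpace ℝ (Fin n)}
    (hw : Continuous w) (hc : HasCompactSupport w) (hw' : Measurable w')
    (hd : ∀ x ≠ 0, HasGradientAt w (w' x) x) (hi : Integrable fun x => ‖w' x‖ ^ 2) :
    sobolevConst n * (∫ x, |w x| ^ (2 * (n : ℝ) / ((n : ℝ) - 2))) ^ (((n : ℝ) - 2) / n) ≤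
      ∫ x, ‖w' x‖ ^ 2 := by
  obtain ⟨m, rfl⟩ : ∃ m, n = m + 1 := ⟨n - 1, by omega⟩
  obtain ⟨L, hL, hwL⟩ := hc.isCompact.isBounded.exists_pos_norm_le
  have hmp := (EuclideanSpace.volume_preserving_symm_measurableEquiv_toLp (Fin (m + 1))).symm
  have hmeas : Measurable (WithLp.toLp 2 : (Fin (m + 1) → ℝ) → EuclideanSpace ℝ (Fin (m + 1))) :=
    hmp.measurable
  have hcont : Continuous (WithLp.toLp 2 : (Fin (m + 1) → ℝ) → EuclideanSpace ℝ (Fin (m + 1))) :=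
    PiLp.continuous_toLp 2 _
  have hnorm : ∀ x : EuclideanSpace ℝ (Fin (m + 1)), ‖x‖ ^ 2 = ∑ i, x i ^ 2 :=
    EuclideanSpace.real_norm_sq_eq
  have hcoord : ∀ i, Measurable fun x => w' x i := fun i =>
    ((EuclideanSpace.proj (𝕜 := ℝ) i).continuous.measurable).comp hw'
  have hii : ∀ i, Integrable fun x => w' x i ^ 2 := fun i => by
    refine hi.mono' ((hcoord i).pow_const 2).aestronglyMeasurable (ae_of_all _ fun x => ?_)
    rw [norm_of_nonneg (sq_nonneg _), hnorm]
    exact Finset.single_le_sum (f := fun i => w' x i ^ 2) (fun j _ => sq_nonneg _)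
      (Finset.mem_univ i)
  have key := sobolev_pi (m := m) (by omega) hL (f := fun x => w (WithLp.toLp 2 x))
    (g := fun i x => w' (WithLp.toLp 2 x) i) (hw.comp hcont) ?_
    (fun i => (hcoord i).comp hmeas)
    (fun i => hmp.integrable_comp_of_integrable (hii i)) ?_ (n := ((m + 1 : ℕ) : ℝ)) rfl
  · have h1 := hmp.integral_comp' (fun x => |w x| ^ (2 * ((m + 1 : ℕ) : ℝ) / (((m + 1 : ℕ) : ℝ) - 2)))
    have h2 := hmp.integral_comp' (fun x => ‖w' x‖ ^ 2)
    simp only [hnorm] at h2 ⊢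
    rw [← h1, ← h2]
    exact key
  · intro x hx j
    have h1 := hwL _ (subset_tsupport _ (Function.mem_support.2 hx))
    exact (PiLp.norm_apply_le (p := 2) (WithLp.toLp 2 x) j).trans h1
  · intro i x hx
    have hx' : (WithLp.toLp 2 x : EuclideanSpace ℝ (Fin (m + 1))) ≠ 0 := fun h => hx (by simpa using h)
    have h1 := (hd _ hx').hasFDerivAt
    have h2 : HasDerivAt (fun s => (WithLp.toLp 2 (Function.update x i s) :
        EuclideanSpace ℝ (Fin (m + 1)))) (EuclideanSpace.single i 1) (x i) := by
      have := ((PiLp.continuousLinearEquiv 2 ℝ (fun _ : Fin (m + 1) => ℝ)).symm.hasFDerivAt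
        (x := Function.update x i (x i))).comp_hasDerivAt _ (hasDerivAt_update x i (x i))
      exact this
    have h4 := h1.comp_hasDerivAt_of_eq (x i) h2 (by rw [Function.update_eq_self])
    refine h4.congr_deriv ?_
    simp [InnerProductSpace.toDual_apply_apply, EuclideanSpace.inner_single_right]

theorem integrable_div_norm_sq {n : ℕ} (hn : 3 ≤ n) {v : EuclideanSpace ℝ (Fin n) → ℝ}
    (hv : Continuous v) (hc : HasCompactSupport v) : Integrable fun x => v x / ‖x‖ ^ 2 := by
  obtain ⟨C, hC⟩ := hc.exists_bound_of_continuous hv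
  obtain ⟨L, hL, hvL⟩ := hc.isCompact.isBounded.exists_pos_norm_lt
  have hn3 : (3 : ℝ) ≤ n := by exact_mod_cast hn
  have h1 : IntegrableOn (fun x => v x / ‖x‖ ^ 2) (Metric.ball 0 L) := by
    refine integrableOn_ball_of_norm_le_rpow (C := C) (α := 2) ?_ ?_ (ae_of_all _ fun x => ?_) ?_
    · rw [finrank_euclideanSpace_fin]; omega
    · rw [finrank_euclideanSpace_fin]; linarith
    · rw [norm_div, norm_pow, norm_norm, rpow_neg (norm_nonneg _), rpow_two, div_eq_mul_inv]
      exact mul_le_mul_of_nonneg_right (hC x) (by positivity)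
    · exact (hv.measurable.div (measurable_norm.pow_const 2)).aestronglyMeasurable
  refine (integrableOn_iff_integrable_of_support_subset fun x hx => ?_).1 h1
  rw [mem_ball_zero_iff]
  exact hvL x (subset_tsupport _ fun h0 => hx (by simp [h0]))

theorem integral_mul_div_norm_sq_add {n : ℕ} {v : EuclideanSpace ℝ (Fin n) → ℝ}
    (hv : ContDiff ℝ 1 v) (hc : HasCompactSupport v) {ε : ℝ} (hε : 0 < ε) :
    ∫ x, fderiv ℝ v x x / (‖x‖ ^ 2 + ε) =
      -∫ x, v x * (n / (‖x‖ ^ 2 + ε) - 2 * ‖x‖ ^ 2 / (‖x‖ ^ 2 + ε) ^ 2) := by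
  have hpos : ∀ x : EuclideanSpace ℝ (Fin n), 0 < ‖x‖ ^ 2 + ε := fun x => by positivity
  have hv' : Continuous (fderiv ℝ v) := hv.continuous_fderiv one_ne_zero
  let e : Fin n → EuclideanSpace ℝ (Fin n) := fun i => EuclideanSpace.single i 1
  have hco : ∀ i, Continuous fun x : EuclideanSpace ℝ (Fin n) => x i := fun i =>
    (EuclideanSpace.proj (𝕜 := ℝ) i).continuous
  have hd : ∀ (i : Fin n) (x : EuclideanSpace ℝ (Fin n)),
      HasFDerivAt (fun x : EuclideanSpace ℝ (Fin n) => x i / (‖x‖ ^ 2 + ε))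
        ((‖x‖ ^ 2 + ε)⁻¹ • (EuclideanSpace.proj (𝕜 := ℝ) i : EuclideanSpace ℝ (Fin n) →L[ℝ] ℝ) +
          x i • (-((‖x‖ ^ 2 + ε) ^ 2)⁻¹) • (2 : ℝ) • innerSL ℝ x) x := by
    intro i x
    have h1 : HasFDerivAt (fun x : EuclideanSpace ℝ (Fin n) => x i)
      (EuclideanSpace.proj (𝕜 := ℝ) i : EuclideanSpace ℝ (Fin n) →L[ℝ] ℝ) x :=
      (EuclideanSpace.proj (𝕜 := ℝ) i).hasFDerivAt
    have h2 : HasFDerivAt (fun x : EuclideanSpace ℝ (Fin n) => ‖x‖ ^ 2 + ε)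
      ((2 : ℝ) • innerSL ℝ x) x := by
      exact ((hasStrictFDerivAt_norm_sq x).hasFDerivAt.add_const ε).congr_fderiv
        (by rw [two_smul, two_smul])
    have h3 := (hasDerivAt_inv (hpos x).ne').comp_hasFDerivAt x h2
    have h4 := h1.mul h3
    simp only [div_eq_mul_inv]
    refine h4.congr_fderiv ?_
    simp only [Function.comp_apply]
    rw [add_comm]
  have hfd : ∀ (i : Fin n) (x : EuclideanSpace ℝ (Fin n)),
      fderiv ℝ (fun x : EuclideanSpace ℝ (Fin n) => x i / (‖x‖ ^ 2 + ε)) x (e i) =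
        1 / (‖x‖ ^ 2 + ε) - 2 * x i ^ 2 / (‖x‖ ^ 2 + ε) ^ 2 := by
    intro i x
    rw [(hd i x).fderiv]
    have hx := hpos x
    simp [e, EuclideanSpace.inner_single_right]
    field_simp
    ring
  have hden : Continuous fun x : EuclideanSpace ℝ (Fin n) => ‖x‖ ^ 2 + ε := by fun_prop
  have hA : ∀ i, Integrable fun x => x i / (‖x‖ ^ 2 + ε) * fderiv ℝ v x (e i) := by
    intro i
    refine Continuous.integrable_of_hasCompactSupport
      (((hco i).div hden fun x => (hpos x).ne').mul (hv'.clm_apply continuous_const)) ?_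
    exact (hc.fderiv_apply ℝ (e i)).mul_left
  have hB : ∀ i, Integrable fun x => fderiv ℝ (fun x : EuclideanSpace ℝ (Fin n) =>
      x i / (‖x‖ ^ 2 + ε)) x (e i) * v x := by
    intro i
    refine Continuous.integrable_of_hasCompactSupport ?_ hc.mul_left
    simp only [hfd]
    refine Continuous.mul ?_ hv.continuous
    exact (continuous_const.div hden fun x => (hpos x).ne').sub
      ((continuous_const.mul ((hco i).pow 2)).div (hden.pow 2) fun x => (pow_pos (hpos x) 2).ne')
  have hibp : ∀ i, ∫ x, x i / (‖x‖ ^ 2 + ε) * fderiv ℝ v x (e i) =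
      -∫ x, fderiv ℝ (fun x : EuclideanSpace ℝ (Fin n) =>
      x i / (‖x‖ ^ 2 + ε)) x (e i) * v x := by
    intro i
    refine integral_mul_fderiv_eq_neg_fderiv_mul_of_integrable (hB i) (hA i) ?_
      (fun x _ => (hd i x).differentiableAt) fun x _ => hv.differentiable one_ne_zero x
    exact Continuous.integrable_of_hasCompactSupport
      (((hco i).div hden fun x => (hpos x).ne').mul hv.continuous) hc.mul_left
  have hsum : ∀ x : EuclideanSpace ℝ (Fin n), x = ∑ i, x i • e i := by
    intro x
    ext j
    simp [e, Finset.sum_apply, Pi.single_apply]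
  have hl : ∀ x, fderiv ℝ v x x / (‖x‖ ^ 2 + ε) =
      ∑ i, x i / (‖x‖ ^ 2 + ε) * fderiv ℝ v x (e i) := by
    intro x
    nth_rewrite 2 [hsum x]
    rw [map_sum, Finset.sum_div]
    refine Finset.sum_congr rfl fun i _ => ?_
    rw [map_smul, smul_eq_mul]
    ring
  have hr : ∀ x, v x * (n / (‖x‖ ^ 2 + ε) - 2 * ‖x‖ ^ 2 / (‖x‖ ^ 2 + ε) ^ 2) =
      ∑ i, fderiv ℝ (fun x : EuclideanSpace ℝ (Fin n) =>
      x i / (‖x‖ ^ 2 + ε)) x (e i) * v x := by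
    intro x
    simp only [hfd]
    rw [← Finset.sum_mul, Finset.sum_sub_distrib, ← Finset.sum_div, ← Finset.sum_div, ← Finset.mul_sum,
      ← EuclideanSpace.real_norm_sq_eq]
    simp
    ring
  simp only [hl, hr]
  rw [integral_finsetSum _ fun i _ => hA i, integral_finsetSum _ fun i _ => hB i,
    ← Finset.sum_neg_distrib]
  exact Finset.sum_congr rfl fun i _ => hibp i

theorem integral_fderiv_self_div_norm_sq {n : ℕ} (hn : 3 ≤ n) {v : EuclideanSpace ℝ (Fin n) → ℝ}
    (hv : ContDiff ℝ 1 v) (hc : HasCompactSupport v) :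
    Integrable (fun x => fderiv ℝ v x x / ‖x‖ ^ 2) ∧
    ∫ x, fderiv ℝ v x x / ‖x‖ ^ 2 = -(((n : ℝ) - 2) * ∫ x, v x / ‖x‖ ^ 2) := by
  have : Nonempty (Fin n) := ⟨⟨0, by omega⟩⟩
  have hv' : Continuous fun x => fderiv ℝ v x x :=
    (hv.continuous_fderiv one_ne_zero).clm_apply continuous_id
  have hc' : HasCompactSupport fun x => fderiv ℝ v x x :=
    (hc.fderiv ℝ).mono' fun x hx => subset_tsupport _ fun h0 => hx (by simp [h0])
  have h1 := integrable_div_norm_sq hn hv' hc'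
  have h2 := integrable_div_norm_sq hn hv.continuous hc
  refine ⟨h1, ?_⟩
  have hlim : ∀ x : EuclideanSpace ℝ (Fin n),
      Tendsto (fun ε : ℝ => ‖x‖ ^ 2 + ε) (𝓝[>] 0) (𝓝 (‖x‖ ^ 2)) := by
    intro x
    have : Tendsto (fun ε : ℝ => ‖x‖ ^ 2 + ε) (𝓝 0) (𝓝 (‖x‖ ^ 2 + 0)) :=
      tendsto_const_nhds.add tendsto_id
    rw [add_zero] at this
    exact this.mono_left nhdsWithin_le_nhds
  have hL : Tendsto (fun ε : ℝ => ∫ x, fderiv ℝ v x x / (‖x‖ ^ 2 + ε)) (𝓝[>] 0)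
      (𝓝 (∫ x, fderiv ℝ v x x / ‖x‖ ^ 2)) := by
    refine tendsto_integral_filter_of_dominated_convergence _ ?_ ?_ h1.norm ?_
    · refine Eventually.of_forall fun ε => Measurable.aestronglyMeasurable ?_
      exact hv'.measurable.div ((measurable_norm.pow_const 2).add_const ε)
    · filter_upwards [self_mem_nhdsWithin] with ε hε
      filter_upwards [(volume : Measure (EuclideanSpace ℝ (Fin n))).ae_ne 0] with x hx
      have hε : 0 < ε := hε
      have hx : 0 < ‖x‖ := norm_pos_iff.2 hx
      rw [norm_div, norm_div, norm_of_nonneg (by positivity : 0 ≤ ‖x‖ ^ 2 + ε),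
        norm_of_nonneg (by positivity : 0 ≤ ‖x‖ ^ 2)]
      gcongr
      linarith
    · filter_upwards [(volume : Measure (EuclideanSpace ℝ (Fin n))).ae_ne 0] with x hx
      exact tendsto_const_nhds.div (hlim x) (by positivity)
  have hR : Tendsto (fun ε : ℝ => ∫ x, v x * (n / (‖x‖ ^ 2 + ε) -
      2 * ‖x‖ ^ 2 / (‖x‖ ^ 2 + ε) ^ 2)) (𝓝[>] 0) (𝓝 (∫ x, ((n : ℝ) - 2) * (v x / ‖x‖ ^ 2))) := by
    refine tendsto_integral_filter_of_dominated_convergence _ ?_ ?_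
      (h2.norm.const_mul ((n : ℝ) + 2)) ?_
    · refine Eventually.of_forall fun ε => Measurable.aestronglyMeasurable ?_
      have := hv.continuous.measurable
      fun_prop
    · filter_upwards [self_mem_nhdsWithin] with ε hε
      filter_upwards [(volume : Measure (EuclideanSpace ℝ (Fin n))).ae_ne 0] with x hx
      have hε : 0 < ε := hε
      have hx : 0 < ‖x‖ := norm_pos_iff.2 hx
      have ha : (n : ℝ) / (‖x‖ ^ 2 + ε) ≤ n / ‖x‖ ^ 2 := by gcongr; linarith
      have hb : 2 * ‖x‖ ^ 2 / (‖x‖ ^ 2 + ε) ^ 2 ≤ 2 / ‖x‖ ^ 2 := by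
        rw [div_le_div_iff₀ (by positivity) (by positivity)]
        nlinarith [sq_nonneg ε, mul_pos hε (pow_pos hx 2)]
      have ha0 : 0 ≤ (n : ℝ) / (‖x‖ ^ 2 + ε) := by positivity
      have hb0 : 0 ≤ 2 * ‖x‖ ^ 2 / (‖x‖ ^ 2 + ε) ^ 2 := by positivity
      have hn0 : 0 ≤ (n : ℝ) / ‖x‖ ^ 2 := by positivity
      have h20 : 0 ≤ 2 / ‖x‖ ^ 2 := by positivity
      rw [norm_mul, norm_div, norm_of_nonneg (by positivity : 0 ≤ ‖x‖ ^ 2)]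
      have hc : ‖(n : ℝ) / (‖x‖ ^ 2 + ε) - 2 * ‖x‖ ^ 2 / (‖x‖ ^ 2 + ε) ^ 2‖ ≤
          ((n : ℝ) + 2) / ‖x‖ ^ 2 := by
        rw [add_div]
        exact abs_le.2 ⟨by linarith, by linarith⟩
      calc _ ≤ ‖v x‖ * (((n : ℝ) + 2) / ‖x‖ ^ 2) := by gcongr
        _ = _ := by ring
    · filter_upwards [(volume : Measure (EuclideanSpace ℝ (Fin n))).ae_ne 0] with x hx
      have hx : 0 < ‖x‖ := norm_pos_iff.2 hx
      have := ((tendsto_const_nhds (x := (n : ℝ))).div (hlim x) (by positivity)).sub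
        ((tendsto_const_nhds (x := 2 * ‖x‖ ^ 2)).div ((hlim x).pow 2) (by positivity))
      have h3 : ((n : ℝ) - 2) * (v x / ‖x‖ ^ 2) =
          v x * (n / ‖x‖ ^ 2 - 2 * ‖x‖ ^ 2 / (‖x‖ ^ 2) ^ 2) := by
        field_simp
      rw [h3]
      exact this.const_mul (v x)
  have hE : ∀ᶠ ε in 𝓝[>] (0 : ℝ), -∫ x, v x * (n / (‖x‖ ^ 2 + ε) -
      2 * ‖x‖ ^ 2 / (‖x‖ ^ 2 + ε) ^ 2) = ∫ x, fderiv ℝ v x x / (‖x‖ ^ 2 + ε) := by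
    filter_upwards [self_mem_nhdsWithin] with ε hε
    exact (integral_mul_div_norm_sq_add hv hc hε).symm
  rw [← integral_const_mul]
  exact tendsto_nhds_unique hL (hR.neg.congr' hE)

section Radial

variable {E : Type*} [NormedAddCommGroup E] [InnerProductSpace ℝ E]

theorem hasFDerivAt_comp_norm {k : ℝ → ℝ} {k' : ℝ} {y : E} (hy : y ≠ 0)
    (hk : HasDerivAt k k' ‖y‖) :
    HasFDerivAt (fun y : E => k ‖y‖) ((k' / ‖y‖) • innerSL ℝ y) y := by
  have hy' : 0 < ‖y‖ := norm_pos_iff.2 hy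
  have h1 := ((hasStrictFDerivAt_norm_sq y).hasFDerivAt).sqrt (by positivity)
  simp only [sqrt_sq (norm_nonneg _)] at h1
  refine (hk.comp_hasFDerivAt y h1).congr_fderiv ?_
  ext v
  simp
  field_simp

theorem hasFDerivAt_radial {h : ℝ → ℝ} {h' : ℝ} {y : E} (hy : y ≠ 0)
    (hh : HasDerivAt h h' ‖y‖) :
    HasFDerivAt (fun y : E => h ‖y‖ • y)
      (h ‖y‖ • ContinuousLinearMap.id ℝ E + ((h' / ‖y‖) • innerSL ℝ y).smulRight y) y :=
  (hasFDerivAt_comp_norm hy hh).smul (hasFDerivAt_id y)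

theorem det_smul_id_add_smulRight [FiniteDimensional ℝ E] {a b : ℝ} (ha : a ≠ 0) (y : E) :
    (a • ContinuousLinearMap.id ℝ E + (b • innerSL ℝ y).smulRight y).det =
      a ^ Module.finrank ℝ E * (1 + b / a * ‖y‖ ^ 2) := by
  have : ((a • ContinuousLinearMap.id ℝ E + (b • innerSL ℝ y).smulRight y : E →L[ℝ] E) :
      E →ₗ[ℝ] E) = a • LinearMap.transvection ((b / a) • (innerSL ℝ y : E →ₗ[ℝ] ℝ)) y := by
    ext v
    simp [LinearMap.transvection.apply, smul_smul]
    congr 1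
    field_simp
  rw [ContinuousLinearMap.det, this, LinearMap.det_smul, LinearMap.transvection.det]
  simp

theorem hasGradientAt_radial [CompleteSpace E] {u : E → ℝ} {h k : ℝ → ℝ} {h' k' : ℝ} {y g : E}
    (hy : y ≠ 0) (hh : HasDerivAt h h' ‖y‖) (hk : HasDerivAt k k' ‖y‖)
    (hu : HasGradientAt u g (h ‖y‖ • y)) :
    HasGradientAt (fun y : E => k ‖y‖ * u (h ‖y‖ • y))
      ((k' / ‖y‖ * u (h ‖y‖ • y) + k ‖y‖ * (h' / ‖y‖ * ⟪g, y⟫_ℝ)) • y +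
        (k ‖y‖ * h ‖y‖) • g) y := by
  have h1 := (hasFDerivAt_comp_norm hy hk).mul
    (HasFDerivAt.comp (f := fun y : E => h ‖y‖ • y) y hu.hasFDerivAt (hasFDerivAt_radial hy hh))
  rw [hasGradientAt_iff_hasFDerivAt]
  refine h1.congr_fderiv ?_
  ext v
  simp [InnerProductSpace.toDual_apply_apply]
  ring

end Radial

section HardyMap

noncomputable def hardyRadius (R : ℝ) (N : ℕ) (s : ℝ) : ℝ := R * exp ((1 - (s ^ N)⁻¹) / N)

noncomputable def hardyWeight (R : ℝ) (N : ℕ) (s : ℝ) : ℝ := √(R ^ N) * exp ((1 - (s ^ N)⁻¹) / 2)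

variable {R : ℝ} {N : ℕ} {s : ℝ}

theorem hardyRadius_pos (hR : 0 < R) : 0 < hardyRadius R N s := mul_pos hR (exp_pos _)

theorem hardyWeight_pos (hR : 0 < R) : 0 < hardyWeight R N s :=
  mul_pos (sqrt_pos.2 (pow_pos hR _)) (exp_pos _)

theorem hardyWeight_sq (hR : 0 < R) (hN : N ≠ 0) :
    hardyWeight R N s ^ 2 = hardyRadius R N s ^ N := by
  have hN' : (N : ℝ) ≠ 0 := by exact_mod_cast hN
  rw [hardyWeight, hardyRadius, mul_pow, mul_pow, sq_sqrt (by positivity), ← exp_nat_mul,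
    ← exp_nat_mul]
  congr 2
  push_cast
  field_simp

theorem hasDerivAt_inv_pow (hs : s ≠ 0) :
    HasDerivAt (fun s : ℝ => 1 - (s ^ N)⁻¹) (N / s ^ (N + 1)) s := by
  have h1 := ((hasDerivAt_pow N s).inv (pow_ne_zero N hs)).const_sub 1
  refine h1.congr_deriv ?_
  rcases N with _ | N
  · simp
  · simp only [Nat.add_sub_cancel]
    field_simp
    ring

theorem hasDerivAt_hardyRadius (hN : N ≠ 0) (hs : s ≠ 0) :
    HasDerivAt (hardyRadius R N) (hardyRadius R N s / s ^ (N + 1)) s := by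
  have hN' : (N : ℝ) ≠ 0 := by exact_mod_cast hN
  have h1 := (((hasDerivAt_inv_pow (N := N) hs).div_const (N : ℝ)).exp).const_mul R
  refine h1.congr_deriv ?_
  rw [hardyRadius]
  field_simp

theorem hasDerivAt_hardyWeight (hs : s ≠ 0) :
    HasDerivAt (hardyWeight R N) (hardyWeight R N s * (N / 2) / s ^ (N + 1)) s := by
  have h1 := (((hasDerivAt_inv_pow (N := N) hs).div_const 2).exp).const_mul √(R ^ N)
  refine h1.congr_deriv ?_
  rw [hardyWeight]
  field_simp

theorem hardyRadius_injOn (hR : 0 < R) (hN : N ≠ 0) : Set.InjOn (hardyRadius R N) (Set.Ioi 0) := by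
  intro s hs t ht h
  have hN' : (N : ℝ) ≠ 0 := by exact_mod_cast hN
  have h1 := exp_injective (mul_left_cancel₀ hR.ne' h)
  have h2 : s ^ N = t ^ N := by
    have := (div_left_inj' hN').1 h1
    exact inv_injective (by linarith)
  exact (pow_left_inj₀ (le_of_lt hs) (le_of_lt ht) hN).1 h2

theorem hardyRadius_le_iff (hR : 0 < R) (hN : N ≠ 0) (hs : 0 < s) :
    hardyRadius R N s ≤ R ↔ s ≤ 1 := by
  have hN' : (0 : ℝ) < N := by exact_mod_cast Nat.pos_of_ne_zero hN
  rw [hardyRadius, mul_le_iff_le_one_right hR, exp_le_one_iff, div_le_iff₀ hN', zero_mul,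
    sub_nonpos, one_le_inv₀ (pow_pos hs N), pow_le_one_iff_of_nonneg hs.le hN]

theorem one_sub_mul_log_hardyRadius (hR : 0 < R) (hN : N ≠ 0) :
    1 - N * log (hardyRadius R N s / R) = (s ^ N)⁻¹ := by
  have hN' : (N : ℝ) ≠ 0 := by exact_mod_cast hN
  rw [hardyRadius, mul_div_cancel_left₀ _ hR.ne', log_exp]
  field_simp
  ring

theorem exists_hardyRadius_eq (hR : 0 < R) (hN : N ≠ 0) {r : ℝ} (hr : 0 < r) (hrR : r ≤ R) :
    ∃ s, 0 < s ∧ hardyRadius R N s = r := by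
  have hN' : (N : ℝ) ≠ 0 := by exact_mod_cast hN
  have hlog : log (r / R) ≤ 0 := log_nonpos (by positivity) ((div_le_one hR).2 hrR)
  have hb : 0 < 1 - N * log (r / R) := by
    have : (N : ℝ) * log (r / R) ≤ 0 := mul_nonpos_of_nonneg_of_nonpos (by positivity) hlog
    linarith
  refine ⟨(1 - N * log (r / R))⁻¹ ^ (1 / (N : ℝ)), by positivity, ?_⟩
  rw [hardyRadius, ← rpow_mul_natCast (by positivity), one_div_mul_cancel hN', rpow_one, inv_inv,
    sub_sub_cancel, mul_div_cancel_left₀ _ hN', exp_log (by positivity)]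
  field_simp

theorem tendsto_hardyWeight (hN : N ≠ 0) :
    Tendsto (hardyWeight R N) (𝓝[>] 0) (𝓝 0) := by
  have h1 : Tendsto (fun s : ℝ => s ^ N) (𝓝[>] 0) (𝓝[>] 0) := by
    refine tendsto_nhdsWithin_iff.2 ⟨?_, ?_⟩
    · have : Tendsto (fun s : ℝ => s ^ N) (𝓝 0) (𝓝 (0 ^ N)) := (continuous_pow N).tendsto 0
      rw [zero_pow hN] at this
      exact this.mono_left nhdsWithin_le_nhds
    · filter_upwards [self_mem_nhdsWithin] with s hs
      exact pow_pos (Set.mem_Ioi.1 hs) N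
  have h2 : Tendsto (fun s : ℝ => (1 - (s ^ N)⁻¹) / 2) (𝓝[>] 0) atBot := by
    refine Tendsto.atBot_div_const two_pos ?_
    simp only [sub_eq_add_neg]
    exact tendsto_atBot_add_const_left _ _
      (tendsto_neg_atTop_atBot.comp (tendsto_inv_nhdsGT_zero.comp h1))
  have h3 := (tendsto_exp_atBot.comp h2).const_mul √(R ^ N)
  rw [mul_zero] at h3
  exact h3

end HardyMap

theorem norm_hardyGradient_sq_le {E : Type*} [NormedAddCommGroup E] [InnerProductSpace ℝ E]
    {N : ℕ} {k r v : ℝ} {y g : E} (hy : y ≠ 0) (hy1 : ‖y‖ ≤ 1) (hr : 0 < r) (hk : k ^ 2 = r ^ N) :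
    ‖(k * (N / 2) / ‖y‖ ^ (N + 1) / ‖y‖ * v +
        k * ((r / ‖y‖ ^ (N + 1) * ‖y‖ - r) / ‖y‖ ^ 2 / ‖y‖ * ⟪g, y⟫_ℝ)) • y +
      (k * (r / ‖y‖)) • g‖ ^ 2 ≤
    r ^ (N + 2) / ‖y‖ ^ (2 * N + 2) *
      (‖g‖ ^ 2 + N * (v * ⟪g, (r / ‖y‖) • y⟫_ℝ / r ^ 2) + (N / 2) ^ 2 * (v ^ 2 / r ^ 2)) := by
  have hs : 0 < ‖y‖ := norm_pos_iff.2 hy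
  obtain ⟨P, hP⟩ : ∃ P, P = (‖y‖ ^ N)⁻¹ := ⟨_, rfl⟩
  have hP1 : 1 ≤ P := by
    rw [hP, one_le_inv₀ (by positivity)]
    exact pow_le_one₀ hs.le hy1
  have hpow : ‖y‖ ^ N = P⁻¹ := by rw [hP, inv_inv]
  have hcs : ⟪g, y⟫_ℝ ^ 2 ≤ ‖g‖ ^ 2 * ‖y‖ ^ 2 := by
    rw [← mul_pow, ← sq_abs]
    exact pow_le_pow_left₀ (abs_nonneg _) (abs_real_inner_le_norm g y) 2
  have hP0 : 0 < P := by linarith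
  rw [norm_add_sq_real, norm_smul, norm_smul, mul_pow, mul_pow, norm_eq_abs, norm_eq_abs, sq_abs,
    sq_abs, inner_smul_left, inner_smul_right, inner_smul_right, real_inner_comm g y]
  rw [show 2 * N + 2 = N + N + 2 by ring]
  simp only [pow_add, hpow, pow_one, conj_trivial]
  rw [← hk]
  generalize ⟪g, y⟫_ℝ = G at *
  generalize ‖g‖ = c at *
  generalize ‖y‖ = s at *
  have hdiff : k ^ 2 * r ^ 2 / (P⁻¹ * P⁻¹ * s ^ 2) *
      (c ^ 2 + N * (v * (r / s * G) / r ^ 2) + (N / 2) ^ 2 * (v ^ 2 / r ^ 2)) -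
      ((k * (N / 2) / (P⁻¹ * s) / s * v +
        k * ((r / (P⁻¹ * s) * s - r) / s ^ 2 / s * G)) ^ 2 * s ^ 2 +
      2 * ((k * (N / 2) / (P⁻¹ * s) / s * v +
        k * ((r / (P⁻¹ * s) * s - r) / s ^ 2 / s * G)) * (k * (r / s) * G)) +
      (k * (r / s)) ^ 2 * c ^ 2) =
      k ^ 2 * r ^ 2 / s ^ 4 * (P ^ 2 - 1) * (c ^ 2 * s ^ 2 - G ^ 2) := by
    field_simp
    ring
  have hnn : 0 ≤ k ^ 2 * r ^ 2 / s ^ 4 * (P ^ 2 - 1) * (c ^ 2 * s ^ 2 - G ^ 2) := by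
    have h1 : 0 ≤ P ^ 2 - 1 := by nlinarith
    have h2 : 0 ≤ c ^ 2 * s ^ 2 - G ^ 2 := by linarith
    positivity
  linarith

theorem continuous_gradient {E : Type*} [NormedAddCommGroup E] [InnerProductSpace ℝ E]
    [CompleteSpace E] {u : E → ℝ} (hu : ContDiff ℝ 1 u) : Continuous (gradient u) :=
  (InnerProductSpace.toDual ℝ E).symm.continuous.comp (hu.continuous_fderiv one_ne_zero)

theorem gradient_of_notMem_tsupport {E : Type*} [NormedAddCommGroup E] [InnerProductSpace ℝ E]
    [CompleteSpace E] {u : E → ℝ} {x : E} (hx : x ∉ tsupport u) : gradient u x = 0 := by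
  rw [gradient, fderiv_of_notMem_tsupport ℝ hx, map_zero]

theorem integral_hardyForm {n : ℕ} (hn : 3 ≤ n) {u : EuclideanSpace ℝ (Fin n) → ℝ}
    (hu : ContDiff ℝ 1 u) (hc : HasCompactSupport u) {N : ℝ} (hN : N = n - 2) :
    Integrable (fun x => ‖gradient u x‖ ^ 2 + N * (u x * ⟪gradient u x, x⟫_ℝ / ‖x‖ ^ 2) +
      (N / 2) ^ 2 * (u x ^ 2 / ‖x‖ ^ 2)) ∧
    ∫ x, (‖gradient u x‖ ^ 2 + N * (u x * ⟪gradient u x, x⟫_ℝ / ‖x‖ ^ 2) +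
      (N / 2) ^ 2 * (u x ^ 2 / ‖x‖ ^ 2)) =
      (∫ x, ‖gradient u x‖ ^ 2) - (N / 2) ^ 2 * ∫ x, u x ^ 2 / ‖x‖ ^ 2 := by
  have hsq : ContDiff ℝ 1 fun x => u x ^ 2 := hu.pow 2
  have hcsq : HasCompactSupport fun x => u x ^ 2 := by
    simp only [sq]
    exact hc.mul_left
  obtain ⟨h1, h2⟩ := integral_fderiv_self_div_norm_sq hn hsq hcsq
  have h3 := integrable_div_norm_sq hn hsq.continuous hcsq
  have hfd : ∀ x, fderiv ℝ (fun x => u x ^ 2) x x = 2 * (u x * ⟪gradient u x, x⟫_ℝ) := by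
    intro x
    have hd := (hu.differentiable one_ne_zero x).hasGradientAt.hasFDerivAt
    rw [(hd.pow 2).fderiv]
    simp
    ring
  have hgr : ∀ x, N * (u x * ⟪gradient u x, x⟫_ℝ / ‖x‖ ^ 2) =
      N / 2 * (fderiv ℝ (fun x => u x ^ 2) x x / ‖x‖ ^ 2) := by
    intro x
    rw [hfd]
    ring
  have hg : Integrable fun x => ‖gradient u x‖ ^ 2 := by
    refine Continuous.integrable_of_hasCompactSupport ((continuous_gradient hu).norm.pow 2) ?_
    refine hc.mono' fun x hx => ?_
    by_contra h0
    exact hx (by simp [gradient_of_notMem_tsupport h0])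
  simp only [hgr]
  have hgh : Integrable fun x => ‖gradient u x‖ ^ 2 +
      N / 2 * (fderiv ℝ (fun x => u x ^ 2) x x / ‖x‖ ^ 2) := hg.add (h1.const_mul _)
  refine ⟨hgh.add (h3.const_mul _), ?_⟩
  rw [integral_add hgh (h3.const_mul _), integral_add hg (h1.const_mul _),
    integral_const_mul, integral_const_mul, h2, hN]
  ring

theorem improved_hardy_sobolev {n : ℕ} (hn : 3 ≤ n) {R : ℝ} (hR : 0 < R)
    {u : EuclideanSpace ℝ (Fin n) → ℝ} (hu : ContDiff ℝ 1 u) (hc : HasCompactSupport u)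
    (hs : tsupport u ⊆ Metric.closedBall 0 R) :
    sobolevConst n * (∫ x, (1 - ((n : ℝ) - 2) * log (‖x‖ / R)) ^
        (-(2 * ((n : ℝ) - 1) / ((n : ℝ) - 2))) *
        |u x| ^ (2 * (n : ℝ) / ((n : ℝ) - 2))) ^ (((n : ℝ) - 2) / n) ≤
      (∫ x, ‖gradient u x‖ ^ 2) - (((n : ℝ) - 2) / 2) ^ 2 * ∫ x, u x ^ 2 / ‖x‖ ^ 2 := by
  classical
  obtain ⟨N, rfl⟩ : ∃ N, n = N + 2 := ⟨n - 2, by omega⟩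
  have hN : N ≠ 0 := by omega
  have hNpos : (0 : ℝ) < N := by exact_mod_cast Nat.pos_of_ne_zero hN
  have hN2 : ((N + 2 : ℕ) : ℝ) - 2 = N := by push_cast; ring
  have hN1 : ((N + 2 : ℕ) : ℝ) - 1 = N + 1 := by push_cast; ring
  obtain ⟨hQi, hQ⟩ := integral_hardyForm hn hu hc hN2.symm
  rw [hN2, hN1]
  rw [← hQ]
  have hu0 : ∀ x, R < ‖x‖ → u x = 0 := fun x hx => image_eq_zero_of_notMem_tsupport fun h =>
    absurd (mem_closedBall_zero_iff.1 (hs h)) (not_le.2 hx)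
  have hg0 : ∀ x, R < ‖x‖ → gradient u x = 0 := fun x hx => gradient_of_notMem_tsupport fun h =>
    absurd (mem_closedBall_zero_iff.1 (hs h)) (not_le.2 hx)
  set p := 2 * ((N + 2 : ℕ) : ℝ) / N with hp
  have hp0 : p ≠ 0 := by positivity
  set ρ := hardyRadius R N with hρ
  set k := hardyWeight R N with hk
  have hρpos : ∀ s, 0 < ρ s := fun s => hardyRadius_pos hR
  have hkpos : ∀ s, 0 < k s := fun s => hardyWeight_pos hR
  set Y : EuclideanSpace ℝ (Fin (N + 2)) → EuclideanSpace ℝ (Fin (N + 2)) :=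
    fun y => (ρ ‖y‖ / ‖y‖) • y with hY
  have hYn : ∀ y, y ≠ 0 → ‖Y y‖ = ρ ‖y‖ := by
    intro y hy
    rw [hY, norm_smul, norm_of_nonneg (div_pos (hρpos _) (norm_pos_iff.2 hy)).le,
      div_mul_cancel₀ _ (norm_ne_zero_iff.2 hy)]
  have hYout : ∀ y, y ≠ 0 → 1 < ‖y‖ → R < ‖Y y‖ := by
    intro y hy hy1
    rw [hYn y hy]
    exact not_le.1 fun h => not_le.2 hy1 ((hardyRadius_le_iff hR hN (norm_pos_iff.2 hy)).1 h)
  set w : EuclideanSpace ℝ (Fin (N + 2)) → ℝ := fun y => if y = 0 then 0 else k ‖y‖ * u (Y y)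
    with hw
  set w' : EuclideanSpace ℝ (Fin (N + 2)) → EuclideanSpace ℝ (Fin (N + 2)) := fun y =>
    if y = 0 then 0 else
    (k ‖y‖ * (N / 2) / ‖y‖ ^ (N + 1) / ‖y‖ * u (Y y) +
        k ‖y‖ * ((ρ ‖y‖ / ‖y‖ ^ (N + 1) * ‖y‖ - ρ ‖y‖) / ‖y‖ ^ 2 / ‖y‖ *
          ⟪gradient u (Y y), y⟫_ℝ)) • y +
      (k ‖y‖ * (ρ ‖y‖ / ‖y‖)) • gradient u (Y y) with hw'
  set A : Set (EuclideanSpace ℝ (Fin (N + 2))) := Metric.closedBall 0 1 \ {0} with hA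
  have hAmem : ∀ y, y ∈ A ↔ ‖y‖ ≤ 1 ∧ y ≠ 0 := by
    intro y
    rw [hA, Set.mem_sdiff, mem_closedBall_zero_iff, Set.mem_singleton_iff]
  have hAm : MeasurableSet A := measurableSet_closedBall.diff (measurableSet_singleton 0)
  have hdρ : ∀ y : EuclideanSpace ℝ (Fin (N + 2)), y ≠ 0 →
      HasDerivAt (fun s => ρ s / s) ((ρ ‖y‖ / ‖y‖ ^ (N + 1) * ‖y‖ - ρ ‖y‖) / ‖y‖ ^ 2) ‖y‖ := by
    intro y hy
    have h := (hasDerivAt_hardyRadius (R := R) hN (norm_ne_zero_iff.2 hy)).div (hasDerivAt_id ‖y‖)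
      (norm_ne_zero_iff.2 hy)
    refine h.congr_deriv ?_
    simp [hρ]
  have hYd : ∀ y, y ≠ 0 → HasFDerivAt Y _ y := fun y hy => hasFDerivAt_radial hy (hdρ y hy)
  have hwd : ∀ y, y ≠ 0 → HasGradientAt w (w' y) y := by
    intro y hy
    have h := hasGradientAt_radial hy (hdρ y hy)
      (hasDerivAt_hardyWeight (R := R) (N := N) (norm_ne_zero_iff.2 hy))
      (hu.differentiable one_ne_zero _).hasGradientAt
    have h2 : w' y = _ := if_neg hy
    rw [h2]
    refine h.congr_of_eventuallyEq ?_
    filter_upwards [isOpen_ne.mem_nhds hy] with z hz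
    exact if_neg hz
  have hdet : ∀ y (hy : y ≠ 0), |(((ρ ‖y‖ / ‖y‖) • ContinuousLinearMap.id ℝ _ +
      (((ρ ‖y‖ / ‖y‖ ^ (N + 1) * ‖y‖ - ρ ‖y‖) / ‖y‖ ^ 2 / ‖y‖) • innerSL ℝ y).smulRight y :
      EuclideanSpace ℝ (Fin (N + 2)) →L[ℝ] EuclideanSpace ℝ (Fin (N + 2)))).det| =
      ρ ‖y‖ ^ (N + 2) / ‖y‖ ^ (2 * N + 2) := by
    intro y hy
    have hy' : 0 < ‖y‖ := norm_pos_iff.2 hy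
    have h1 := hρpos ‖y‖
    rw [det_smul_id_add_smulRight (div_pos h1 hy').ne', finrank_euclideanSpace_fin,
      ← abs_of_nonneg (by positivity : 0 ≤ ρ ‖y‖ ^ (N + 2) / ‖y‖ ^ (2 * N + 2))]
    congr 1
    rw [show 2 * N + 2 = N + N + 2 by ring]
    simp only [pow_add, div_pow]
    field_simp
    ring
  have hYinj : Set.InjOn Y A := by
    intro y hy z hz hyz
    have hy0 := ((hAmem y).1 hy).2
    have hz0 := ((hAmem z).1 hz).2
    have h1 : ‖y‖ = ‖z‖ := by
      refine hardyRadius_injOn hR hN (norm_pos_iff.2 hy0) (norm_pos_iff.2 hz0) ?_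
      rw [← hρ, ← hYn y hy0, ← hYn z hz0, hyz]
    have h2 : (ρ ‖y‖ / ‖y‖) • y = (ρ ‖z‖ / ‖z‖) • z := hyz
    rw [← h1] at h2
    exact smul_right_injective _ (div_pos (hρpos _) (norm_pos_iff.2 hy0)).ne' h2
  have hYim : ∀ x, x ≠ 0 → x ∉ Y '' A → R < ‖x‖ := by
    intro x hx hxA
    by_contra! hxR
    have hx' : 0 < ‖x‖ := norm_pos_iff.2 hx
    obtain ⟨s, hs0, hsx⟩ := exists_hardyRadius_eq hR hN hx' hxR
    refine hxA ⟨(s / ‖x‖) • x, ?_, ?_⟩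
    · rw [hAmem, norm_smul, norm_of_nonneg (by positivity), div_mul_cancel₀ _ hx'.ne']
      exact ⟨(hardyRadius_le_iff hR hN hs0).1 (hsx.trans_le hxR),
        smul_ne_zero (by positivity) hx⟩
    · simp only [hY]
      rw [norm_smul, norm_of_nonneg (by positivity), div_mul_cancel₀ _ hx'.ne', hρ, hsx, smul_smul]
      field_simp
      simp
  have hcv : ∀ F : EuclideanSpace ℝ (Fin (N + 2)) → ℝ, (∀ x, R < ‖x‖ → F x = 0) →
      ∫ x, F x = ∫ y in A, ρ ‖y‖ ^ (N + 2) / ‖y‖ ^ (2 * N + 2) * F (Y y) := by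
    intro F hF
    have h1 : ∫ x in Y '' A, F x = ∫ x, F x := by
      refine setIntegral_eq_integral_of_ae_compl_eq_zero ?_
      filter_upwards [(volume : Measure (EuclideanSpace ℝ (Fin (N + 2)))).ae_ne 0] with x hx hxA
      exact hF x (hYim x hx hxA)
    rw [← h1, integral_image_eq_integral_abs_det_fderiv_smul volume hAm
      (fun y hy => (hYd y ((hAmem y).1 hy).2).hasFDerivWithinAt) hYinj]
    refine setIntegral_congr_fun hAm fun y hy => ?_
    simp only [hdet y ((hAmem y).1 hy).2, smul_eq_mul]
  have hcvi : ∀ F : EuclideanSpace ℝ (Fin (N + 2)) → ℝ, Integrable F →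
      IntegrableOn (fun y => ρ ‖y‖ ^ (N + 2) / ‖y‖ ^ (2 * N + 2) * F (Y y)) A := by
    intro F hF
    have h1 := (integrableOn_image_iff_integrableOn_abs_det_fderiv_smul volume hAm
      (fun y hy => (hYd y ((hAmem y).1 hy).2).hasFDerivWithinAt) hYinj F).1 hF.integrableOn
    refine h1.congr_fun (fun y hy => ?_) hAm
    simp only [hdet y ((hAmem y).1 hy).2, smul_eq_mul]
  -- the transformed function is admissible in the Sobolev inequality
  obtain ⟨C, hC⟩ := hc.exists_bound_of_continuous hu.continuous
  have hwsupp : ∀ y, y ∉ A → w y = 0 ∧ w' y = 0 := by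
    intro y hy
    by_cases hy0 : y = 0
    · exact ⟨if_pos hy0, if_pos hy0⟩
    have hy1 : 1 < ‖y‖ := by
      by_contra! h
      exact hy ((hAmem y).2 ⟨h, hy0⟩)
    have h1 := hYout y hy0 hy1
    simp only [hw, hw', if_neg hy0, hu0 _ h1, hg0 _ h1]
    simp
  have hwc : Continuous w := by
    rw [continuous_iff_continuousAt]
    intro y
    by_cases hy : y = 0
    · subst hy
      have h1 : Tendsto (fun y : EuclideanSpace ℝ (Fin (N + 2)) => k ‖y‖ * C) (𝓝[≠] 0) (𝓝 0) := by
        have := (((tendsto_hardyWeight (R := R) hN).comp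
          (tendsto_norm_nhdsNE_zero (E := EuclideanSpace ℝ (Fin (N + 2))))).mul_const C)
        rwa [zero_mul] at this
      rw [continuousAt_iff_punctured_nhds]
      have hw0 : w 0 = 0 := if_pos rfl
      rw [hw0]
      refine squeeze_zero_norm' ?_ h1
      filter_upwards [self_mem_nhdsWithin] with y hy
      have h2 : w y = _ := if_neg hy
      rw [h2, norm_mul, norm_of_nonneg (hkpos _).le]
      exact mul_le_mul_of_nonneg_left (hC _) (hkpos _).le
    · exact (hwd y hy).continuousAt
  have hwcs : HasCompactSupport w := by
    refine HasCompactSupport.of_support_subset_isCompact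
      (isCompact_closedBall (0 : EuclideanSpace ℝ (Fin (N + 2))) 1) fun y hy => ?_
    by_contra h
    exact hy (hwsupp y fun hA => h hA.1).1
  have hρm : Measurable ρ := by
    simp only [hρ]
    unfold hardyRadius
    fun_prop
  have hkm : Measurable k := by
    simp only [hk]
    unfold hardyWeight
    fun_prop
  have hYm : Measurable Y := ((hρm.comp measurable_norm).div measurable_norm).smul measurable_id
  have hgm : Measurable fun y => gradient u (Y y) := (continuous_gradient hu).measurable.comp hYm
  have hum : Measurable fun y => u (Y y) := hu.continuous.measurable.comp hYm
  have hwm : Measurable w' := by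
    refine Measurable.ite (measurableSet_singleton 0) measurable_const ?_
    have h1 : Measurable fun y : EuclideanSpace ℝ (Fin (N + 2)) => k ‖y‖ := hkm.comp measurable_norm
    have h2 : Measurable fun y : EuclideanSpace ℝ (Fin (N + 2)) => ρ ‖y‖ := hρm.comp measurable_norm
    have h3 : Measurable fun y => ⟪gradient u (Y y), y⟫_ℝ := hgm.inner measurable_id
    have h4 : Measurable fun y : EuclideanSpace ℝ (Fin (N + 2)) => ‖y‖ := measurable_norm
    have h5 : Measurable fun y => k ‖y‖ * (N / 2) / ‖y‖ ^ (N + 1) / ‖y‖ * u (Y y) :=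
      (((h1.mul_const _).div (h4.pow_const _)).div h4).mul hum
    have h6 : Measurable fun y => k ‖y‖ * ((ρ ‖y‖ / ‖y‖ ^ (N + 1) * ‖y‖ - ρ ‖y‖) / ‖y‖ ^ 2 / ‖y‖ *
        ⟪gradient u (Y y), y⟫_ℝ) :=
      h1.mul ((((((h2.div (h4.pow_const _)).mul h4).sub h2).div (h4.pow_const _)).div h4).mul h3)
    exact ((h5.add h6).smul measurable_id).add ((h1.mul (h2.div h4)).smul hgm)
  have hle : ∀ y ∈ A, ‖w' y‖ ^ 2 ≤ ρ ‖y‖ ^ (N + 2) / ‖y‖ ^ (2 * N + 2) *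
      (‖gradient u (Y y)‖ ^ 2 + N * (u (Y y) * ⟪gradient u (Y y), Y y⟫_ℝ / ‖Y y‖ ^ 2) +
      (N / 2) ^ 2 * (u (Y y) ^ 2 / ‖Y y‖ ^ 2)) := by
    intro y hy
    obtain ⟨hy1, hy0⟩ := (hAmem y).1 hy
    have h1 : w' y = _ := if_neg hy0
    rw [h1, hYn y hy0]
    exact norm_hardyGradient_sq_le hy0 hy1 (hρpos _) (hardyWeight_sq hR hN)
  have hwi : Integrable fun y => ‖w' y‖ ^ 2 := by
    refine (integrableOn_iff_integrable_of_support_subset (s := A) fun y hy => ?_).1 ?_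
    · by_contra h
      exact hy (by simp [(hwsupp y h).2])
    · refine (hcvi _ hQi).mono' (hwm.norm.pow_const 2).aestronglyMeasurable ?_
      refine (ae_restrict_iff' hAm).2 (ae_of_all _ fun y hy => ?_)
      rw [norm_of_nonneg (sq_nonneg _)]
      exact hle y hy
  have key := sobolev_euclidean hn hwc hwcs hwm hwd hwi
  rw [hN2] at key
  have hlhs : ∫ y, |w y| ^ p = ∫ x, (1 - N * log (‖x‖ / R)) ^
      (-(2 * ((N : ℝ) + 1) / N)) * |u x| ^ p := by
    rw [hcv (fun x => (1 - N * log (‖x‖ / R)) ^ (-(2 * ((N : ℝ) + 1) / N)) * |u x| ^ p)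
      fun x hx => by simp only [hu0 x hx, abs_zero, zero_rpow hp0, mul_zero]]
    rw [← setIntegral_eq_integral_of_forall_compl_eq_zero (s := A) fun y hy => by
      rw [(hwsupp y hy).1, abs_zero, zero_rpow hp0]]
    refine setIntegral_congr_fun hAm fun y hy => ?_
    obtain ⟨hy1, hy0⟩ := (hAmem y).1 hy
    have hy' : 0 < ‖y‖ := norm_pos_iff.2 hy0
    have h1 : w y = _ := if_neg hy0
    simp only [h1, hYn y hy0]
    rw [hρ, one_sub_mul_log_hardyRadius hR hN, abs_mul, abs_of_pos (hkpos _),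
      mul_rpow (hkpos _).le (abs_nonneg _), ← mul_assoc]
    congr 1
    have h2 : k ‖y‖ ^ p = hardyRadius R N ‖y‖ ^ (N + 2) := by
      have h3 : k ‖y‖ ^ p = (k ‖y‖ ^ 2) ^ (((N + 2 : ℕ) : ℝ) / N) := by
        rw [← rpow_natCast, ← rpow_mul (hkpos _).le]
        congr 1
        rw [hp]
        push_cast
        ring
      rw [h3, hk, hardyWeight_sq hR hN, ← rpow_natCast, ← rpow_mul (hρpos _).le,
        mul_div_cancel₀ _ hNpos.ne', rpow_natCast]
    have h4 : ((‖y‖ ^ N)⁻¹) ^ (-(2 * ((N : ℝ) + 1) / N)) = ‖y‖ ^ (2 * N + 2) := by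
      rw [rpow_neg (by positivity), inv_rpow (by positivity), inv_inv, ← rpow_natCast,
        ← rpow_mul hy'.le, mul_div_cancel₀ _ hNpos.ne', ← rpow_natCast]
      congr 1
      push_cast
      ring
    rw [h2, h4, div_mul_cancel₀ _ (by positivity)]
  rw [hlhs] at key
  refine key.trans ?_
  have hcvQ := hcv (fun x => ‖gradient u x‖ ^ 2 + N * (u x * ⟪gradient u x, x⟫_ℝ / ‖x‖ ^ 2) +
    (N / 2) ^ 2 * (u x ^ 2 / ‖x‖ ^ 2)) fun x hx => by simp [hu0 x hx, hg0 x hx]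
  have hwA : ∫ y in A, ‖w' y‖ ^ 2 = ∫ y, ‖w' y‖ ^ 2 :=
    setIntegral_eq_integral_of_forall_compl_eq_zero fun y hy => by simp [(hwsupp y hy).2]
  rw [hcvQ, ← hwA]
  exact setIntegral_mono_on hwi.integrableOn (hcvi _ hQi) hAm hle

theorem sobolevConst_pos {n : ℕ} (hn : 3 ≤ n) : 0 < sobolevConst n := by
  have h : (3 : ℝ) ≤ n := by exact_mod_cast hn
  have h1 : 0 < Gamma ((n : ℝ) / 2) := Gamma_pos_of_pos (by linarith)
  have h2 : 0 < Gamma (n : ℝ) := Gamma_pos_of_pos (by linarith)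
  have h3 : (0 : ℝ) < n - 2 := by linarith
  unfold sobolevConst
  positivity

theorem HasCompactSupport.exists_tsupport_subset_closedBall {E : Type*} [NormedAddCommGroup E]
    {u : E → ℝ} (hc : HasCompactSupport u) (hs : tsupport u ⊆ Metric.ball 0 1) :
    ∃ R, 0 < R ∧ R < 1 ∧ tsupport u ⊆ Metric.closedBall 0 R := by
  rcases (tsupport u).eq_empty_or_nonempty with h | h
  · exact ⟨1 / 2, by norm_num, by norm_num, by simp [h]⟩
  · obtain ⟨x, hx, hmax⟩ := hc.isCompact.exists_isMaxOn h continuous_norm.continuousOn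
    have hx1 : ‖x‖ < 1 := mem_ball_zero_iff.1 (hs hx)
    refine ⟨(‖x‖ + 1) / 2, by positivity, by linarith, fun y hy => ?_⟩
    have : ‖y‖ ≤ ‖x‖ := hmax hy
    rw [mem_closedBall_zero_iff]
    linarith

/-- Both cases of the constant have the form `k ^ (-2(n-1)/n) * S_n`. -/
theorem exists_scale_of_le {m a : ℝ} (hm : 0 < m) (ha : 0 < a) :
    ∃ k, 0 < k ∧ (∀ e : ℝ, (if 1 / m ≤ a then m ^ (-e) else a ^ e) = k ^ (-e)) ∧
      ∀ t ≤ 0, 1 - m * t ≤ k * (a - t) := by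
  by_cases h : 1 / m ≤ a
  · refine ⟨m, hm, fun e => if_pos h, fun t ht => ?_⟩
    rw [div_le_iff₀ hm] at h
    nlinarith
  · refine ⟨a⁻¹, by positivity, fun e => ?_, fun t ht => ?_⟩
    · rw [if_neg h, rpow_neg (by positivity), inv_rpow ha.le, inv_inv]
    · have h1 : m < a⁻¹ := by
        rw [not_le, lt_div_iff₀ hm] at h
        rw [lt_inv_comm₀ hm ha, ← one_div, lt_div_iff₀ hm]
        exact h
      rw [mul_sub, inv_mul_cancel₀ ha.ne']
      nlinarith

/-- Comparison of weighted `L^q` norms of a continuous compactly supported function: a pointwise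
strict inequality of bounded weights gives a strict inequality of integrals. -/
theorem integral_weight_mul_lt {E : Type*} [NormedAddCommGroup E] [NormedSpace ℝ E]
    [FiniteDimensional ℝ E] [MeasurableSpace E] [BorelSpace E] {μ : Measure E}
    [μ.IsAddHaarMeasure] [NullSingletonClass μ] {f : E → ℝ} (hf : Continuous f) (hc : HasCompactSupport f)
    (hf0 : ∀ x, 0 ≤ f x) (hne : f ≠ 0) {v w : E → ℝ} (hv : Measurable v) (hw : Measurable w)
    {C : ℝ} (h0 : ∀ x, x ≠ 0 → f x ≠ 0 → 0 ≤ v x) (hvw : ∀ x, x ≠ 0 → f x ≠ 0 → v x < w x)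
    (hwC : ∀ x, x ≠ 0 → f x ≠ 0 → w x ≤ C) :
    0 ≤ ∫ x, v x * f x ∂μ ∧ ∫ x, v x * f x ∂μ < ∫ x, w x * f x ∂μ := by
  have hi : Integrable f μ := hf.integrable_of_hasCompactSupport hc
  have hae : ∀ᵐ x ∂μ, x ≠ 0 := μ.ae_ne 0
  have hvi : Integrable (fun x => v x * f x) μ := by
    refine (hi.const_mul C).mono' (hv.mul hf.measurable).aestronglyMeasurable ?_
    filter_upwards [hae] with x hx
    by_cases h : f x = 0
    · simp [h]
    rw [norm_of_nonneg (mul_nonneg (h0 x hx h) (hf0 x))]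
    exact mul_le_mul_of_nonneg_right ((hvw x hx h).le.trans (hwC x hx h)) (hf0 x)
  have hwi : Integrable (fun x => w x * f x) μ := by
    refine (hi.const_mul C).mono' (hw.mul hf.measurable).aestronglyMeasurable ?_
    filter_upwards [hae] with x hx
    by_cases h : f x = 0
    · simp [h]
    rw [norm_of_nonneg (mul_nonneg ((h0 x hx h).trans (hvw x hx h).le) (hf0 x))]
    exact mul_le_mul_of_nonneg_right (hwC x hx h) (hf0 x)
  refine ⟨integral_nonneg_of_ae ?_, ?_⟩
  · filter_upwards [hae] with x hx
    by_cases h : f x = 0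
    · simp [h]
    exact mul_nonneg (h0 x hx h) (hf0 x)
  rw [← sub_pos, ← integral_sub hwi hvi]
  have hnn : 0 ≤ᵐ[μ] fun x => w x * f x - v x * f x := by
    filter_upwards [hae] with x hx
    by_cases h : f x = 0
    · simp [h]
    rw [Pi.zero_apply, ← sub_mul]
    exact mul_nonneg (sub_nonneg.2 (hvw x hx h).le) (hf0 x)
  rw [integral_pos_iff_support_of_nonneg_ae hnn (hwi.sub hvi)]
  have hopen : IsOpen (Function.support f) := hf.isOpen_support
  have hpos : 0 < μ (Function.support f) := hopen.measure_pos μ (Function.support_nonempty_iff.2 hne)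
  refine hpos.trans_le (measure_mono_ae ?_)
  filter_upwards [hae] with x hx hfx
  have h : f x ≠ 0 := hfx
  show w x * f x - v x * f x ≠ 0
  rw [← sub_mul]
  exact mul_ne_zero (sub_pos.2 (hvw x hx h)).ne' h

end

theorem stmt6 (n : ℕ) (hn : 3 ≤ n) (a : ℝ) (ha0 : 0 < a)
    (Cna : ℝ)
    (hCna : Cna = if 1 / ((n : ℝ) - 2) ≤ a then ((n : ℝ) - 2) ^ (-(2 * ((n : ℝ) - 1)) / (n : ℝ)) * sobolevConst n else a ^ (2 * ((n : ℝ) - 1) / (n : ℝ)) * sobolevConst n)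
    (u : EuclideanSpace ℝ (Fin n) → ℝ) (hu : ContDiff ℝ (⊤ : ℕ∞) u)
    (hcs : HasCompactSupport u)
    (hsupp : tsupport u ⊆ Metric.ball (0 : EuclideanSpace ℝ (Fin n)) 1) (hne : u ≠ 0) :
    (∫ x in Metric.ball (0 : EuclideanSpace ℝ (Fin n)) 1, ‖gradient u x‖ ^ 2)
      > (((n : ℝ) - 2) / 2) ^ 2 *
          (∫ x in Metric.ball (0 : EuclideanSpace ℝ (Fin n)) 1, u x ^ 2 / ‖x‖ ^ 2)
        + Cna *
          (∫ x in Metric.ball (0 : EuclideanSpace ℝ (Fin n)) 1,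
              (X1 a ‖x‖) ^ (2 * ((n : ℝ) - 1) / ((n : ℝ) - 2)) *
                |u x| ^ (2 * (n : ℝ) / ((n : ℝ) - 2)))
            ^ (((n : ℝ) - 2) / (n : ℝ)) := by
  have hn3 : (3 : ℝ) ≤ n := by exact_mod_cast hn
  have hm : (0 : ℝ) < n - 2 := by linarith
  have hS := sobolevConst_pos hn
  have : NeZero n := ⟨by omega⟩
  obtain ⟨R, hR, hR1, hs⟩ := hcs.exists_tsupport_subset_closedBall hsupp
  obtain ⟨k, hk, hkC, hkle⟩ := exists_scale_of_le hm ha0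
  have hu1 : ContDiff ℝ 1 u := hu.of_le (by exact_mod_cast le_top)
  have key := improved_hardy_sobolev hn hR hu1 hcs hs
  have hC : Cna = k ^ (-(2 * ((n : ℝ) - 1) / n)) * sobolevConst n := by
    rw [hCna, ← hkC, ite_mul, neg_div]
  set m : ℝ := n - 2 with hmdef
  set p : ℝ := 2 * ((n : ℝ) - 1) / m with hp
  set q : ℝ := 2 * (n : ℝ) / m with hq
  have hp0 : 0 < p := div_pos (by linarith) hm
  have hq0 : 0 < q := by positivity
  have hu0 : ∀ x, x ∉ Metric.ball (0 : EuclideanSpace ℝ (Fin n)) 1 → u x = 0 := fun x hx =>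
    image_eq_zero_of_notMem_tsupport fun h => hx (hsupp h)
  rw [setIntegral_eq_integral_of_forall_compl_eq_zero (f := fun x => ‖gradient u x‖ ^ 2)
      fun x hx => by simp [gradient_of_notMem_tsupport fun h => hx (hsupp h)],
    setIntegral_eq_integral_of_forall_compl_eq_zero (f := fun x => u x ^ 2 / ‖x‖ ^ 2)
      fun x hx => by simp [hu0 x hx],
    setIntegral_eq_integral_of_forall_compl_eq_zero (f := fun x => X1 a ‖x‖ ^ p * |u x| ^ q)
      fun x hx => by simp [hu0 x hx, zero_rpow hq0.ne']]
  have hnorm : ∀ x, |u x| ^ q ≠ 0 → ‖x‖ ≤ R := by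
    intro x hx
    by_contra h
    refine hx ?_
    rw [image_eq_zero_of_notMem_tsupport fun h' => h (mem_closedBall_zero_iff.1 (hs h')), abs_zero,
      zero_rpow hq0.ne']
  have hbase : ∀ x : EuclideanSpace ℝ (Fin n), x ≠ 0 → |u x| ^ q ≠ 0 →
      1 ≤ 1 - m * log (‖x‖ / R) ∧ 1 - m * log (‖x‖ / R) < k * (a - log ‖x‖) := by
    intro x hx hux
    have h1 := hnorm x hux
    have hx' : 0 < ‖x‖ := norm_pos_iff.2 hx
    have h2 : log (‖x‖ / R) ≤ 0 := log_nonpos (by positivity) ((div_le_one hR).2 h1)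
    have h3 : log (‖x‖ / R) = log ‖x‖ - log R := log_div hx'.ne' hR.ne'
    have h4 : log R < 0 := log_neg hR hR1
    have h5 := hkle (log ‖x‖) (log_nonpos hx'.le (h1.trans hR1.le))
    constructor <;> nlinarith
  obtain ⟨hI0, hI⟩ := integral_weight_mul_lt (μ := (volume : Measure (EuclideanSpace ℝ (Fin n))))
    (f := fun x => |u x| ^ q) (v := fun x => k ^ (-p) * X1 a ‖x‖ ^ p)
    (w := fun x => (1 - m * log (‖x‖ / R)) ^ (-p)) (C := 1)
    (hu.continuous.abs.rpow_const fun x => Or.inr hq0.le)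
    (hcs.mono fun x hx => fun h => hx (by simp [h, zero_rpow hq0.ne']))
    (fun x => by positivity)
    (fun h => hne (funext fun x => by
      have h1 : |u x| ^ q = 0 := congrFun h x
      exact abs_eq_zero.1 ((rpow_eq_zero (abs_nonneg _) hq0.ne').1 h1)))
    (by unfold X1; fun_prop) (by fun_prop)
    (fun x hx hux => by
      obtain ⟨h1, h2⟩ := hbase x hx hux
      have h3 : 0 < a - log ‖x‖ := pos_of_mul_pos_right (by linarith) hk.le
      unfold X1
      positivity)
    (fun x hx hux => by
      obtain ⟨h1, h2⟩ := hbase x hx hux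
      have h3 : 0 < a - log ‖x‖ := pos_of_mul_pos_right (by linarith) hk.le
      have h4 : k ^ (-p) * X1 a ‖x‖ ^ p = (k * (a - log ‖x‖)) ^ (-p) := by
        rw [mul_rpow hk.le h3.le, X1, inv_rpow h3.le, ← rpow_neg h3.le]
      simp only [h4]
      exact rpow_lt_rpow_of_neg (by linarith) h2 (by linarith))
    (fun x hx hux => rpow_le_one_of_one_le_of_nonpos (hbase x hx hux).1 (by linarith))
  have hI1 : ∫ x, k ^ (-p) * X1 a ‖x‖ ^ p * |u x| ^ q =
      k ^ (-p) * ∫ x, X1 a ‖x‖ ^ p * |u x| ^ q := by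
    simp only [mul_assoc]
    exact integral_const_mul _ _
  have hlt := mul_lt_mul_of_pos_left
    (rpow_lt_rpow hI0 hI (by positivity : 0 < m / (n : ℝ))) hS
  rw [hI1] at hI0 hlt
  rw [mul_rpow (by positivity) (nonneg_of_mul_nonneg_right hI0 (by positivity)),
    ← rpow_mul hk.le] at hlt
  have hexp : -p * (m / n) = -(2 * ((n : ℝ) - 1) / n) := by
    rw [hp]
    field_simp
  rw [hexp] at hlt
  rw [hC]
  linarith
end
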